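/- For every ε > 0 there exist η > 0 and n₀ ∈ ℕ such that for all n ≥ n₀ the following holds: every edge-colouring of the complete graph K_n that is (1−ε)n/2-bounded and locally ηn/(log n)⁴-bounded admits an ε-decomposition of K_n into Hamilton cycles each of which is rainbow. -/

import Mathlib

namespace Paper

variable {V : Type*} {W : Type*} {C : Type*}

/-- The set of edges of `G` receiving colour `c` under `φ`. -/
def colourCls (G : SimpleGraph V) (φ : Sym2 V → C) (c : C) : Set (Sym2 V) :=
  {e | e ∈ G.edgeSet ∧ φ e = c}

/-- `φ` is a (globally) `g`-bounded edge-colouring of `G`: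
every colour is used on at most `g` edges. -/
def GBounded (G : SimpleGraph V) (φ : Sym2 V → C) (g : ℝ) : Prop :=
  ∀ c : C, ((colourCls G φ c).ncard : ℝ) ≤ g

/-- `φ` is a locally `l`-bounded edge-colouring of `G`:
every vertex is incident to at most `l` edges of each colour. -/
def LBounded (G : SimpleGraph V) (φ : Sym2 V → C) (l : ℝ) : Prop :=
  ∀ (v : V) (c : C), (({u | G.Adj v u ∧ φ s(v, u) = c}).ncard : ℝ) ≤ l

/-- A set of edges is rainbow if the colouring is injective on it. -/
def Rainbow (φ : Sym2 V → C) (E : Set (Sym2 V)) : Prop :=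
  Set.InjOn φ E

/-- The set of common neighbours `w` of `u` and `v` with `φ(uw) = φ(vw)`. -/
def monoSet (G : SimpleGraph V) (φ : Sym2 V → C) (u v : V) : Set V :=
  {w | G.Adj u w ∧ G.Adj v w ∧ φ s(u, w) = φ s(v, w)}

/-- The monochromatic codegree `c^φ_G(u,v)`. -/
noncomputable def monoCodeg (G : SimpleGraph V) (φ : Sym2 V → C) (u v : V) : ℕ :=
  (monoSet G φ u v).ncard

/-- Degree of `u` into the set `S`. -/
noncomputable def degIn (G : SimpleGraph V) (u : V) (S : Set V) : ℕ :=
  (G.neighborSet u ∩ S).ncard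

/-- Codegree of `u,v` into the set `S`. -/
noncomputable def codegIn (G : SimpleGraph V) (u v : V) (S : Set V) : ℕ :=
  (G.neighborSet u ∩ G.neighborSet v ∩ S).ncard

/-- `G` restricted to `S` is `(ε,d)`-quasirandom: all degrees (within `S`)
are `(d ± ε)|S|` and all but at most `ε|S|²` unordered pairs of distinct
vertices of `S` have codegree (within `S`) equal to `(d² ± ε)|S|`. -/
def QuasirandomOn (G : SimpleGraph V) (S : Set V) (ε d : ℝ) : Prop :=
  (∀ v ∈ S, |(degIn G v S : ℝ) - d * S.ncard| ≤ ε * S.ncard) ∧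
  ((({p : Sym2 V | ∃ u v, p = s(u, v) ∧ u ≠ v ∧ u ∈ S ∧ v ∈ S ∧
        ¬ (|(codegIn G u v S : ℝ) - d ^ 2 * S.ncard| ≤ ε * S.ncard)}).ncard : ℝ)
      ≤ ε * (S.ncard : ℝ) ^ 2)

/-- `G` is `(ε,d)`-quasirandom. -/
def Quasirandom (G : SimpleGraph V) (ε d : ℝ) : Prop :=
  QuasirandomOn G Set.univ ε d

/-- Edges of `G` with one endpoint in `X` and the other in `Y`. -/
def edgesBetween (G : SimpleGraph V) (X Y : Set V) : Set (Sym2 V) :=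
  {e | e ∈ G.edgeSet ∧ ∃ u v, e = s(u, v) ∧ u ∈ X ∧ v ∈ Y}

/-- The pair `(A,B)` is `(ε,d)`-regular in `G`. -/
def RegularPair (G : SimpleGraph V) (A B : Set V) (ε d : ℝ) : Prop :=
  ∀ X ⊆ A, ∀ Y ⊆ B, ε * A.ncard ≤ (X.ncard : ℝ) → ε * B.ncard ≤ (Y.ncard : ℝ) →
    |((edgesBetween G X Y).ncard : ℝ) / ((X.ncard : ℝ) * (Y.ncard : ℝ)) - d| ≤ ε

/-- The pair `(A,B)` is `(ε,d)`-superregular in `G`. -/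
def SuperregularPair (G : SimpleGraph V) (A B : Set V) (ε d : ℝ) : Prop :=
  RegularPair G A B ε d ∧
  (∀ u ∈ A, |(degIn G u B : ℝ) - d * B.ncard| ≤ ε * B.ncard) ∧
  (∀ v ∈ B, |(degIn G v A : ℝ) - d * A.ncard| ≤ ε * A.ncard)

/-- `H` is a copy of `F`: a subgraph of `G` isomorphic to `F`. -/
def IsCopy (F : SimpleGraph W) {G : SimpleGraph V} (H : G.Subgraph) : Prop :=
  Nonempty (F ≃g H.coe)

/-- `L` is the union of the family `𝒞` of pairwise vertex-disjoint copies of `F`. -/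
def IsFactorFrom (F : SimpleGraph W) {G : SimpleGraph V} (L : G.Subgraph)
    (𝒞 : Set G.Subgraph) : Prop :=
  (∀ H ∈ 𝒞, IsCopy F H) ∧
  𝒞.Pairwise (fun H₁ H₂ => Disjoint H₁.verts H₂.verts) ∧
  L = sSup 𝒞

/-- `L` consists of vertex-disjoint copies of `F`. -/
def IsFFactorSub (F : SimpleGraph W) {G : SimpleGraph V} (L : G.Subgraph) : Prop :=
  ∃ 𝒞 : Set G.Subgraph, IsFactorFrom F L 𝒞

/-- An `ε`-decomposition: pairwise edge-disjoint subgraphs of `G` which together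
contain all but at most an `ε`-proportion of the edges of `G`. -/
def ApxDecomp (G : SimpleGraph V) (ε : ℝ) {t : ℕ} (L : Fin t → G.Subgraph) : Prop :=
  (Pairwise fun i j => Disjoint (L i).edgeSet (L j).edgeSet) ∧
  ((G.edgeSet \ ⋃ i, (L i).edgeSet).ncard : ℝ) ≤ ε * (G.edgeSet.ncard : ℝ)

/-- `a(F) ≤ a`, where `a(F) = max {Δ(F), a'(F), a''(F)}`. -/
def AParamLe (F : SimpleGraph W) (a : ℕ) : Prop :=
  (∀ v, (F.neighborSet v).ncard ≤ a) ∧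
  (∀ u v, F.Adj u v →
    (F.neighborSet u).ncard + (F.neighborSet v).ncard - 2 ≤ a) ∧
  (∀ u v w, F.Adj u v → F.Adj v w → u ≠ w →
    (F.neighborSet u).ncard + (F.neighborSet v).ncard + (F.neighborSet w).ncard - 4 ≤ a)

end Paper

namespace RainbowHam

set_option linter.unusedSectionVars false

open Finset

/-- A probability weight on a finite type. -/
structure Wt (Ω : Type*) [Fintype Ω] where
  w : Ω → ℝ
  nonneg : ∀ a, 0 ≤ w a
  sum_one : ∑ a, w a = 1

section Expectation

variable {σ Ω : Type*} [Fintype σ] [DecidableEq σ] [Fintype Ω]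

/-- Expectation over independent coordinates, each distributed according to `μ`. -/
noncomputable def Ex (μ : Wt Ω) (f : (σ → Ω) → ℝ) : ℝ := ∑ ω, (∏ s, μ.w (ω s)) * f ω

open Classical in
/-- Probability of an event. -/
noncomputable def Pr (μ : Wt Ω) (P : (σ → Ω) → Prop) : ℝ := Ex μ fun ω => if P ω then 1 else 0

/-- Averaging over the coordinate `s`. -/
noncomputable def avg (μ : Wt Ω) (s : σ) (f : (σ → Ω) → ℝ) : (σ → Ω) → ℝ :=
  fun ω => ∑ a, μ.w a * f (Function.update ω s a)

theorem prod_w_nonneg (μ : Wt Ω) (ω : σ → Ω) : 0 ≤ ∏ s, μ.w (ω s) :=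
  Finset.prod_nonneg fun _ _ => μ.nonneg _

theorem Ex_add (μ : Wt Ω) (f g : (σ → Ω) → ℝ) :
    Ex μ (fun ω => f ω + g ω) = Ex μ f + Ex μ g := by
  simp [Ex, mul_add, Finset.sum_add_distrib]

theorem Ex_const_mul (μ : Wt Ω) (c : ℝ) (f : (σ → Ω) → ℝ) :
    Ex μ (fun ω => c * f ω) = c * Ex μ f := by
  simp only [Ex, Finset.mul_sum]
  exact Finset.sum_congr rfl fun _ _ => by ring

theorem Ex_neg (μ : Wt Ω) (f : (σ → Ω) → ℝ) : Ex μ (fun ω => - f ω) = - Ex μ f := by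
  simp [Ex]

theorem Ex_sum {ι : Type*} (μ : Wt Ω) (t : Finset ι) (f : ι → (σ → Ω) → ℝ) :
    Ex μ (fun ω => ∑ i ∈ t, f i ω) = ∑ i ∈ t, Ex μ (f i) := by
  simp only [Ex, Finset.mul_sum]
  exact Finset.sum_comm

theorem Ex_mono (μ : Wt Ω) {f g : (σ → Ω) → ℝ} (h : ∀ ω, f ω ≤ g ω) : Ex μ f ≤ Ex μ g :=
  Finset.sum_le_sum fun ω _ => mul_le_mul_of_nonneg_left (h ω) (prod_w_nonneg μ ω)

theorem Ex_prod (μ : Wt Ω) (g : σ → Ω → ℝ) :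
    Ex μ (fun ω => ∏ s, g s (ω s)) = ∏ s, ∑ a, μ.w a * g s a := by
  simp only [Ex, ← Finset.prod_mul_distrib]
  rw [Finset.prod_univ_sum]
  simp

theorem Ex_const (μ : Wt Ω) (c : ℝ) : Ex μ (fun _ : σ → Ω => c) = c := by
  have h := Ex_prod (σ := σ) μ (fun _ _ => 1)
  simp only [Finset.prod_const_one, mul_one, μ.sum_one] at h
  have := Ex_const_mul (σ := σ) μ c (fun _ => 1)
  simpa [h] using this

theorem prod_w_update (μ : Wt Ω) (ω : σ → Ω) (s : σ) (a : Ω) :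
    (∏ x, μ.w (Function.update ω s a x)) * μ.w (ω s) = (∏ x, μ.w (ω x)) * μ.w a := by
  rw [← Finset.mul_prod_erase _ _ (Finset.mem_univ s), ← Finset.mul_prod_erase
    (f := fun x => μ.w (ω x)) _ (Finset.mem_univ s)]
  have : ∏ x ∈ univ.erase s, μ.w (Function.update ω s a x) = ∏ x ∈ univ.erase s, μ.w (ω x) :=
    Finset.prod_congr rfl fun x hx => by
      rw [Function.update_of_ne (Finset.ne_of_mem_erase hx)]
  rw [this]
  simp
  ring

theorem Ex_avg (μ : Wt Ω) (s : σ) (f : (σ → Ω) → ℝ) : Ex μ (avg μ s f) = Ex μ f := by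
  let e : (σ → Ω) × Ω ≃ (σ → Ω) × Ω :=
    { toFun := fun p => (Function.update p.1 s p.2, p.1 s)
      invFun := fun p => (Function.update p.1 s p.2, p.1 s)
      left_inv := fun p => by ext <;> simp
      right_inv := fun p => by ext <;> simp }
  have h1 : Ex μ (avg μ s f) =
      ∑ p : (σ → Ω) × Ω, (∏ x, μ.w (p.1 x)) * μ.w p.2 * f (Function.update p.1 s p.2) := by
    rw [Fintype.sum_prod_type]
    simp only [Ex, avg, Finset.mul_sum]
    exact Finset.sum_congr rfl fun _ _ => Finset.sum_congr rfl fun _ _ => by ring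
  have h2 : Ex μ f = ∑ p : (σ → Ω) × Ω, (∏ x, μ.w (p.1 x)) * μ.w p.2 * f p.1 := by
    rw [Fintype.sum_prod_type]
    simp only [Ex]
    refine Finset.sum_congr rfl fun ω _ => ?_
    rw [← Finset.sum_mul, ← Finset.mul_sum, μ.sum_one, mul_one]
  rw [h1, h2]
  refine Fintype.sum_equiv e _ _ fun p => ?_
  simp only [e, Equiv.coe_fn_mk]
  rw [prod_w_update]

theorem Pr_mono (μ : Wt Ω) {P Q : (σ → Ω) → Prop} (h : ∀ ω, P ω → Q ω) : Pr μ P ≤ Pr μ Q := by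
  refine Ex_mono μ fun ω => ?_
  by_cases hp : P ω
  · simp [hp, h ω hp]
  · simp only [hp, if_false]; split_ifs <;> norm_num

theorem Pr_or_le (μ : Wt Ω) (P Q : (σ → Ω) → Prop) :
    Pr μ (fun ω => P ω ∨ Q ω) ≤ Pr μ P + Pr μ Q := by
  rw [Pr, Pr, Pr, ← Ex_add]
  refine Ex_mono μ fun ω => ?_
  by_cases hp : P ω <;> by_cases hq : Q ω <;> simp [hp, hq]

theorem Pr_exists_le {ι : Type*} [Fintype ι] (μ : Wt Ω) (P : ι → (σ → Ω) → Prop) :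
    Pr μ (fun ω => ∃ i, P i ω) ≤ ∑ i, Pr μ (P i) := by
  classical
  simp only [Pr]
  rw [← Ex_sum]
  refine Ex_mono μ fun ω => ?_
  by_cases h : ∃ i, P i ω
  · obtain ⟨i, hi⟩ := h
    rw [if_pos ⟨i, hi⟩]
    calc (1 : ℝ) = if P i ω then 1 else 0 := by simp [hi]
      _ ≤ _ := Finset.single_le_sum (f := fun i => if P i ω then (1 : ℝ) else 0)
          (fun j _ => by split_ifs <;> norm_num) (Finset.mem_univ i)
  · rw [if_neg h]
    exact Finset.sum_nonneg fun j _ => by split_ifs <;> norm_num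

theorem exists_not_of_Pr_lt_one (μ : Wt Ω) {P : (σ → Ω) → Prop} (h : Pr μ P < 1) :
    ∃ ω, ¬ P ω := by
  by_contra! hc
  have : Pr μ P = 1 := by
    simp only [Pr, hc, if_true]
    exact Ex_const μ 1
  linarith

theorem Pr_le_of_exp (μ : Wt Ω) {P : (σ → Ω) → Prop} {g : (σ → Ω) → ℝ}
    (h : ∀ ω, P ω → 0 ≤ g ω) : Pr μ P ≤ Ex μ fun ω => Real.exp (g ω) := by
  refine Ex_mono μ fun ω => ?_
  by_cases hp : P ω
  · simpa [hp] using h ω hp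
  · simpa [hp] using (Real.exp_pos _).le

/-- Changing the coordinate `s` changes `f` by at most `c`. -/
def Lip (f : (σ → Ω) → ℝ) (s : σ) (c : ℝ) : Prop :=
  ∀ ω a, |f (Function.update ω s a) - f ω| ≤ c

theorem Lip.pair {f : (σ → Ω) → ℝ} {s : σ} {c : ℝ} (h : Lip f s c) (ω : σ → Ω) (a b : Ω) :
    |f (Function.update ω s a) - f (Function.update ω s b)| ≤ c := by
  have := h (Function.update ω s b) a
  simpa using this

theorem Lip.zero_iff {f : (σ → Ω) → ℝ} {s : σ} :
    Lip f s 0 ↔ ∀ ω a, f (Function.update ω s a) = f ω := by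
  unfold Lip
  constructor
  · intro h ω a
    have := abs_nonpos_iff.1 (h ω a)
    linarith
  · intro h ω a
    simp [h]

theorem eq_of_forall_Lip_zero {f : (σ → Ω) → ℝ} (h : ∀ s, Lip f s 0) (ω ω' : σ → Ω) :
    f ω = f ω' := by
  have key : ∀ T : Finset σ, f (fun s => if s ∈ T then ω s else ω' s) = f ω' := by
    intro T
    induction T using Finset.induction_on with
    | empty => simp
    | insert s T hs ih =>
      rw [← ih, ← Lip.zero_iff.1 (h s) (fun s => if s ∈ T then ω s else ω' s) (ω s)]
      congr 1
      ext x
      by_cases hx : x = s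
      · subst hx; simp
      · simp [hx]
  have := key Finset.univ
  simpa using this

theorem avg_Lip_self (μ : Wt Ω) (s : σ) (f : (σ → Ω) → ℝ) : Lip (avg μ s f) s 0 := by
  rw [Lip.zero_iff]
  intro ω a
  simp [avg]

theorem avg_Lip (μ : Wt Ω) (s x : σ) (f : (σ → Ω) → ℝ) {c : ℝ} (h : Lip f x c) (hc : 0 ≤ c) :
    Lip (avg μ s f) x c := by
  by_cases hx : x = s
  · subst hx
    intro ω a
    have := avg_Lip_self μ x f ω a
    linarith
  intro ω a
  simp only [avg]
  rw [← Finset.sum_sub_distrib]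
  calc _ ≤ ∑ b, |μ.w b * f (Function.update (Function.update ω x a) s b)
            - μ.w b * f (Function.update ω s b)| := Finset.abs_sum_le_sum_abs _ _
    _ ≤ ∑ b, μ.w b * c := by
        refine Finset.sum_le_sum fun b _ => ?_
        rw [← mul_sub, abs_mul, abs_of_nonneg (μ.nonneg b)]
        refine mul_le_mul_of_nonneg_left ?_ (μ.nonneg b)
        rw [Function.update_comm hx]
        exact h _ _
    _ = c := by rw [← Finset.sum_mul, μ.sum_one, one_mul]

/-- `μ` satisfies a variance bound with factor `v`. -/
def VarF (μ : Wt Ω) (v : ℝ) : Prop :=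
  ∀ (g : Ω → ℝ) (c : ℝ), (∀ a b, |g a - g b| ≤ c) →
    ∑ a, μ.w a * (g a - ∑ b, μ.w b * g b) ^ 2 ≤ v * c ^ 2

theorem Wt.abs_sub_mean_le (μ : Wt Ω) {g : Ω → ℝ} {c : ℝ} (h : ∀ a b, |g a - g b| ≤ c) (a : Ω) :
    |g a - ∑ b, μ.w b * g b| ≤ c := by
  have : g a - ∑ b, μ.w b * g b = ∑ b, μ.w b * (g a - g b) := by
    simp only [mul_sub, Finset.sum_sub_distrib, ← Finset.sum_mul, μ.sum_one, one_mul]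
  rw [this]
  calc _ ≤ ∑ b, |μ.w b * (g a - g b)| := Finset.abs_sum_le_sum_abs _ _
    _ ≤ ∑ b, μ.w b * c := Finset.sum_le_sum fun b _ => by
        rw [abs_mul, abs_of_nonneg (μ.nonneg b)]
        exact mul_le_mul_of_nonneg_left (h a b) (μ.nonneg b)
    _ = c := by rw [← Finset.sum_mul, μ.sum_one, one_mul]

theorem varF_one (μ : Wt Ω) : VarF μ 1 := by
  intro g c h
  calc _ ≤ ∑ a, μ.w a * c ^ 2 := Finset.sum_le_sum fun a _ =>
        mul_le_mul_of_nonneg_left (sq_le_sq' (by linarith [abs_le.1 (μ.abs_sub_mean_le h a)])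
          (abs_le.1 (μ.abs_sub_mean_le h a)).2) (μ.nonneg a)
    _ = 1 * c ^ 2 := by rw [← Finset.sum_mul, μ.sum_one]

theorem mgf_single (μ : Wt Ω) {v : ℝ} (hv : VarF μ v) {g : Ω → ℝ} {c l : ℝ}
    (h : ∀ a b, |g a - g b| ≤ c) (hl : |l| * c ≤ 1) :
    ∑ a, μ.w a * Real.exp (l * (g a - ∑ b, μ.w b * g b)) ≤ Real.exp (l ^ 2 * v * c ^ 2) := by
  set m := ∑ b, μ.w b * g b with hm
  have h1 : ∀ a, Real.exp (l * (g a - m)) ≤ 1 + l * (g a - m) + l ^ 2 * (g a - m) ^ 2 := by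
    intro a
    have hb : |l * (g a - m)| ≤ 1 := by
      rw [abs_mul]
      exact (mul_le_mul_of_nonneg_left (μ.abs_sub_mean_le h a) (abs_nonneg l)).trans hl
    have := (abs_le.1 (Real.abs_exp_sub_one_sub_id_le hb)).2
    nlinarith
  calc _ ≤ ∑ a, μ.w a * (1 + l * (g a - m) + l ^ 2 * (g a - m) ^ 2) :=
        Finset.sum_le_sum fun a _ => mul_le_mul_of_nonneg_left (h1 a) (μ.nonneg a)
    _ = (∑ a, μ.w a) + l * ((∑ a, μ.w a * g a) - m * ∑ a, μ.w a) +
          l ^ 2 * ∑ a, μ.w a * (g a - m) ^ 2 := by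
        simp only [Finset.mul_sum, ← Finset.sum_sub_distrib, ← Finset.sum_add_distrib]
        exact Finset.sum_congr rfl fun _ _ => by ring
    _ ≤ 1 + l ^ 2 * (v * c ^ 2) := by
        rw [μ.sum_one, ← hm]
        have := mul_le_mul_of_nonneg_left (hv g c h) (sq_nonneg l)
        linarith
    _ ≤ _ := by
        have := Real.add_one_le_exp (l ^ 2 * v * c ^ 2)
        linarith

theorem Ex_exp_le (μ : Wt Ω) {v : ℝ} (hv : VarF μ v) {l : ℝ} (f : (σ → Ω) → ℝ) (c : σ → ℝ)
    (hc : ∀ s, 0 ≤ c s) (hf : ∀ s, Lip f s (c s)) (hl : ∀ s, |l| * c s ≤ 1) :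
    Ex μ (fun ω => Real.exp (l * (f ω - Ex μ f))) ≤ Real.exp (l ^ 2 * v * ∑ s, c s ^ 2) := by
  suffices H : ∀ (T : Finset σ) (f : (σ → Ω) → ℝ) (c : σ → ℝ), (∀ s, s ∉ T → c s = 0) →
      (∀ s, 0 ≤ c s) → (∀ s, Lip f s (c s)) → (∀ s, |l| * c s ≤ 1) →
      Ex μ (fun ω => Real.exp (l * (f ω - Ex μ f))) ≤ Real.exp (l ^ 2 * v * ∑ s ∈ T, c s ^ 2) from
    H Finset.univ f c (fun s hs => absurd (Finset.mem_univ s) hs) hc hf hl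
  intro T
  induction T using Finset.induction_on with
  | empty =>
    intro f c h0 _ hf _
    have hconst : ∀ ω, f ω = Ex μ f := by
      intro ω
      have : f = fun _ => f ω := by
        ext ω'
        exact eq_of_forall_Lip_zero (fun s => by simpa [h0 s (by simp)] using hf s) ω' ω
      rw [this, Ex_const]
    have : ∀ ω, f ω - Ex μ f = 0 := fun ω => by linarith [hconst ω]
    simp [this, Ex_const]
  | insert s T hs ih =>
    intro f c h0 hc hf hl
    have hg := ih (avg μ s f) (Function.update c s 0) (fun x hx => by
        by_cases hxs : x = s
        · simp [hxs]
        · simp only [Function.update_of_ne hxs]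
          exact h0 x (by simp [hxs, hx]))
      (fun x => by
        by_cases hxs : x = s
        · simp [hxs]
        · simpa only [Function.update_of_ne hxs] using hc x)
      (fun x => by
        by_cases hxs : x = s
        · subst hxs; simpa using avg_Lip_self μ x f
        · simpa only [Function.update_of_ne hxs] using avg_Lip μ s x f (hf x) (hc x))
      (fun x => by
        by_cases hxs : x = s
        · simp [hxs]
        · simpa only [Function.update_of_ne hxs] using hl x)
    rw [Ex_avg] at hg
    have hsum : ∑ x ∈ T, Function.update c s 0 x ^ 2 = ∑ x ∈ T, c x ^ 2 :=
      Finset.sum_congr rfl fun x hx => by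
        rw [Function.update_of_ne (ne_of_mem_of_not_mem hx hs)]
    rw [hsum] at hg
    rw [Finset.sum_insert hs, mul_add, Real.exp_add, ← Ex_avg μ s]
    calc _ ≤ Ex μ (fun ω => Real.exp (l ^ 2 * v * c s ^ 2) *
            Real.exp (l * (avg μ s f ω - Ex μ f))) := by
          refine Ex_mono μ fun ω => ?_
          have h1 := mgf_single μ hv (g := fun a => f (Function.update ω s a))
            (fun a b => (hf s).pair ω a b) (hl s)
          have h2 : avg μ s (fun ω => Real.exp (l * (f ω - Ex μ f))) ω =
              (∑ a, μ.w a * Real.exp (l * (f (Function.update ω s a) -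
                ∑ b, μ.w b * f (Function.update ω s b)))) *
                  Real.exp (l * (avg μ s f ω - Ex μ f)) := by
            simp only [avg, Finset.sum_mul]
            refine Finset.sum_congr rfl fun a _ => ?_
            rw [mul_assoc, ← Real.exp_add]
            congr 2
            ring
          rw [h2]
          exact mul_le_mul_of_nonneg_right h1 (Real.exp_pos _).le
      _ = _ := Ex_const_mul _ _ _
      _ ≤ _ := mul_le_mul_of_nonneg_left hg (Real.exp_pos _).le

/-- Upper tail bound for Lipschitz functions of independent coordinates. -/
theorem Pr_upper_tail (μ : Wt Ω) {v : ℝ} (hv : VarF μ v) (hv0 : 0 ≤ v) (f : (σ → Ω) → ℝ)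
    (c : σ → ℝ) {L A t : ℝ} (hL : 0 < L) (hA : 0 < A) (ht : 0 ≤ t) (htA : t ≤ 2 * A)
    (hc : ∀ s, 0 ≤ c s) (hcL : ∀ s, c s ≤ L) (hf : ∀ s, Lip f s (c s))
    (hsum : v * ∑ s, c s ≤ A) :
    Pr μ (fun ω => Ex μ f + t < f ω) ≤ Real.exp (-(t ^ 2 / (4 * A * L))) := by
  set l := t / (2 * A * L) with hl
  have hl0 : 0 ≤ l := by positivity
  have h1 := Ex_exp_le μ hv (l := l) f c hc hf (fun s => by
    rw [abs_of_nonneg hl0]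
    calc l * c s ≤ l * L := mul_le_mul_of_nonneg_left (hcL s) hl0
      _ = t / (2 * A) := by rw [hl]; field_simp
      _ ≤ 1 := by rw [div_le_one (by positivity)]; exact htA)
  calc _ ≤ Ex μ (fun ω => Real.exp (l * (f ω - Ex μ f - t))) :=
        Pr_le_of_exp μ fun ω h => mul_nonneg hl0 (by linarith)
    _ = Ex μ (fun ω => Real.exp (-(l * t)) * Real.exp (l * (f ω - Ex μ f))) := by
        congr 1; ext ω; rw [← Real.exp_add]; congr 1; ring
    _ = Real.exp (-(l * t)) * Ex μ (fun ω => Real.exp (l * (f ω - Ex μ f))) := Ex_const_mul _ _ _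
    _ ≤ Real.exp (-(l * t)) * Real.exp (l ^ 2 * v * ∑ s, c s ^ 2) :=
        mul_le_mul_of_nonneg_left h1 (Real.exp_pos _).le
    _ ≤ _ := by
        rw [← Real.exp_add]
        apply Real.exp_le_exp.2
        have h2 : ∑ s, c s ^ 2 ≤ L * ∑ s, c s := by
          rw [Finset.mul_sum]
          exact Finset.sum_le_sum fun s _ => by
            rw [sq]; exact mul_le_mul_of_nonneg_right (hcL s) (hc s)
        have h3 : v * ∑ s, c s ^ 2 ≤ L * A := by
          calc _ ≤ v * (L * ∑ s, c s) := mul_le_mul_of_nonneg_left h2 hv0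
            _ = L * (v * ∑ s, c s) := by ring
            _ ≤ _ := mul_le_mul_of_nonneg_left hsum hL.le
        have h4 : l ^ 2 * (v * ∑ s, c s ^ 2) ≤ l ^ 2 * (L * A) :=
          mul_le_mul_of_nonneg_left h3 (sq_nonneg l)
        have h5 : l ^ 2 * (L * A) - l * t = -(t ^ 2 / (4 * A * L)) := by
          rw [hl]; field_simp; ring
        linarith

/-- Lower tail bound for Lipschitz functions of independent coordinates. -/
theorem Pr_lower_tail (μ : Wt Ω) {v : ℝ} (hv : VarF μ v) (hv0 : 0 ≤ v) (f : (σ → Ω) → ℝ)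
    (c : σ → ℝ) {L A t : ℝ} (hL : 0 < L) (hA : 0 < A) (ht : 0 ≤ t) (htA : t ≤ 2 * A)
    (hc : ∀ s, 0 ≤ c s) (hcL : ∀ s, c s ≤ L) (hf : ∀ s, Lip f s (c s))
    (hsum : v * ∑ s, c s ≤ A) :
    Pr μ (fun ω => f ω < Ex μ f - t) ≤ Real.exp (-(t ^ 2 / (4 * A * L))) := by
  have := Pr_upper_tail μ hv hv0 (fun ω => - f ω) c hL hA ht htA hc hcL (fun s ω a => by
    rw [neg_sub_neg, abs_sub_comm]; exact hf s ω a) hsum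
  rw [Ex_neg] at this
  refine le_trans (Pr_mono μ fun ω h => ?_) this
  linarith

end Expectation

section Bernoulli

/-- The Bernoulli weight. -/
def bern (p : ℝ) (h0 : 0 ≤ p) (h1 : p ≤ 1) : Wt Bool where
  w b := if b then p else 1 - p
  nonneg b := by cases b <;> simp [h0, h1]
  sum_one := by simp

variable {σ : Type*} [Fintype σ] [DecidableEq σ] {p : ℝ} {h0 : 0 ≤ p} {h1 : p ≤ 1}

theorem varF_bern : VarF (bern p h0 h1) p := by
  intro g c h
  have hc : (g true - g false) ^ 2 ≤ c ^ 2 :=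
    sq_le_sq' (by linarith [abs_le.1 (h true false)]) (abs_le.1 (h true false)).2
  simp only [bern, Fintype.sum_bool, if_true, Bool.false_eq_true, if_false]
  have : p * (g true - (p * g true + (1 - p) * g false)) ^ 2 +
      (1 - p) * (g false - (p * g true + (1 - p) * g false)) ^ 2 =
      p * (1 - p) * (g true - g false) ^ 2 := by ring
  rw [this]
  have h2 : p * (1 - p) * (g true - g false) ^ 2 ≤ p * 1 * c ^ 2 := by
    apply mul_le_mul _ hc (sq_nonneg _) (by linarith)
    exact mul_le_mul_of_nonneg_left (by linarith) h0
  linarith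

theorem exp_sub_one_le_two_mul {y : ℝ} (hy : 0 ≤ y) (hy1 : y ≤ 1) : Real.exp y - 1 ≤ 2 * y := by
  have := (abs_le.1 (Real.abs_exp_sub_one_sub_id_le (x := y) (by rw [abs_of_nonneg hy]; exact hy1))).2
  nlinarith

/-- Exponential supermartingale bound for a predictable sum of Bernoulli variables. -/
theorem Ex_exp_predictable_le {l : ℝ} (hl : 0 ≤ l) (rk : σ → ℕ) (w : σ → (σ → Bool) → ℝ)
    (T : Finset σ)
    (hw : ∀ s ω, 0 ≤ w s ω) (hlw : ∀ s ω, l * w s ω ≤ 1)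
    (hind : ∀ s ∈ T, ∀ x ∈ T, rk s ≤ rk x → ∀ ω a, w s (Function.update ω x a) = w s ω) :
    Ex (bern p h0 h1) (fun ω => Real.exp (∑ s ∈ T,
      (l * (if ω s then w s ω else 0) - 2 * l * p * w s ω))) ≤ 1 := by
  induction T using Finset.induction_on_max_value rk with
  | empty => simp [Ex_const]
  | insert s T hs hmax ih =>
    have ih := ih fun x hx y hy => hind x (mem_insert_of_mem hx) y (mem_insert_of_mem hy)
    refine le_trans ?_ ih
    rw [← Ex_avg _ s]
    refine Ex_mono _ fun ω => ?_
    have hT : ∀ a, ∑ x ∈ T, (l * (if Function.update ω s a x then w x (Function.update ω s a)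
          else 0) - 2 * l * p * w x (Function.update ω s a)) =
        ∑ x ∈ T, (l * (if ω x then w x ω else 0) - 2 * l * p * w x ω) := by
      intro a
      refine Finset.sum_congr rfl fun x hx => ?_
      rw [hind x (mem_insert_of_mem hx) s (mem_insert_self _ _) (hmax x hx),
        Function.update_of_ne (ne_of_mem_of_not_mem hx hs)]
    have hs' := hind s (mem_insert_self _ _) s (mem_insert_self _ _) le_rfl ω
    simp only [avg, Finset.sum_insert hs, hT, hs', Function.update_self, bern, Fintype.sum_bool,
      if_true, Bool.false_eq_true, if_false, Real.exp_add]
    set E := Real.exp (∑ x ∈ T, (l * (if ω x then w x ω else 0) - 2 * l * p * w x ω))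
    have hE : 0 < E := Real.exp_pos _
    have hy := exp_sub_one_le_two_mul (mul_nonneg hl (hw s ω)) (hlw s ω)
    have e1 : Real.exp (l * w s ω - 2 * l * p * w s ω) =
        Real.exp (l * w s ω) * Real.exp (-(2 * l * p * w s ω)) := by
      rw [← Real.exp_add]; rfl
    have e2 : Real.exp (l * 0 - 2 * l * p * w s ω) = Real.exp (-(2 * l * p * w s ω)) := by
      congr 1; ring
    rw [e1, e2]
    set D := Real.exp (-(2 * l * p * w s ω)) with hD
    have hD0 : 0 < D := Real.exp_pos _
    have hD1 : D * (1 + 2 * l * p * w s ω) ≤ 1 := by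
      have h3 := Real.add_one_le_exp (2 * l * p * w s ω)
      calc D * (1 + 2 * l * p * w s ω) ≤ D * Real.exp (2 * l * p * w s ω) :=
            mul_le_mul_of_nonneg_left (by linarith) hD0.le
        _ = 1 := by rw [hD, ← Real.exp_add]; simp
    have h4 : p * Real.exp (l * w s ω) + (1 - p) ≤ 1 + 2 * l * p * w s ω := by nlinarith
    calc _ = (D * (p * Real.exp (l * w s ω) + (1 - p))) * E := by ring
      _ ≤ (D * (1 + 2 * l * p * w s ω)) * E :=
        mul_le_mul_of_nonneg_right (mul_le_mul_of_nonneg_left h4 hD0.le) hE.le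
      _ ≤ 1 * E := mul_le_mul_of_nonneg_right hD1 hE.le
      _ = E := one_mul _

theorem Pr_predictable_tail {m t : ℝ} (hm : 0 < m) (rk : σ → ℕ) (w : σ → (σ → Bool) → ℝ)
    (T : Finset σ) (hw : ∀ s ω, 0 ≤ w s ω) (hwm : ∀ s ω, w s ω ≤ m)
    (hind : ∀ s ∈ T, ∀ x ∈ T, rk s ≤ rk x → ∀ ω a, w s (Function.update ω x a) = w s ω) :
    Pr (bern p h0 h1) (fun ω => 2 * p * ∑ s ∈ T, w s ω + t < ∑ s ∈ T, if ω s then w s ω else 0)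
      ≤ Real.exp (-(t / m)) := by
  have h := Ex_exp_predictable_le (p := p) (h0 := h0) (h1 := h1) (l := 1 / m) (by positivity)
    rk w T hw (fun s ω => by
      rw [one_div, inv_mul_le_iff₀ hm, mul_one]; exact hwm s ω) hind
  calc _ ≤ Ex (bern p h0 h1) (fun ω => Real.exp (-(t / m) + ∑ s ∈ T,
      ((1 / m) * (if ω s then w s ω else 0) - 2 * (1 / m) * p * w s ω))) := by
        refine Pr_le_of_exp _ fun ω hω => ?_
        rw [Finset.sum_sub_distrib, ← Finset.mul_sum, ← Finset.mul_sum]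
        have : -(t / m) + (1 / m * (∑ s ∈ T, if ω s then w s ω else 0)
            - 2 * (1 / m) * p * ∑ s ∈ T, w s ω) =
            ((∑ s ∈ T, if ω s then w s ω else 0) - (2 * p * ∑ s ∈ T, w s ω + t)) / m := by
          field_simp; ring
        rw [this]
        exact div_nonneg (by linarith) hm.le
    _ = Real.exp (-(t / m)) * _ := by
        rw [← Ex_const_mul]; simp only [Real.exp_add]
    _ ≤ Real.exp (-(t / m)) * 1 := mul_le_mul_of_nonneg_left h (Real.exp_pos _).le
    _ = _ := mul_one _

end Bernoulli

section Cover

variable {X σ F : Type*} [Fintype X] [DecidableEq X] [Fintype σ] [DecidableEq σ]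
  {p : ℝ} {h0 : 0 ≤ p} {h1 : p ≤ 1}

/-- The points not hit by any of the chosen sets. -/
def unhit (hs : σ → Finset X) (ω : σ → Bool) : Finset X :=
  univ.filter fun x => ∀ s, ω s = true → x ∉ hs s

/-- The indices of the sets meeting `A`. -/
def hitters (hs : σ → Finset X) (A : Finset X) : Finset σ :=
  univ.filter fun s => ¬ Disjoint A (hs s)

theorem subset_unhit_iff (hs : σ → Finset X) (ω : σ → Bool) (A : Finset X) :
    A ⊆ unhit hs ω ↔ ∀ s ∈ hitters hs A, ω s = false := by
  simp only [unhit, hitters, mem_filter, mem_univ, true_and, subset_iff, Finset.disjoint_left,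
    not_forall, not_not]
  constructor
  · rintro h s ⟨x, hx, hxs⟩
    by_contra hw
    exact h hx s (by simpa using hw) hxs
  · intro h x hx s hw hxs
    have := h s ⟨x, hx, hxs⟩
    simp [hw] at this

theorem Ex_none (T : Finset σ) :
    Ex (bern p h0 h1) (fun ω => if ∀ s ∈ T, ω s = false then 1 else 0) = (1 - p) ^ T.card := by
  have h : ∀ ω : σ → Bool, (if ∀ s ∈ T, ω s = false then (1 : ℝ) else 0) =
      ∏ s, if s ∈ T ∧ ω s = true then (0 : ℝ) else 1 := by
    intro ω
    split_ifs with hT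
    · symm
      refine Finset.prod_eq_one fun s _ => ?_
      rw [if_neg]
      rintro ⟨hs, hw⟩
      simp [hT s hs] at hw
    · push Not at hT
      obtain ⟨s, hs, hw⟩ := hT
      symm
      refine Finset.prod_eq_zero (mem_univ s) ?_
      rw [if_pos ⟨hs, by simpa using hw⟩]
  simp only [h]
  rw [Ex_prod _ (fun s a => if s ∈ T ∧ a = true then (0 : ℝ) else 1)]
  have h2 : ∀ s, ∑ a, (bern p h0 h1).w a * (if s ∈ T ∧ a = true then (0 : ℝ) else 1) =
      if s ∈ T then 1 - p else 1 := by
    intro s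
    by_cases hs : s ∈ T <;> simp [bern, hs]
  simp only [h2, Finset.prod_ite_mem, Finset.univ_inter, Finset.prod_const]

/-- Total weight of the sets `A f` that are not hit. -/
def unhitWt (hs : σ → Finset X) (E : Finset F) (A : F → Finset X) (w : F → ℝ) (ω : σ → Bool) : ℝ :=
  ∑ f ∈ E, w f * if A f ⊆ unhit hs ω then 1 else 0

theorem Ex_unhitWt (hs : σ → Finset X) (E : Finset F) (A : F → Finset X) (w : F → ℝ) :
    Ex (bern p h0 h1) (unhitWt hs E A w) =
      ∑ f ∈ E, w f * (1 - p) ^ (hitters hs (A f)).card := by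
  unfold unhitWt
  rw [Ex_sum]
  refine Finset.sum_congr rfl fun f _ => ?_
  rw [Ex_const_mul]
  congr 1
  simp only [subset_unhit_iff]
  exact Ex_none _

theorem unhitWt_Lip (hs : σ → Finset X) (E : Finset F) (A : F → Finset X) (w : F → ℝ)
    (hw : ∀ f ∈ E, 0 ≤ w f) (s : σ) :
    Lip (unhitWt hs E A w) s (∑ f ∈ E, if ¬ Disjoint (A f) (hs s) then w f else 0) := by
  intro ω a
  unfold unhitWt
  rw [← Finset.sum_sub_distrib]
  refine (Finset.abs_sum_le_sum_abs _ _).trans (Finset.sum_le_sum fun f hf => ?_)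
  rw [← mul_sub, abs_mul, abs_of_nonneg (hw f hf)]
  by_cases hd : Disjoint (A f) (hs s)
  · have : A f ⊆ unhit hs (Function.update ω s a) ↔ A f ⊆ unhit hs ω := by
      rw [subset_unhit_iff, subset_unhit_iff]
      refine forall₂_congr fun x hx => ?_
      rw [Function.update_of_ne]
      rintro rfl
      simp [hitters, hd] at hx
    simp [this, hd]
  · rw [if_pos hd]
    have : |(if A f ⊆ unhit hs (Function.update ω s a) then (1 : ℝ) else 0) -
        if A f ⊆ unhit hs ω then 1 else 0| ≤ 1 := by
      split_ifs <;> simp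
    exact mul_le_of_le_one_right (hw f hf) this

theorem unhitWt_tail (hs : σ → Finset X) (E : Finset F) (A : F → Finset X) (w : F → ℝ)
    (hw : ∀ f ∈ E, 0 ≤ w f) {L B t : ℝ} (hL : 0 < L) (hB : 0 < B) (ht : 0 ≤ t) (htB : t ≤ 2 * B)
    (hcL : ∀ s, ∑ f ∈ E, (if ¬ Disjoint (A f) (hs s) then w f else 0) ≤ L)
    (hsum : p * ∑ f ∈ E, w f * (hitters hs (A f)).card ≤ B) :
    Pr (bern p h0 h1) (fun ω => ∑ f ∈ E, w f * (1 - p) ^ (hitters hs (A f)).card + t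
        < unhitWt hs E A w ω) ≤ Real.exp (-(t ^ 2 / (4 * B * L))) ∧
    Pr (bern p h0 h1) (fun ω => unhitWt hs E A w ω <
        ∑ f ∈ E, w f * (1 - p) ^ (hitters hs (A f)).card - t)
        ≤ Real.exp (-(t ^ 2 / (4 * B * L))) := by
  rw [← Ex_unhitWt (h0 := h0) (h1 := h1)]
  have hsw : ∑ s, ∑ f ∈ E, (if ¬ Disjoint (A f) (hs s) then w f else 0) =
      ∑ f ∈ E, w f * (hitters hs (A f)).card := by
    rw [Finset.sum_comm]
    refine Finset.sum_congr rfl fun f _ => ?_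
    rw [← Finset.sum_filter, Finset.sum_const, hitters, nsmul_eq_mul, mul_comm]
  have hnn : ∀ s, 0 ≤ ∑ f ∈ E, (if ¬ Disjoint (A f) (hs s) then w f else 0) := fun s =>
    Finset.sum_nonneg fun f hf => by split_ifs <;> simp [hw f hf]
  exact ⟨Pr_upper_tail _ varF_bern h0 _ _ hL hB ht htB hnn hcL (unhitWt_Lip hs E A w hw)
      (by rw [hsw]; exact hsum),
    Pr_lower_tail _ varF_bern h0 _ _ hL hB ht htB hnn hcL (unhitWt_Lip hs E A w hw)
      (by rw [hsw]; exact hsum)⟩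

end Cover

section Round

variable {X ι : Type*} [Fintype X] [DecidableEq X] [Fintype ι] [DecidableEq ι]

/-- Number of edges of the hypergraph `H` inside `Y` that contain `x`. -/
def dg (H : ι → Finset X) (Y : Finset X) (x : X) : ℕ :=
  (univ.filter fun f => x ∈ H f ∧ H f ⊆ Y).card

/-- The hitting sets: the edges inside `Y` and dummy singletons making all degrees equal `Δ`. -/
def hset (H : ι → Finset X) (Y : Finset X) (Δ : ℕ) : ι ⊕ (X × Fin Δ) → Finset X
  | Sum.inl f => if H f ⊆ Y then H f else ∅
  | Sum.inr q => if q.1 ∈ Y ∧ (q.2 : ℕ) < Δ - dg H Y q.1 then {q.1} else ∅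

variable {H : ι → Finset X} {Y : Finset X} {Δ : ℕ}

theorem mem_hset_inl {f : ι} {x : X} : x ∈ hset H Y Δ (Sum.inl f) ↔ x ∈ H f ∧ H f ⊆ Y := by
  simp only [hset]
  split_ifs with h <;> simp [h]

theorem mem_hset_inr {q : X × Fin Δ} {x : X} :
    x ∈ hset H Y Δ (Sum.inr q) ↔ x = q.1 ∧ q.1 ∈ Y ∧ (q.2 : ℕ) < Δ - dg H Y q.1 := by
  simp only [hset]
  split_ifs with h
  · simp [h]
  · simp only [notMem_empty, false_iff]
    tauto

theorem card_hset_le {r : ℕ} (hr : ∀ f, (H f).card = r) (hr1 : 1 ≤ r) (s : ι ⊕ (X × Fin Δ)) :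
    (hset H Y Δ s).card ≤ r := by
  rcases s with f | q <;> simp only [hset] <;> split_ifs <;> simp [hr, hr1]

theorem card_dummies (x : X) (hxY : x ∈ Y) :
    (univ.filter fun j : Fin Δ => x ∈ hset H Y Δ (Sum.inr (x, j))).card = Δ - dg H Y x := by
  have : (univ.filter fun j : Fin Δ => x ∈ hset H Y Δ (Sum.inr (x, j))) =
      univ.filter fun j : Fin Δ => (j : ℕ) < Δ - dg H Y x := by
    ext j; simp [mem_hset_inr, hxY]
  rw [this, Fin.card_filter_val_lt]
  omega

theorem card_hitters_singleton {x : X} (hxY : x ∈ Y) (hd : dg H Y x ≤ Δ) :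
    (hitters (hset H Y Δ) {x}).card = Δ := by
  have h1 : hitters (hset H Y Δ) {x} =
      (univ.filter fun f => x ∈ H f ∧ H f ⊆ Y).disjSum
        ((univ.filter fun j : Fin Δ => x ∈ hset H Y Δ (Sum.inr (x, j))).map
          ⟨fun j => (x, j), fun a b h => by simpa using h⟩) := by
    ext s
    rcases s with f | q
    · simp [hitters, mem_hset_inl]
    · simp only [hitters, mem_filter, mem_univ, true_and, disjoint_singleton_left, not_not,
        inr_mem_disjSum, mem_map, mem_hset_inr]
      constructor
      · rintro ⟨rfl, h⟩
        exact ⟨q.2, h, rfl⟩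
      · rintro ⟨j, h, rfl⟩
        exact ⟨rfl, h⟩
  rw [h1, card_disjSum, card_map, card_dummies x hxY]
  have : (univ.filter fun f => x ∈ H f ∧ H f ⊆ Y).card = dg H Y x := rfl
  omega

theorem card_both_le {Cd : ℝ}
    (hcd : ∀ x y, x ≠ y → ((univ.filter fun f => x ∈ H f ∧ y ∈ H f).card : ℝ) ≤ Cd)
    {x y : X} (hxy : x ≠ y) :
    ((hitters (hset H Y Δ) {x} ∩ hitters (hset H Y Δ) {y}).card : ℝ) ≤ Cd := by
  refine le_trans ?_ (hcd x y hxy)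
  have : hitters (hset H Y Δ) {x} ∩ hitters (hset H Y Δ) {y} ⊆
      (univ.filter fun f => x ∈ H f ∧ y ∈ H f).map ⟨Sum.inl, Sum.inl_injective⟩ := by
    intro s hs
    simp only [hitters, mem_inter, mem_filter, mem_univ, true_and, disjoint_singleton_left,
      not_not] at hs
    rcases s with f | q
    · simp only [mem_hset_inl] at hs
      simp [hs]
    · simp only [mem_hset_inr] at hs
      exact absurd (hs.1.1.trans hs.2.1.symm) hxy
  have := card_le_card this
  rw [card_map] at this
  exact_mod_cast this

theorem hitters_insert {σ : Type*} [Fintype σ] [DecidableEq σ] (hs : σ → Finset X) (x : X)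
    (A : Finset X) : hitters hs (insert x A) = hitters hs {x} ∪ hitters hs A := by
  ext s
  simp only [hitters, mem_filter, mem_univ, true_and, mem_union, disjoint_insert_left,
    disjoint_singleton_left]
  tauto

theorem card_hitters_bounds {Cd : ℝ} (hCd : 0 ≤ Cd)
    (hcd : ∀ x y, x ≠ y → ((univ.filter fun f => x ∈ H f ∧ y ∈ H f).card : ℝ) ≤ Cd)
    (hd : ∀ x ∈ Y, dg H Y x ≤ Δ) (A : Finset X) (hA : A ⊆ Y) :
    (hitters (hset H Y Δ) A).card ≤ A.card * Δ ∧
    (A.card * Δ : ℝ) ≤ (hitters (hset H Y Δ) A).card + (A.card : ℝ) ^ 2 * Cd := by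
  induction A using Finset.induction_on with
  | empty => simp [hitters]
  | insert x A hx ih =>
    have hxY : x ∈ Y := hA (mem_insert_self _ _)
    obtain ⟨ih1, ih2⟩ := ih fun y hy => hA (mem_insert_of_mem hy)
    rw [hitters_insert, card_insert_of_notMem hx]
    have h1 := card_hitters_singleton hxY (hd x hxY)
    have h2 := card_union_add_card_inter (hitters (hset H Y Δ) {x}) (hitters (hset H Y Δ) A)
    constructor
    · calc _ ≤ _ := card_union_le _ _
        _ ≤ _ := by rw [h1]; nlinarith
    · have h3 : ((hitters (hset H Y Δ) {x} ∩ hitters (hset H Y Δ) A).card : ℝ) ≤ A.card * Cd := by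
        have hsub : hitters (hset H Y Δ) {x} ∩ hitters (hset H Y Δ) A ⊆
            A.biUnion fun y => hitters (hset H Y Δ) {x} ∩ hitters (hset H Y Δ) {y} := by
          intro s hs
          simp only [hitters, mem_inter, mem_filter, mem_univ, true_and, disjoint_singleton_left,
            not_not, mem_biUnion, Finset.not_disjoint_iff] at hs ⊢
          obtain ⟨h, y, hy, hys⟩ := hs
          exact ⟨y, hy, h, hys⟩
        calc _ ≤ ((A.biUnion fun y => hitters (hset H Y Δ) {x} ∩
                  hitters (hset H Y Δ) {y}).card : ℝ) := by exact_mod_cast card_le_card hsub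
          _ ≤ ∑ y ∈ A, ((hitters (hset H Y Δ) {x} ∩ hitters (hset H Y Δ) {y}).card : ℝ) := by
              exact_mod_cast card_biUnion_le
          _ ≤ ∑ y ∈ A, Cd := Finset.sum_le_sum fun y hy =>
              card_both_le hcd (ne_of_mem_of_not_mem hy hx).symm
          _ = _ := by simp
      have h4 : ((hitters (hset H Y Δ) {x} ∪ hitters (hset H Y Δ) A).card : ℝ) +
          (hitters (hset H Y Δ) {x} ∩ hitters (hset H Y Δ) A).card =
          Δ + (hitters (hset H Y Δ) A).card := by
        rw [h1] at h2; exact_mod_cast h2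
      push_cast
      have h5 : (0 : ℝ) ≤ A.card * Cd := by positivity
      nlinarith

/-- The number of edges in `Y` through `x` whose other vertices are not hit. -/
noncomputable def gdeg (H : ι → Finset X) (Y : Finset X) (Δ : ℕ) (x : X)
    (ω : ι ⊕ (X × Fin Δ) → Bool) : ℝ :=
  unhitWt (hset H Y Δ) (univ.filter fun f => x ∈ H f ∧ H f ⊆ Y) (fun f => (H f).erase x)
    (fun _ => 1) ω

variable {p : ℝ} {h0 : 0 ≤ p} {h1 : p ≤ 1}

theorem gdeg_tail {r : ℕ} (hr : ∀ f, (H f).card = r) (hr1 : 1 ≤ r) {Cd : ℝ} (hCd : 1 ≤ Cd)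
    (hcd : ∀ x y, x ≠ y → ((univ.filter fun f => x ∈ H f ∧ y ∈ H f).card : ℝ) ≤ Cd)
    (hd : ∀ x ∈ Y, dg H Y x ≤ Δ) (hΔ : 1 ≤ Δ) {a b : ℝ} (ha : p * Δ ≤ a) (ha1 : a ≤ 1)
    (hb : 0 ≤ b) (hb1 : b ≤ 1) (x : X) (hxY : x ∈ Y) :
    Pr (bern p h0 h1) (fun ω => dg H Y x * ((1 - p) ^ Δ) ^ (r - 1) + a * r ^ 2 * Cd + b * Δ
        < gdeg H Y Δ x ω) ≤ Real.exp (-(b ^ 2 * Δ / (4 * r ^ 2 * Cd))) ∧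
    Pr (bern p h0 h1) (fun ω => gdeg H Y Δ x ω < dg H Y x * ((1 - p) ^ Δ) ^ (r - 1) - b * Δ)
        ≤ Real.exp (-(b ^ 2 * Δ / (4 * r ^ 2 * Cd))) := by
  have hΔ' : (1 : ℝ) ≤ Δ := by exact_mod_cast hΔ
  have hr1' : (1 : ℝ) ≤ r := by exact_mod_cast hr1
  set E := univ.filter fun f => x ∈ H f ∧ H f ⊆ Y with hE
  have hEc : (E.card : ℝ) = dg H Y x := rfl
  have hEΔ : (E.card : ℝ) ≤ Δ := by rw [hEc]; exact_mod_cast hd x hxY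
  have hcardA : ∀ f ∈ E, ((H f).erase x).card = r - 1 := fun f hf => by
    rw [card_erase_of_mem (mem_filter.1 hf).2.1, hr]
  have hbd : ∀ f ∈ E, _ := fun f hf => card_hitters_bounds (H := H) (Y := Y) (Δ := Δ)
    (by linarith) hcd hd ((H f).erase x)
    ((erase_subset _ _).trans (mem_filter.1 hf).2.2)
  have hc : ∀ s, ∑ f ∈ E, (if ¬ Disjoint ((H f).erase x) (hset H Y Δ s) then (1 : ℝ) else 0)
      ≤ r * Cd := by
    intro s
    rw [← Finset.sum_filter, Finset.sum_const, nsmul_eq_mul, mul_one]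
    have hsub : (E.filter fun f => ¬ Disjoint ((H f).erase x) (hset H Y Δ s)) ⊆
        ((hset H Y Δ s).erase x).biUnion fun y => univ.filter fun f => x ∈ H f ∧ y ∈ H f := by
      intro f hf
      simp only [mem_filter, Finset.not_disjoint_iff, mem_biUnion, mem_erase, mem_univ, true_and,
        hE] at hf ⊢
      obtain ⟨⟨hxf, _⟩, y, ⟨hyx, hyf⟩, hys⟩ := hf
      exact ⟨y, ⟨hyx, hys⟩, hxf, hyf⟩
    calc _ ≤ ((((hset H Y Δ s).erase x).biUnion fun y =>
            univ.filter fun f => x ∈ H f ∧ y ∈ H f).card : ℝ) := by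
          exact_mod_cast card_le_card hsub
      _ ≤ ∑ y ∈ (hset H Y Δ s).erase x, ((univ.filter fun f => x ∈ H f ∧ y ∈ H f).card : ℝ) := by
          exact_mod_cast card_biUnion_le
      _ ≤ ∑ y ∈ (hset H Y Δ s).erase x, Cd :=
          Finset.sum_le_sum fun y hy => hcd x y (mem_erase.1 hy).1.symm
      _ = ((hset H Y Δ s).erase x).card * Cd := by simp
      _ ≤ r * Cd := by
          refine mul_le_mul_of_nonneg_right ?_ (by linarith)
          exact_mod_cast (card_le_card (erase_subset _ _)).trans (card_hset_le hr hr1 s)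
  have hB : p * ∑ f ∈ E, (1 : ℝ) * (hitters (hset H Y Δ) ((H f).erase x)).card ≤ r * Δ := by
    have : ∑ f ∈ E, (1 : ℝ) * (hitters (hset H Y Δ) ((H f).erase x)).card
        ≤ ∑ f ∈ E, (r : ℝ) * Δ := by
      refine Finset.sum_le_sum fun f hf => ?_
      rw [one_mul]
      have h := (hbd f hf).1
      rw [hcardA f hf] at h
      have h2 : (hitters (hset H Y Δ) ((H f).erase x)).card ≤ r * Δ :=
        h.trans (Nat.mul_le_mul_right _ (Nat.sub_le _ _))
      exact_mod_cast h2
    rw [Finset.sum_const, nsmul_eq_mul] at this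
    calc _ ≤ p * (E.card * (r * Δ)) := mul_le_mul_of_nonneg_left this h0
      _ ≤ p * (Δ * (r * Δ)) := by gcongr
      _ = (p * Δ) * (r * Δ) := by ring
      _ ≤ 1 * (r * Δ) := mul_le_mul_of_nonneg_right (ha.trans ha1) (by positivity)
      _ = _ := one_mul _
  have htail := unhitWt_tail (h0 := h0) (h1 := h1) (hset H Y Δ) E (fun f => (H f).erase x)
    (fun _ => (1 : ℝ)) (fun _ _ => zero_le_one) (L := r * Cd) (B := r * Δ) (t := b * Δ)
    (by positivity) (by positivity) (by positivity) (by nlinarith) hc hB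
  have hexp : (b * Δ) ^ 2 / (4 * (r * Δ) * (r * Cd)) = b ^ 2 * Δ / (4 * r ^ 2 * Cd) := by
    field_simp
  rw [hexp] at htail
  have hp0 : 0 ≤ 1 - p := by linarith
  have hp1 : 1 - p ≤ 1 := by linarith
  have hlow : (dg H Y x : ℝ) * ((1 - p) ^ Δ) ^ (r - 1) ≤
      ∑ f ∈ E, (1 : ℝ) * (1 - p) ^ (hitters (hset H Y Δ) ((H f).erase x)).card := by
    rw [← hEc, ← nsmul_eq_mul, ← Finset.sum_const]
    refine Finset.sum_le_sum fun f hf => ?_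
    rw [one_mul, ← pow_mul]
    refine pow_le_pow_of_le_one hp0 hp1 ?_
    have h := (hbd f hf).1
    rw [hcardA f hf] at h
    rwa [mul_comm]
  have hup : ∑ f ∈ E, (1 : ℝ) * (1 - p) ^ (hitters (hset H Y Δ) ((H f).erase x)).card ≤
      (dg H Y x : ℝ) * ((1 - p) ^ Δ) ^ (r - 1) + a * r ^ 2 * Cd := by
    have h2 : ∀ f ∈ E, (1 : ℝ) * (1 - p) ^ (hitters (hset H Y Δ) ((H f).erase x)).card ≤
        ((1 - p) ^ Δ) ^ (r - 1) + p * (r ^ 2 * Cd) := by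
      intro f hf
      obtain ⟨h3, h4⟩ := hbd f hf
      rw [hcardA f hf] at h3 h4
      set N := (hitters (hset H Y Δ) ((H f).erase x)).card
      obtain ⟨m, hm⟩ := Nat.exists_eq_add_of_le h3
      have hm' : (m : ℝ) ≤ r ^ 2 * Cd := by
        have : (((r - 1 : ℕ) : ℝ)) * Δ = N + m := by exact_mod_cast hm
        have h5 : ((r - 1 : ℕ) : ℝ) ≤ r := by exact_mod_cast Nat.sub_le _ _
        have h6 : (((r - 1 : ℕ) : ℝ)) ^ 2 * Cd ≤ r ^ 2 * Cd := by gcongr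
        linarith
      rw [one_mul, ← pow_mul, mul_comm Δ, hm, pow_add]
      have hber : 1 - m * p ≤ (1 - p) ^ m := by
        have := one_add_mul_le_pow (a := -p) (by linarith) m
        have e : 1 + -p = 1 - p := by ring
        rw [e] at this
        linarith
      have hN1 : (1 - p) ^ N ≤ 1 := pow_le_one₀ hp0 hp1
      have hN0 : 0 ≤ (1 - p) ^ N := pow_nonneg hp0 _
      have hmp : (m : ℝ) * p ≤ p * (r ^ 2 * Cd) := by
        rw [mul_comm]; exact mul_le_mul_of_nonneg_left hm' h0
      have hmp0 : 0 ≤ (m : ℝ) * p := by positivity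
      nlinarith
    calc _ ≤ ∑ f ∈ E, (((1 - p) ^ Δ) ^ (r - 1) + p * (r ^ 2 * Cd)) := Finset.sum_le_sum h2
      _ = E.card * ((1 - p) ^ Δ) ^ (r - 1) + (p * E.card) * (r ^ 2 * Cd) := by
          rw [Finset.sum_const, nsmul_eq_mul]; ring
      _ ≤ _ := by
          rw [hEc]
          have : p * (dg H Y x : ℝ) ≤ a := by
            rw [← hEc]
            exact (mul_le_mul_of_nonneg_left hEΔ h0).trans ha
          have : p * (dg H Y x : ℝ) * (r ^ 2 * Cd) ≤ a * (r ^ 2 * Cd) :=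
            mul_le_mul_of_nonneg_right this (by positivity)
          linarith
  refine ⟨(Pr_mono _ fun ω h => ?_).trans htail.1, (Pr_mono _ fun ω h => ?_).trans htail.2⟩
  · unfold gdeg at h; linarith
  · unfold gdeg at h; linarith

end Round

theorem sum_biUnion_le_sum {A B : Type*} [DecidableEq B] (S : Finset A) (h : A → Finset B)
    (w : B → ℝ) (hw : ∀ b, 0 ≤ w b) :
    ∑ b ∈ S.biUnion h, w b ≤ ∑ a ∈ S, ∑ b ∈ h a, w b := by
  classical
  induction S using Finset.induction_on with
  | empty => simp
  | insert a S ha ih =>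
    rw [biUnion_insert, sum_insert ha]
    have := Finset.sum_union_inter (s₁ := h a) (s₂ := S.biUnion h) (f := w)
    have h2 : 0 ≤ ∑ b ∈ h a ∩ S.biUnion h, w b := Finset.sum_nonneg fun b _ => hw b
    linarith

section Waste

variable {X ι : Type*} [Fintype X] [DecidableEq X] [Fintype ι] [DecidableEq ι]
variable {H : ι → Finset X} {Y : Finset X} {Δ : ℕ}
variable {p : ℝ} {h0 : 0 ≤ p} {h1 : p ≤ 1}

theorem kept_tail {r : ℕ} (hr : ∀ f, (H f).card = r) (hr1 : 1 ≤ r)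
    (hd : ∀ x ∈ Y, dg H Y x ≤ Δ) {a b m : ℝ} (ha : p * Δ ≤ a) (ha1 : a ≤ 1)
    (hb : 0 ≤ b) (hb1 : b ≤ 1) (hm : 0 < m) (w : X → ℝ) (hw : ∀ x, 0 ≤ w x)
    (hwm : ∀ x, w x ≤ m) (hw1 : ∑ x ∈ Y, w x ≤ 1) :
    Pr (bern p h0 h1) (fun ω => (1 - p) ^ Δ * (∑ x ∈ Y, w x) + b
      < ∑ x ∈ Y ∩ unhit (hset H Y Δ) ω, w x) ≤ Real.exp (-(b ^ 2 / (4 * r ^ 2 * m))) := by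
  have hr1' : (1 : ℝ) ≤ r := by exact_mod_cast hr1
  have hcard : ∀ x ∈ Y, w x * (hitters (hset H Y Δ) {x}).card = w x * Δ := fun x hx => by
    rw [card_hitters_singleton hx (hd x hx)]
  have h := (unhitWt_tail (h0 := h0) (h1 := h1) (hset H Y Δ) Y (fun x => {x}) w
    (fun x _ => hw x) (L := r ^ 2 * m) (B := 1) (t := b) (by positivity) one_pos hb (by linarith)
    (fun s => by
      rw [← Finset.sum_filter]
      calc _ ≤ ∑ x ∈ hset H Y Δ s, w x :=
            Finset.sum_le_sum_of_subset_of_nonneg (fun x hx => by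
              simpa using (mem_filter.1 hx).2) fun x _ _ => hw x
        _ ≤ ∑ x ∈ hset H Y Δ s, m := Finset.sum_le_sum fun x _ => hwm x
        _ = (hset H Y Δ s).card * m := by simp
        _ ≤ r * m := mul_le_mul_of_nonneg_right (by exact_mod_cast card_hset_le hr hr1 s) hm.le
        _ ≤ r ^ 2 * m := mul_le_mul_of_nonneg_right (by nlinarith) hm.le)
    (by
      rw [Finset.sum_congr rfl hcard, ← Finset.sum_mul]
      calc _ = (p * Δ) * ∑ x ∈ Y, w x := by ring
        _ ≤ a * ∑ x ∈ Y, w x :=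
          mul_le_mul_of_nonneg_right ha (Finset.sum_nonneg fun x _ => hw x)
        _ ≤ 1 * 1 := by
          refine mul_le_mul ha1 hw1 (Finset.sum_nonneg fun x _ => hw x) zero_le_one
        _ = 1 := one_mul _)).1
  have e : 4 * 1 * (r ^ 2 * m) = 4 * r ^ 2 * m := by ring
  rw [e] at h
  refine (Pr_mono _ fun ω hω => ?_).trans h
  have e1 : ∑ x ∈ Y, w x * (1 - p) ^ (hitters (hset H Y Δ) {x}).card
      = (1 - p) ^ Δ * ∑ x ∈ Y, w x := by
    rw [Finset.mul_sum]
    refine Finset.sum_congr rfl fun x hx => ?_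
    rw [card_hitters_singleton hx (hd x hx), mul_comm]
  have e2 : unhitWt (hset H Y Δ) Y (fun x => {x}) w ω = ∑ x ∈ Y ∩ unhit (hset H Y Δ) ω, w x := by
    simp only [unhitWt, singleton_subset_iff, mul_ite, mul_one, mul_zero]
    rw [← Finset.sum_filter, Finset.filter_mem_eq_inter]
  rw [e1, e2]
  exact hω

/-- The chosen edge `f` conflicts with a chosen edge of smaller index. -/
def Blocked (H : ι → Finset X) (Y : Finset X) (Δ : ℕ) (f : ι) (ω : ι ⊕ (X × Fin Δ) → Bool) : Prop :=
  ∃ g, Fintype.equivFin ι g < Fintype.equivFin ι f ∧ ω (Sum.inl g) = true ∧ H g ⊆ Y ∧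
    ¬ Disjoint (H g) (H f)

open Classical in
/-- The chosen edges that are not blocked. -/
noncomputable def matching (H : ι → Finset X) (Y : Finset X) (Δ : ℕ)
    (ω : ι ⊕ (X × Fin Δ) → Bool) : Finset ι :=
  univ.filter fun f => ω (Sum.inl f) = true ∧ H f ⊆ Y ∧ ¬ Blocked H Y Δ f ω

theorem mem_matching {ω : ι ⊕ (X × Fin Δ) → Bool} {f : ι} : f ∈ matching H Y Δ ω ↔
    ω (Sum.inl f) = true ∧ H f ⊆ Y ∧ ¬ Blocked H Y Δ f ω := by
  simp [matching]

theorem matching_disjoint (ω : ι ⊕ (X × Fin Δ) → Bool) {f g : ι} (hf : f ∈ matching H Y Δ ω)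
    (hg : g ∈ matching H Y Δ ω) (hfg : f ≠ g) : Disjoint (H f) (H g) := by
  simp only [matching, mem_filter, mem_univ, true_and] at hf hg
  by_contra hd
  have hne : Fintype.equivFin ι f ≠ Fintype.equivFin ι g := fun h => hfg (Equiv.injective _ h)
  rcases lt_or_gt_of_ne hne with h | h
  · exact hg.2.2 ⟨f, h, hf.1, hf.2.1, hd⟩
  · exact hf.2.2 ⟨g, h, hg.1, hg.2.1, fun h => hd h.symm⟩

open Classical in
/-- The weight possibly wasted by choosing the hitting set `s`. -/
noncomputable def wasteWt (H : ι → Finset X) (Y : Finset X) (Δ : ℕ) (w : X → ℝ)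
    (s : ι ⊕ (X × Fin Δ)) (ω : ι ⊕ (X × Fin Δ) → Bool) : ℝ :=
  if (∀ f, s = Sum.inl f → Blocked H Y Δ f ω) then ∑ x ∈ hset H Y Δ s, w x else 0

theorem waste_le (w : X → ℝ) (hw : ∀ x, 0 ≤ w x) (ω : ι ⊕ (X × Fin Δ) → Bool) :
    ∑ x ∈ (Y \ unhit (hset H Y Δ) ω) \ (matching H Y Δ ω).biUnion H, w x ≤
      ∑ s, if ω s then wasteWt H Y Δ w s ω else 0 := by
  classical
  simp only [wasteWt]
  rw [← Finset.sum_filter, ← Finset.sum_filter, Finset.filter_filter]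
  refine le_trans ?_ (sum_biUnion_le_sum _ _ _ hw)
  refine Finset.sum_le_sum_of_subset_of_nonneg (fun x hx => ?_) fun x _ _ => hw x
  simp only [mem_sdiff, unhit, mem_filter, mem_univ, true_and, not_forall, mem_biUnion,
    not_exists, not_and, not_not] at hx
  obtain ⟨⟨hxY, s, hws, hxs⟩, hM⟩ := hx
  refine mem_biUnion.2 ⟨s, ?_, hxs⟩
  simp only [mem_filter, mem_univ, true_and]
  refine ⟨hws, ?_⟩
  rintro f rfl
  rw [mem_hset_inl] at hxs
  by_contra hb
  exact hM f (by simp [matching, hws, hxs.2, hb]) hxs.1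

theorem wt_hset_le {r : ℕ} (hr : ∀ f, (H f).card = r) (hr1 : 1 ≤ r) {m : ℝ} (hm : 0 ≤ m)
    (w : X → ℝ) (hwm : ∀ x, w x ≤ m) (s : ι ⊕ (X × Fin Δ)) :
    ∑ x ∈ hset H Y Δ s, w x ≤ r * m := by
  calc _ ≤ ∑ x ∈ hset H Y Δ s, m := Finset.sum_le_sum fun x _ => hwm x
    _ = (hset H Y Δ s).card * m := by simp
    _ ≤ r * m := mul_le_mul_of_nonneg_right (by exact_mod_cast card_hset_le hr hr1 s) hm

theorem card_meet_le {r : ℕ} (hr : ∀ f, (H f).card = r) (hd : ∀ x ∈ Y, dg H Y x ≤ Δ) {g : ι}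
    (hg : H g ⊆ Y) : (univ.filter fun f => H f ⊆ Y ∧ ¬ Disjoint (H g) (H f)).card ≤ r * Δ := by
  have hsub : (univ.filter fun f => H f ⊆ Y ∧ ¬ Disjoint (H g) (H f)) ⊆
      (H g).biUnion fun x => univ.filter fun f => x ∈ H f ∧ H f ⊆ Y := by
    intro f hf
    simp only [mem_filter, mem_univ, true_and, Finset.not_disjoint_iff, mem_biUnion] at hf ⊢
    obtain ⟨hfY, x, hx, hxf⟩ := hf
    exact ⟨x, hx, hxf, hfY⟩
  calc _ ≤ _ := card_le_card hsub
    _ ≤ _ := card_biUnion_le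
    _ ≤ ∑ x ∈ H g, Δ := Finset.sum_le_sum fun x hx => hd x (hg hx)
    _ = r * Δ := by simp [hr]

/-- The total weight of the edges in `Y` meeting `g`. -/
noncomputable def meetWt (H : ι → Finset X) (Y : Finset X) (w : X → ℝ) (g : ι) : ℝ :=
  if H g ⊆ Y then ∑ f ∈ univ.filter (fun f => H f ⊆ Y ∧ ¬ Disjoint (H g) (H f)), ∑ x ∈ H f, w x
  else 0

theorem meetWt_nonneg (w : X → ℝ) (hw : ∀ x, 0 ≤ w x) (g : ι) : 0 ≤ meetWt H Y w g := by
  unfold meetWt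
  split_ifs
  · exact Finset.sum_nonneg fun f _ => Finset.sum_nonneg fun x _ => hw x
  · exact le_rfl

theorem meetWt_le {r : ℕ} (hr : ∀ f, (H f).card = r) (hd : ∀ x ∈ Y, dg H Y x ≤ Δ) {m : ℝ}
    (hm : 0 ≤ m) (w : X → ℝ) (hwm : ∀ x, w x ≤ m) (g : ι) :
    meetWt H Y w g ≤ r ^ 2 * Δ * m := by
  unfold meetWt
  split_ifs with hg
  · calc _ ≤ ∑ f ∈ univ.filter (fun f => H f ⊆ Y ∧ ¬ Disjoint (H g) (H f)), (r : ℝ) * m := by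
          refine Finset.sum_le_sum fun f _ => ?_
          calc _ ≤ ∑ x ∈ H f, m := Finset.sum_le_sum fun x _ => hwm x
            _ = r * m := by simp [hr]
      _ = (univ.filter (fun f => H f ⊆ Y ∧ ¬ Disjoint (H g) (H f))).card * (r * m) := by simp
      _ ≤ (r * Δ) * (r * m) := mul_le_mul_of_nonneg_right
          (by exact_mod_cast card_meet_le hr hd hg) (by positivity)
      _ = _ := by ring
  · positivity

theorem sum_active_wt (w : X → ℝ) :
    ∑ f ∈ univ.filter (fun f => H f ⊆ Y), ∑ x ∈ H f, w x = ∑ x ∈ Y, w x * dg H Y x := by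
  have h1 : ∀ f ∈ univ.filter (fun f => H f ⊆ Y), ∑ x ∈ H f, w x =
      ∑ x ∈ Y, if x ∈ H f then w x else 0 := fun f hf => by
    rw [← Finset.sum_filter, Finset.filter_mem_eq_inter,
      Finset.inter_eq_right.2 (mem_filter.1 hf).2]
  rw [Finset.sum_congr rfl h1, Finset.sum_comm]
  refine Finset.sum_congr rfl fun x _ => ?_
  rw [← Finset.sum_filter, Finset.filter_filter, Finset.sum_const, nsmul_eq_mul, mul_comm, dg]
  congr 4
  ext f
  exact and_comm

theorem meetWt_eq (w : X → ℝ) (g : ι) : meetWt H Y w g =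
    ∑ f, if H g ⊆ Y ∧ H f ⊆ Y ∧ ¬ Disjoint (H f) (H g) then ∑ x ∈ H f, w x else 0 := by
  unfold meetWt
  split_ifs with hg
  · rw [Finset.sum_filter]
    simp only [hg, true_and, disjoint_comm]
  · simp [hg]

theorem sum_meetWt_le {r : ℕ} (hr : ∀ f, (H f).card = r) (hd : ∀ x ∈ Y, dg H Y x ≤ Δ)
    (w : X → ℝ) (hw : ∀ x, 0 ≤ w x) :
    ∑ g, meetWt H Y w g ≤ r * Δ ^ 2 * ∑ x ∈ Y, w x := by
  have h1 : ∑ g, meetWt H Y w g = ∑ f ∈ univ.filter (fun f => H f ⊆ Y),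
      ((univ.filter (fun g => H g ⊆ Y ∧ ¬ Disjoint (H f) (H g))).card : ℝ) * ∑ x ∈ H f, w x := by
    simp only [meetWt_eq]
    rw [Finset.sum_comm, Finset.sum_filter]
    refine Finset.sum_congr rfl fun f _ => ?_
    split_ifs with hf
    · simp only [hf, true_and]
      rw [← Finset.sum_filter, Finset.sum_const, nsmul_eq_mul]
    · simp [hf]
  rw [h1]
  calc _ ≤ ∑ f ∈ univ.filter (fun f => H f ⊆ Y), ((r : ℝ) * Δ) * ∑ x ∈ H f, w x := by
        refine Finset.sum_le_sum fun f hf => mul_le_mul_of_nonneg_right ?_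
          (Finset.sum_nonneg fun x _ => hw x)
        exact_mod_cast card_meet_le hr hd (mem_filter.1 hf).2
    _ = (r * Δ) * ∑ x ∈ Y, w x * dg H Y x := by rw [← Finset.mul_sum, sum_active_wt]
    _ ≤ (r * Δ) * ∑ x ∈ Y, w x * Δ := by
        refine mul_le_mul_of_nonneg_left (Finset.sum_le_sum fun x hx => ?_) (by positivity)
        exact mul_le_mul_of_nonneg_left (by exact_mod_cast hd x hx) (hw x)
    _ = _ := by rw [← Finset.sum_mul]; ring

end Waste

section RoundLemma

variable {X ι : Type*} [Fintype X] [DecidableEq X] [Fintype ι] [DecidableEq ι]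
variable {H : ι → Finset X} {Y : Finset X} {Δ : ℕ}
variable {p : ℝ} {h0 : 0 ≤ p} {h1 : p ≤ 1}

theorem sum_dummies (hd : ∀ x ∈ Y, dg H Y x ≤ Δ) (w : X → ℝ) :
    ∑ q : X × Fin Δ, ∑ x ∈ hset H Y Δ (Sum.inr q), w x
      = ∑ x ∈ Y, w x * ((Δ : ℝ) - dg H Y x) := by
  rw [Fintype.sum_prod_type]
  have h1 : ∀ x : X, ∑ j : Fin Δ, ∑ y ∈ hset H Y Δ (Sum.inr (x, j)), w y =
      if x ∈ Y then w x * ((Δ : ℝ) - dg H Y x) else 0 := by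
    intro x
    split_ifs with hx
    · have h2 : ∀ j : Fin Δ, ∑ y ∈ hset H Y Δ (Sum.inr (x, j)), w y =
          if x ∈ hset H Y Δ (Sum.inr (x, j)) then w x else 0 := by
        intro j
        simp only [mem_hset_inr, true_and]
        simp only [hset]
        split_ifs <;> simp
      simp only [h2]
      rw [← Finset.sum_filter, Finset.sum_const, card_dummies x hx, nsmul_eq_mul,
        Nat.cast_sub (hd x hx), mul_comm]
    · refine Finset.sum_eq_zero fun j _ => ?_
      simp [hset, hx]
  simp only [h1]
  rw [← Finset.sum_filter, Finset.filter_mem_eq_inter, Finset.univ_inter]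

theorem sum_wasteWt_le (hd : ∀ x ∈ Y, dg H Y x ≤ Δ) (w : X → ℝ) (hw : ∀ x, 0 ≤ w x)
    (ω : ι ⊕ (X × Fin Δ) → Bool) :
    ∑ s, wasteWt H Y Δ w s ω ≤ ∑ x ∈ Y, w x * ((Δ : ℝ) - dg H Y x) +
      ∑ g, if ω (Sum.inl g) then meetWt H Y w g else 0 := by
  rw [Fintype.sum_sum_type, add_comm]
  refine add_le_add ?_ ?_
  · rw [← sum_dummies hd w]
    refine Finset.sum_le_sum fun q _ => ?_
    simp [wasteWt]
  · have h2 : ∀ g, (if ω (Sum.inl g) then meetWt H Y w g else 0) = ∑ f,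
        if ω (Sum.inl g) = true ∧ H g ⊆ Y ∧ H f ⊆ Y ∧ ¬ Disjoint (H f) (H g) then
          ∑ x ∈ H f, w x else 0 := by
      intro g
      split_ifs with h
      · rw [meetWt_eq]; simp [h]
      · simp [h]
    simp only [h2]
    rw [Finset.sum_comm]
    refine Finset.sum_le_sum fun f _ => ?_
    have hWf : 0 ≤ ∑ x ∈ H f, w x := Finset.sum_nonneg fun x _ => hw x
    have hnn : ∀ g, 0 ≤ (if ω (Sum.inl g) = true ∧ H g ⊆ Y ∧ H f ⊆ Y ∧ ¬ Disjoint (H f) (H g) then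
          ∑ x ∈ H f, w x else 0) := fun g => by split_ifs <;> simp [hWf]
    unfold wasteWt
    split_ifs with hb
    · obtain ⟨g, _, hg, hgY, hgf⟩ := hb f rfl
      simp only [hset]
      split_ifs with hfY
      · refine le_trans ?_ (Finset.single_le_sum (fun g _ => hnn g) (mem_univ g))
        rw [if_pos ⟨hg, hgY, hfY, fun h => hgf h.symm⟩]
      · simpa using Finset.sum_nonneg fun g _ => hnn g
    · exact Finset.sum_nonneg fun g _ => hnn g

theorem waste_tail {r : ℕ} (hr : ∀ f, (H f).card = r) (hr1 : 1 ≤ r)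
    (hd : ∀ x ∈ Y, dg H Y x ≤ Δ) (hΔ : 1 ≤ Δ) {b m : ℝ} (hb : 0 ≤ b) (hb1 : b ≤ 1) (hm : 0 < m)
    (w : X → ℝ) (hw : ∀ x, 0 ≤ w x) (hwm : ∀ x, w x ≤ m) :
    Pr (bern p h0 h1) (fun ω => 2 * p * (∑ x ∈ Y, w x * ((Δ : ℝ) - dg H Y x) +
        (2 * p * (r * Δ ^ 2 * ∑ x ∈ Y, w x) + b * Δ)) + b <
      ∑ x ∈ (Y \ unhit (hset H Y Δ) ω) \ (matching H Y Δ ω).biUnion H, w x)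
      ≤ 2 * Real.exp (-(b ^ 2 / (4 * r ^ 2 * m))) := by
  have hr1' : (1 : ℝ) ≤ r := by exact_mod_cast hr1
  have hΔ' : (1 : ℝ) ≤ Δ := by exact_mod_cast hΔ
  let rk : ι ⊕ (X × Fin Δ) → ℕ := fun s => Sum.elim (fun f => (Fintype.equivFin ι f : ℕ))
    (fun _ => 0) s
  have t1 := Pr_predictable_tail (p := p) (h0 := h0) (h1 := h1) (m := r * m) (t := b)
    (by positivity) rk (wasteWt H Y Δ w) univ
    (fun s ω => by
      unfold wasteWt
      split_ifs
      · exact Finset.sum_nonneg fun x _ => hw x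
      · exact le_rfl)
    (fun s ω => by
      unfold wasteWt
      split_ifs
      · exact wt_hset_le hr hr1 hm.le w hwm s
      · positivity)
    (by
      intro s _ x _ hsx ω a
      unfold wasteWt
      congr 1
      simp only [eq_iff_iff]
      refine forall_congr' fun f => ?_
      refine imp_congr_right fun hsf => ?_
      subst hsf
      unfold Blocked
      refine exists_congr fun g => and_congr_right fun hgf => ?_
      rw [Function.update_of_ne]
      rintro rfl
      simp only [rk, Sum.elim_inl] at hsx
      exact absurd hgf (not_lt.2 hsx))
  have t2 := Pr_predictable_tail (p := p) (h0 := h0) (h1 := h1) (m := r ^ 2 * Δ * m) (t := b * Δ)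
    (by positivity) rk (fun s _ => Sum.elim (meetWt H Y w) (fun _ => 0) s) univ
    (fun s ω => by
      rcases s with f | q
      · exact meetWt_nonneg w hw f
      · exact le_rfl)
    (fun s ω => by
      rcases s with f | q
      · exact meetWt_le hr hd hm.le w hwm f
      · simp only [Sum.elim_inr]; positivity)
    (fun _ _ _ _ _ _ _ => rfl)
  simp only [Fintype.sum_sum_type, Sum.elim_inl, Sum.elim_inr, ite_self, Finset.sum_const_zero,
    add_zero] at t2
  have e1 : Real.exp (-(b / (r * m))) ≤ Real.exp (-(b ^ 2 / (4 * r ^ 2 * m))) := by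
    apply Real.exp_le_exp.2
    rw [neg_le_neg_iff]
    have : b ^ 2 ≤ b := by nlinarith
    gcongr
    nlinarith
  have e2 : Real.exp (-(b * Δ / (r ^ 2 * Δ * m))) ≤ Real.exp (-(b ^ 2 / (4 * r ^ 2 * m))) := by
    apply Real.exp_le_exp.2
    rw [neg_le_neg_iff]
    have e3 : b * Δ / (r ^ 2 * Δ * m) = b / (r ^ 2 * m) := by field_simp
    rw [e3]
    have : b ^ 2 ≤ b := by nlinarith
    gcongr
    nlinarith
  refine (Pr_mono _ fun ω hω => ?_).trans ((Pr_or_le _ _ _).trans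
    ((add_le_add (t1.trans e1) (t2.trans e2)).trans (le_of_eq (two_mul _).symm)))
  by_contra! hcon
  obtain ⟨c1, c2⟩ := hcon
  have h3 := waste_le (H := H) (Y := Y) (Δ := Δ) w hw ω
  have h4 := sum_wasteWt_le hd w hw ω
  have h5 := sum_meetWt_le hr hd w hw
  have h6 : 2 * p * ∑ g, meetWt H Y w g ≤ 2 * p * (r * Δ ^ 2 * ∑ x ∈ Y, w x) :=
    mul_le_mul_of_nonneg_left h5 (by linarith)
  have h7 : 2 * p * ∑ s, wasteWt H Y Δ w s ω ≤ 2 * p * (∑ x ∈ Y, w x * ((Δ : ℝ) - dg H Y x) +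
        (2 * p * (r * Δ ^ 2 * ∑ x ∈ Y, w x) + b * Δ)) := by
    refine mul_le_mul_of_nonneg_left ?_ (by linarith)
    linarith
  linarith

theorem nibble_round {J : Type*} [Fintype J] {r : ℕ} (hr : ∀ f, (H f).card = r) (hr1 : 1 ≤ r)
    {Cd : ℝ} (hCd : 1 ≤ Cd)
    (hcd : ∀ x y, x ≠ y → ((univ.filter fun f => x ∈ H f ∧ y ∈ H f).card : ℝ) ≤ Cd)
    (hd : ∀ x ∈ Y, dg H Y x ≤ Δ) (hΔ : 1 ≤ Δ) {a b m : ℝ} (ha : 0 ≤ a) (ha1 : a ≤ 1)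
    (hb : 0 ≤ b) (hb1 : b ≤ 1) (hm : 0 < m) (w : J → X → ℝ) (hw : ∀ j x, 0 ≤ w j x)
    (hwm : ∀ j x, w j x ≤ m) (hw1 : ∀ j, ∑ x ∈ Y, w j x ≤ 1)
    (hU : 2 * Fintype.card X * Real.exp (-(b ^ 2 * Δ / (4 * r ^ 2 * Cd))) +
      3 * Fintype.card J * Real.exp (-(b ^ 2 / (4 * r ^ 2 * m))) < 1) :
    ∃ (M : Finset ι) (Y' : Finset X), Y' ⊆ Y ∧ (∀ f ∈ M, H f ⊆ Y) ∧
      (∀ f ∈ M, ∀ g ∈ M, f ≠ g → Disjoint (H f) (H g)) ∧ (∀ f ∈ M, Disjoint (H f) Y') ∧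
      (∀ x ∈ Y', (dg H Y' x : ℝ) ≤ dg H Y x * Real.exp (-a) ^ (r - 1) + a * r ^ 2 * Cd + b * Δ ∧
        dg H Y x * Real.exp (-a) ^ (r - 1) - b * Δ ≤ dg H Y' x) ∧
      ∀ j, ∑ x ∈ Y', w j x ≤ Real.exp (-a) * ∑ x ∈ Y, w j x + b ∧
        ∑ x ∈ (Y \ Y') \ M.biUnion H, w j x ≤
          2 * a * ((∑ x ∈ Y, w j x * ((Δ : ℝ) - dg H Y x)) / Δ) +
          4 * a ^ 2 * r * (∑ x ∈ Y, w j x) + 3 * b := by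
  have hΔ' : (1 : ℝ) ≤ Δ := by exact_mod_cast hΔ
  set p : ℝ := 1 - Real.exp (-(a / Δ)) with hp
  have h0 : 0 ≤ p := by
    have : Real.exp (-(a / Δ)) ≤ 1 := Real.exp_le_one_iff.2 (by
      have : 0 ≤ a / Δ := by positivity
      linarith)
    linarith
  have h1 : p ≤ 1 := by
    have := Real.exp_pos (-(a / Δ))
    linarith
  have hpa' : p ≤ a / Δ := by
    have := Real.add_one_le_exp (-(a / Δ))
    linarith
  have hpa : p * Δ ≤ a := by rwa [le_div_iff₀ (by positivity)] at hpa'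
  have hk : (1 - p) ^ Δ = Real.exp (-a) := by
    rw [hp, sub_sub_cancel, ← Real.exp_nat_mul]
    congr 1
    field_simp
  set E1 := Real.exp (-(b ^ 2 * Δ / (4 * r ^ 2 * Cd)))
  set E2 := Real.exp (-(b ^ 2 / (4 * r ^ 2 * m)))
  let Bd : X → (ι ⊕ (X × Fin Δ) → Bool) → Prop := fun x ω => x ∈ Y ∧
    ((dg H Y x * ((1 - p) ^ Δ) ^ (r - 1) + a * r ^ 2 * Cd + b * Δ < gdeg H Y Δ x ω) ∨
      gdeg H Y Δ x ω < dg H Y x * ((1 - p) ^ Δ) ^ (r - 1) - b * Δ)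
  let Bk : J → (ι ⊕ (X × Fin Δ) → Bool) → Prop := fun j ω =>
    ((1 - p) ^ Δ * (∑ x ∈ Y, w j x) + b < ∑ x ∈ Y ∩ unhit (hset H Y Δ) ω, w j x) ∨
    (2 * p * (∑ x ∈ Y, w j x * ((Δ : ℝ) - dg H Y x) +
        (2 * p * (r * Δ ^ 2 * ∑ x ∈ Y, w j x) + b * Δ)) + b <
      ∑ x ∈ (Y \ unhit (hset H Y Δ) ω) \ (matching H Y Δ ω).biUnion H, w j x)
  have hBd : ∀ x, Pr (bern p h0 h1) (Bd x) ≤ 2 * E1 := by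
    intro x
    by_cases hx : x ∈ Y
    · have := gdeg_tail (h0 := h0) (h1 := h1) hr hr1 hCd hcd hd hΔ hpa ha1 hb hb1 x hx
      calc _ ≤ _ := Pr_mono _ fun ω hω => hω.2
        _ ≤ _ := Pr_or_le _ _ _
        _ ≤ E1 + E1 := add_le_add this.1 this.2
        _ = _ := (two_mul _).symm
    · have : Pr (bern p h0 h1) (Bd x) = 0 := by
        simp only [Pr, Bd, hx, false_and, if_false]
        exact Ex_const _ 0
      rw [this]
      positivity
  have hBk : ∀ j, Pr (bern p h0 h1) (Bk j) ≤ 3 * E2 := by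
    intro j
    have k1 := kept_tail (h0 := h0) (h1 := h1) hr hr1 hd hpa ha1 hb hb1 hm (w j) (hw j) (hwm j)
      (hw1 j)
    have k2 := waste_tail (h0 := h0) (h1 := h1) hr hr1 hd hΔ hb hb1 hm (w j) (hw j) (hwm j)
    calc _ ≤ _ := Pr_or_le _ _ _
      _ ≤ E2 + 2 * E2 := add_le_add k1 k2
      _ = _ := by ring
  obtain ⟨ω, hω⟩ := exists_not_of_Pr_lt_one (bern p h0 h1)
    (P := fun ω => (∃ x, Bd x ω) ∨ ∃ j, Bk j ω) (by
      calc _ ≤ _ := Pr_or_le _ _ _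
        _ ≤ (∑ _x : X, 2 * E1) + ∑ _j : J, 3 * E2 := add_le_add
            ((Pr_exists_le _ _).trans (Finset.sum_le_sum fun x _ => hBd x))
            ((Pr_exists_le _ _).trans (Finset.sum_le_sum fun j _ => hBk j))
        _ = 2 * Fintype.card X * E1 + 3 * Fintype.card J * E2 := by
            simp only [Finset.sum_const, nsmul_eq_mul, Finset.card_univ]; ring
        _ < 1 := hU)
  push Not at hω
  obtain ⟨hω1, hω2⟩ := hω
  refine ⟨matching H Y Δ ω, Y ∩ unhit (hset H Y Δ) ω, inter_subset_left, ?_, ?_, ?_, ?_, ?_⟩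
  · intro f hf
    exact (mem_matching.1 hf).2.1
  · intro f hf g hg hfg
    exact matching_disjoint ω hf hg hfg
  · intro f hf
    obtain ⟨hf1, hf2, _⟩ := mem_matching.1 hf
    rw [Finset.disjoint_left]
    intro x hx hxY
    have := (mem_filter.1 (mem_inter.1 hxY).2).2 (Sum.inl f) hf1
    exact this (mem_hset_inl.2 ⟨hx, hf2⟩)
  · intro x hx
    obtain ⟨hxY, hxu⟩ := mem_inter.1 hx
    have hg : gdeg H Y Δ x ω = dg H (Y ∩ unhit (hset H Y Δ) ω) x := by
      simp only [gdeg, unhitWt, one_mul]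
      rw [← Finset.sum_filter, Finset.filter_filter, Finset.sum_const, nsmul_eq_mul, mul_one, dg]
      congr 2
      ext f
      simp only [mem_filter, mem_univ, true_and]
      constructor
      · rintro ⟨⟨h1, h2⟩, h3⟩
        refine ⟨h1, subset_inter h2 ?_⟩
        rw [← insert_erase h1]
        exact insert_subset hxu h3
      · rintro ⟨h1, h2⟩
        exact ⟨⟨h1, h2.trans inter_subset_left⟩,
          (erase_subset _ _).trans (h2.trans inter_subset_right)⟩
    have := hω1 x
    simp only [Bd, hxY, true_and, not_or, not_lt, hk, hg] at this
    exact this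
  · intro j
    have := hω2 j
    simp only [Bk, not_or, not_lt, hk] at this
    refine ⟨this.1, ?_⟩
    have e : (Y \ (Y ∩ unhit (hset H Y Δ) ω)) = Y \ unhit (hset H Y Δ) ω := sdiff_inter_self_left _ _
    rw [e]
    refine this.2.trans ?_
    have hZ : 0 ≤ ∑ x ∈ Y, w j x * ((Δ : ℝ) - dg H Y x) := Finset.sum_nonneg fun x hx =>
      mul_nonneg (hw j x) (by
        have : (dg H Y x : ℝ) ≤ Δ := by exact_mod_cast hd x hx
        linarith)
    have hW : 0 ≤ ∑ x ∈ Y, w j x := Finset.sum_nonneg fun x hx => hw j x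
    set Z := ∑ x ∈ Y, w j x * ((Δ : ℝ) - dg H Y x)
    set W := ∑ x ∈ Y, w j x
    have i1 : p * Z ≤ a * (Z / Δ) := by
      calc _ ≤ a / Δ * Z := mul_le_mul_of_nonneg_right hpa' hZ
        _ = _ := by ring
    have i2 : p * Δ * (p * Δ) ≤ a * a := mul_le_mul hpa hpa (by positivity) ha
    have i3 : p * Δ * (p * Δ) * (r * W) ≤ a * a * (r * W) :=
      mul_le_mul_of_nonneg_right i2 (by positivity)
    have i4 : p * Δ * b ≤ 1 * b := mul_le_mul_of_nonneg_right (hpa.trans ha1) hb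
    nlinarith

end RoundLemma

section Iterate

variable {X ι J : Type} [Fintype X] [DecidableEq X] [Fintype ι] [DecidableEq ι] [Fintype J]

/-- The state of the nibble after `s` rounds. -/
def NibbleState (H : ι → Finset X) (Full : X → Prop) (w : J → X → ℝ) (D u b k o : ℝ)
    (M : Finset ι) (Y : Finset X) : Prop :=
  (∀ f ∈ M, ∀ g ∈ M, f ≠ g → Disjoint (H f) (H g)) ∧ (∀ f ∈ M, Disjoint (H f) Y) ∧
  (∀ x ∈ Y, (dg H Y x : ℝ) ≤ (u + b) * D) ∧ (∀ x ∈ Y, Full x → (u - b) * D ≤ dg H Y x) ∧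
  ∀ j, ∑ x ∈ Y, w j x ≤ k ∧ ∑ x ∈ (univ \ Y) \ M.biUnion H, w j x ≤ o

theorem NibbleState.step {H : ι → Finset X} {Full : X → Prop} {w : J → X → ℝ}
    {D u b k o : ℝ} {M : Finset ι} {Y : Finset X} (hS : NibbleState H Full w D u b k o M Y)
    {r : ℕ} (hr : ∀ f, (H f).card = r) (hr1 : 1 ≤ r) {Cd a β uK bK m : ℝ} (hCd : 1 ≤ Cd)
    (hcd : ∀ x y, x ≠ y → ((univ.filter fun f => x ∈ H f ∧ y ∈ H f).card : ℝ) ≤ Cd)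
    (ha : 0 ≤ a) (ha1 : a ≤ 1) (hβ : 0 < β) (hβb : β ≤ b) (hbK : b ≤ bK) (hbK1 : bK ≤ 1)
    (huK : 0 < uK) (hu : uK ≤ u) (hu1 : u ≤ 1) (hCdD : r ^ 2 * Cd ≤ β * D)
    (hm : 0 < m) (hw : ∀ j x, 0 ≤ w j x)
    (hwm : ∀ j x, w j x ≤ m) (hwF : ∀ j x, ¬ Full x → w j x = 0) (hw1 : ∀ j, ∑ x, w j x ≤ 1)
    (hU : 2 * Fintype.card X * Real.exp (-(β ^ 2 * (uK * D) / (4 * r ^ 2 * Cd))) +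
      3 * Fintype.card J * Real.exp (-(β ^ 2 / (4 * r ^ 2 * m))) < 1) :
    ∃ M' Y', NibbleState H Full w D (u * Real.exp (-a) ^ (r - 1)) (b + 4 * β)
      (Real.exp (-a) * k + β) (o + (6 * a * bK / uK + 4 * a ^ 2 * r + 3 * β)) M' Y' := by
  obtain ⟨hM, hMY, hup, hlow, hW⟩ := hS
  have hr1' : (1 : ℝ) ≤ r := by exact_mod_cast hr1
  have hr2 : (1 : ℝ) ≤ (r : ℝ) ^ 2 := one_le_pow₀ hr1'
  have hβD : 1 ≤ β * D := by nlinarith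
  have hD : 0 < D := by
    by_contra! h
    nlinarith
  have hub : 0 < u + b := by linarith
  set Δ : ℕ := ⌈(u + b) * D⌉₊ with hΔdef
  have hΔ1 : (u + b) * D ≤ Δ := Nat.le_ceil _
  have hΔ2 : (Δ : ℝ) ≤ (u + b) * D + 1 := (Nat.ceil_lt_add_one (by positivity)).le
  have hΔ0 : 1 ≤ Δ := Nat.one_le_iff_ne_zero.2 (by
    rw [hΔdef]
    exact (Nat.ceil_pos.2 (by positivity)).ne')
  have hΔpos : (0 : ℝ) < Δ := by exact_mod_cast hΔ0
  have hΔ3 : (Δ : ℝ) ≤ 3 * D := by nlinarith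
  have hΔK : uK * D ≤ Δ := by nlinarith
  have hsub1 : ∀ j, ∑ x ∈ Y, w j x ≤ 1 := fun j =>
    (Finset.sum_le_sum_of_subset_of_nonneg (subset_univ Y) fun x _ _ => hw j x).trans (hw1 j)
  obtain ⟨M', Y', hY', hMs, hMd, hMY', hdeg, hwt⟩ := nibble_round (H := H) (Y := Y) (Δ := Δ) hr hr1
    hCd hcd (fun x hx => by
      have := (hup x hx).trans hΔ1
      exact_mod_cast this) hΔ0 ha ha1 hβ.le (by linarith) hm w hw hwm hsub1 (by
      refine lt_of_le_of_lt (add_le_add_left (mul_le_mul_of_nonneg_left ?_ (by positivity)) _) hU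
      apply Real.exp_le_exp.2
      rw [neg_le_neg_iff]
      gcongr)
  set κ := Real.exp (-a) with hκ
  have hκ0 : 0 < κ := Real.exp_pos _
  have hκ1 : κ ≤ 1 := Real.exp_le_one_iff.2 (by linarith)
  have hκr0 : 0 < κ ^ (r - 1) := pow_pos hκ0 _
  have hκr1 : κ ^ (r - 1) ≤ 1 := pow_le_one₀ hκ0.le hκ1
  refine ⟨M ∪ M', Y', ?_, ?_, ?_, ?_, ?_⟩
  · intro f hf g hg hfg
    rcases mem_union.1 hf with hf | hf <;> rcases mem_union.1 hg with hg | hg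
    · exact hM f hf g hg hfg
    · exact (hMY f hf).mono_right (hMs g hg)
    · exact ((hMY g hg).mono_right (hMs f hf)).symm
    · exact hMd f hf g hg hfg
  · intro f hf
    rcases mem_union.1 hf with hf | hf
    · exact (hMY f hf).mono_right hY'
    · exact hMY' f hf
  · intro x hx
    have h1 := (hdeg x hx).1
    have h2 : (dg H Y x : ℝ) * κ ^ (r - 1) ≤ (u + b) * D * κ ^ (r - 1) :=
      mul_le_mul_of_nonneg_right (hup x (hY' hx)) hκr0.le
    have h3 : b * D * κ ^ (r - 1) ≤ b * D := mul_le_of_le_one_right (by nlinarith) hκr1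
    have h4 : a * r ^ 2 * Cd ≤ β * D := by
      calc _ = a * (r ^ 2 * Cd) := by ring
        _ ≤ 1 * (r ^ 2 * Cd) := mul_le_mul_of_nonneg_right ha1 (by positivity)
        _ ≤ _ := by linarith
    have h5 : β * Δ ≤ β * (3 * D) := mul_le_mul_of_nonneg_left hΔ3 hβ.le
    linarith
  · intro x hx hxF
    have h1 := (hdeg x hx).2
    have h2 : (u - b) * D * κ ^ (r - 1) ≤ (dg H Y x : ℝ) * κ ^ (r - 1) :=
      mul_le_mul_of_nonneg_right (hlow x (hY' hx) hxF) hκr0.le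
    have h3 : b * D * κ ^ (r - 1) ≤ b * D := mul_le_of_le_one_right (by nlinarith) hκr1
    have h5 : β * Δ ≤ β * (3 * D) := mul_le_mul_of_nonneg_left hΔ3 hβ.le
    linarith
  · intro j
    obtain ⟨hk, ho⟩ := hW j
    obtain ⟨h1, h2⟩ := hwt j
    constructor
    · have := mul_le_mul_of_nonneg_left hk hκ0.le
      linarith
    · have hsub : (univ \ Y') \ (M ∪ M').biUnion H ⊆
          ((univ \ Y) \ M.biUnion H) ∪ ((Y \ Y') \ M'.biUnion H) := by
        intro x hx
        simp only [mem_sdiff, mem_univ, true_and, mem_union, mem_biUnion, not_exists, not_and] at hx ⊢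
        obtain ⟨hx1, hx2⟩ := hx
        by_cases hxY : x ∈ Y
        · exact Or.inr ⟨⟨hxY, hx1⟩, fun f hf => hx2 f (Or.inr hf)⟩
        · exact Or.inl ⟨hxY, fun f hf => hx2 f (Or.inl hf)⟩
      have h3 : ∑ x ∈ (univ \ Y') \ (M ∪ M').biUnion H, w j x ≤
          ∑ x ∈ (univ \ Y) \ M.biUnion H, w j x + ∑ x ∈ (Y \ Y') \ M'.biUnion H, w j x := by
        refine (Finset.sum_le_sum_of_subset_of_nonneg hsub fun x _ _ => hw j x).trans ?_
        have := Finset.sum_union_inter (s₁ := (univ \ Y) \ M.biUnion H)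
          (s₂ := (Y \ Y') \ M'.biUnion H) (f := w j)
        have h4 : 0 ≤ ∑ x ∈ ((univ \ Y) \ M.biUnion H) ∩ ((Y \ Y') \ M'.biUnion H), w j x :=
          Finset.sum_nonneg fun x _ => hw j x
        linarith
      have hWn : 0 ≤ ∑ x ∈ Y, w j x := Finset.sum_nonneg fun x _ => hw j x
      have hZ : ∑ x ∈ Y, w j x * ((Δ : ℝ) - dg H Y x) ≤ 3 * bK * D := by
        calc _ ≤ ∑ x ∈ Y, w j x * (3 * bK * D) := by
              refine Finset.sum_le_sum fun x hx => ?_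
              by_cases hxF : Full x
              · refine mul_le_mul_of_nonneg_left ?_ (hw j x)
                have := hlow x hx hxF
                nlinarith
              · simp [hwF j x hxF]
          _ = (∑ x ∈ Y, w j x) * (3 * bK * D) := by rw [Finset.sum_mul]
          _ ≤ 1 * (3 * bK * D) := mul_le_mul_of_nonneg_right (hsub1 j) (by
              have : 0 < bK := by linarith
              positivity)
          _ = _ := one_mul _
      have hbK0 : 0 < bK := by linarith
      have hZΔ : (∑ x ∈ Y, w j x * ((Δ : ℝ) - dg H Y x)) / Δ ≤ 3 * bK / uK := by
        rw [div_le_div_iff₀ hΔpos huK]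
        calc _ ≤ 3 * bK * D * uK := mul_le_mul_of_nonneg_right hZ huK.le
          _ = 3 * bK * (uK * D) := by ring
          _ ≤ _ := mul_le_mul_of_nonneg_left hΔK (by positivity)
      have h5 : 2 * a * ((∑ x ∈ Y, w j x * ((Δ : ℝ) - dg H Y x)) / Δ) ≤ 6 * a * bK / uK := by
        calc _ ≤ 2 * a * (3 * bK / uK) := mul_le_mul_of_nonneg_left hZΔ (by positivity)
          _ = _ := by ring
      have h6 : 4 * a ^ 2 * r * (∑ x ∈ Y, w j x) ≤ 4 * a ^ 2 * r :=
        mul_le_of_le_one_right (by positivity) (hsub1 j)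
      linarith

end Iterate

set_option maxHeartbeats 1000000 in
/-- Nibble theorem: a nearly regular hypergraph with small codegrees has a matching that is nearly
perfect with respect to every test weight supported on the vertices of full degree. -/
theorem nibble (r : ℕ) (hr1 : 1 ≤ r) (δ : ℝ) (hδ : 0 < δ) : ∃ β : ℝ, 0 < β ∧
    ∀ (X ι J : Type) [Fintype X] [DecidableEq X] [Fintype ι] [DecidableEq ι] [Fintype J]
      (H : ι → Finset X) (Full : X → Prop) (w : J → X → ℝ) (D Cd m : ℝ),
      (∀ f, (H f).card = r) → 1 ≤ Cd → Cd ≤ β * D →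
      (∀ x, (dg H univ x : ℝ) ≤ (1 + β) * D) →
      (∀ x, Full x → (1 - β) * D ≤ dg H univ x) →
      (∀ x y, x ≠ y → ((univ.filter fun f => x ∈ H f ∧ y ∈ H f).card : ℝ) ≤ Cd) →
      0 < m → (∀ j x, 0 ≤ w j x) → (∀ j x, w j x ≤ m) → (∀ j x, ¬ Full x → w j x = 0) →
      (∀ j, ∑ x, w j x ≤ 1) →
      2 * Fintype.card X * Real.exp (-(β * D / Cd)) +
        3 * Fintype.card J * Real.exp (-(β / m)) < 1 →
      ∃ M : Finset ι, (∀ f ∈ M, ∀ g ∈ M, f ≠ g → Disjoint (H f) (H g)) ∧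
        ∀ j, ∑ x ∈ univ \ M.biUnion H, w j x ≤ δ := by
  wlog hδ1 : δ ≤ 1 generalizing δ
  · obtain ⟨β, hβ, h⟩ := this 1 one_pos le_rfl
    refine ⟨β, hβ, ?_⟩
    intro X ι J _ _ _ _ _ H Full w D Cd m a1 a2 a3 a4 a5 a6 a7 a8 a9 a10 a11 a12
    obtain ⟨M, hM, hM'⟩ := h X ι J H Full w D Cd m a1 a2 a3 a4 a5 a6 a7 a8 a9 a10 a11 a12
    exact ⟨M, hM, fun j => (hM' j).trans (by linarith)⟩
  have hr1' : (1 : ℝ) ≤ r := by exact_mod_cast hr1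
  set L := Real.log (4 / δ) with hL
  have hL0 : 0 < L := Real.log_pos (by rw [lt_div_iff₀ hδ]; linarith)
  obtain ⟨K, hK⟩ := exists_nat_ge (max L (16 * r * L ^ 2 / δ))
  have hKL : L ≤ K := (le_max_left _ _).trans hK
  have hK2 : 16 * r * L ^ 2 / δ ≤ K := (le_max_right _ _).trans hK
  have hK0 : (0 : ℝ) < K := by linarith
  set a := L / K with ha
  have ha0 : 0 < a := by positivity
  have ha1 : a ≤ 1 := by rw [ha, div_le_one hK0]; exact hKL
  set κ := Real.exp (-a) with hκ
  have hκ0 : 0 < κ := Real.exp_pos _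
  have hκ1 : κ ≤ 1 := Real.exp_le_one_iff.2 (by linarith)
  set q := κ ^ (r - 1) with hq
  have hq0 : 0 < q := pow_pos hκ0 _
  have hq1 : q ≤ 1 := pow_le_one₀ hκ0.le hκ1
  have hκK : κ ^ K = δ / 4 := by
    rw [hκ, ← Real.exp_nat_mul, ha]
    have : (K : ℝ) * -(L / K) = -L := by field_simp
    rw [this, hL, Real.exp_neg, Real.exp_log (by positivity), inv_div]
  set uK := q ^ K with huK
  have huK0 : 0 < uK := pow_pos hq0 _
  have huK1 : uK ≤ 1 := pow_le_one₀ hq0.le hq1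
  set b := δ * uK / (48 * (L + 1) * (1 + 4 * K)) with hb
  have hb0 : 0 < b := by positivity
  have hbK : (1 + 4 * K) * b = δ * uK / (48 * (L + 1)) := by rw [hb]; field_simp
  have hbK48 : (1 + 4 * K) * b ≤ δ * uK / 48 := by
    rw [hbK]
    apply div_le_div_of_nonneg_left (by positivity) (by positivity)
    nlinarith
  have hbKδ : (1 + 4 * K) * b ≤ δ / 48 := by
    refine hbK48.trans ?_
    have : δ * uK ≤ δ := mul_le_of_le_one_right hδ.le huK1
    linarith
  have hb1 : b ≤ 1 := by nlinarith
  refine ⟨b ^ 2 * uK / (4 * r ^ 2), by positivity, ?_⟩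
  intro X ι J _ _ _ _ _ H Full w D Cd m hr hCd hCdD hup hlow hcd hm hw hwm hwF hw1 hU
  set β := b ^ 2 * uK / (4 * r ^ 2) with hβ
  have hβ0 : 0 < β := by positivity
  have hβr : r ^ 2 * β ≤ b := by
    have : r ^ 2 * β = b * b * uK / 4 := by rw [hβ]; field_simp
    rw [this]
    have : b * b ≤ b * 1 := mul_le_mul_of_nonneg_left hb1 hb0.le
    have : b * b * uK ≤ b * b := mul_le_of_le_one_right (by positivity) huK1
    linarith
  have hr2 : (1 : ℝ) ≤ (r : ℝ) ^ 2 := one_le_pow₀ hr1'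
  have hβb : β ≤ b := by nlinarith
  have hD : 0 < D := by
    by_contra! h
    nlinarith
  have hCdD' : r ^ 2 * Cd ≤ b * D := by
    calc r ^ 2 * Cd ≤ r ^ 2 * (β * D) := mul_le_mul_of_nonneg_left hCdD (by positivity)
      _ = (r ^ 2 * β) * D := by ring
      _ ≤ b * D := mul_le_mul_of_nonneg_right hβr hD.le
  have hU' : 2 * Fintype.card X * Real.exp (-(b ^ 2 * (uK * D) / (4 * r ^ 2 * Cd))) +
      3 * Fintype.card J * Real.exp (-(b ^ 2 / (4 * r ^ 2 * m))) < 1 := by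
    refine lt_of_le_of_lt (add_le_add ?_ ?_) hU
    · refine mul_le_mul_of_nonneg_left (Real.exp_le_exp.2 ?_) (by positivity)
      rw [neg_le_neg_iff, hβ]
      apply le_of_eq
      field_simp
    · refine mul_le_mul_of_nonneg_left (Real.exp_le_exp.2 ?_) (by positivity)
      rw [neg_le_neg_iff, hβ]
      have : b ^ 2 * uK / (4 * r ^ 2) / m = b ^ 2 / (4 * r ^ 2 * m) * uK := by field_simp
      rw [this]
      exact mul_le_of_le_one_right (by positivity) huK1
  set o := 6 * a * ((1 + 4 * K) * b) / uK + 4 * a ^ 2 * r + 3 * b with ho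
  have main : ∀ s : ℕ, s ≤ K → ∃ M Y, NibbleState H Full w D (q ^ s) ((1 + 4 * s) * b)
      (κ ^ s + s * b) (s * o) M Y := by
    intro s
    induction s with
    | zero =>
      intro _
      refine ⟨∅, univ, by simp, by simp, ?_, ?_, ?_⟩
      · intro x _
        have := hup x
        have h1 : β * D ≤ b * D := mul_le_mul_of_nonneg_right hβb hD.le
        simp only [pow_zero, Nat.cast_zero, mul_zero, add_zero, one_mul]
        linarith
      · intro x _ hx
        have := hlow x hx
        have h1 : β * D ≤ b * D := mul_le_mul_of_nonneg_right hβb hD.le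
        simp only [pow_zero, Nat.cast_zero, mul_zero, add_zero, one_mul]
        linarith
      · intro j
        simpa using hw1 j
    | succ s ih =>
      intro hs
      obtain ⟨M, Y, hS⟩ := ih (by omega)
      have hsK : (s : ℝ) ≤ K := by exact_mod_cast (by omega : s ≤ K)
      obtain ⟨M', Y', hS'⟩ := hS.step hr hr1 hCd hcd ha0.le ha1 hb0
        (bK := (1 + 4 * K) * b) (uK := uK)
        (by linarith [mul_nonneg (Nat.cast_nonneg (α := ℝ) s) hb0.le])
        (mul_le_mul_of_nonneg_right (by linarith) hb0.le) (by linarith) huK0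
        (pow_le_pow_of_le_one hq0.le hq1 (by omega)) (pow_le_one₀ hq0.le hq1) hCdD' hm hw hwm hwF
        hw1 hU'
      refine ⟨M', Y', ?_⟩
      obtain ⟨h1, h2, h3, h4, h5⟩ := hS'
      refine ⟨h1, h2, ?_, ?_, ?_⟩
      · intro x hx
        have := h3 x hx
        rw [pow_succ]
        push_cast
        linarith
      · intro x hx hxF
        have := h4 x hx hxF
        rw [pow_succ]
        push_cast
        linarith
      · intro j
        obtain ⟨h6, h7⟩ := h5 j
        constructor
        · rw [pow_succ]
          push_cast
          have : κ * (s * b) ≤ s * b := mul_le_of_le_one_left (by positivity) hκ1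
          rw [← hκ] at h6
          linarith
        · push_cast
          linarith
  obtain ⟨M, Y, hM, hMY, _, _, hW⟩ := main K le_rfl
  refine ⟨M, hM, fun j => ?_⟩
  obtain ⟨h1, h2⟩ := hW j
  have hsub : univ \ M.biUnion H ⊆ Y ∪ ((univ \ Y) \ M.biUnion H) := by
    intro x hx
    by_cases hxY : x ∈ Y
    · exact mem_union_left _ hxY
    · exact mem_union_right _ (by simpa [hxY] using hx)
  have h3 : ∑ x ∈ univ \ M.biUnion H, w j x ≤
      ∑ x ∈ Y, w j x + ∑ x ∈ (univ \ Y) \ M.biUnion H, w j x := by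
    refine (Finset.sum_le_sum_of_subset_of_nonneg hsub fun x _ _ => hw j x).trans ?_
    have := Finset.sum_union_inter (s₁ := Y) (s₂ := (univ \ Y) \ M.biUnion H) (f := w j)
    have h4 : 0 ≤ ∑ x ∈ Y ∩ ((univ \ Y) \ M.biUnion H), w j x :=
      Finset.sum_nonneg fun x _ => hw j x
    linarith
  have hKa : K * a = L := by rw [ha]; field_simp
  have e1 : K * (6 * a * ((1 + 4 * K) * b) / uK) ≤ δ / 8 := by
    have : K * (6 * a * ((1 + 4 * K) * b) / uK) = 6 * (K * a) * ((1 + 4 * K) * b) / uK := by ring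
    rw [this, hKa, hbK]
    have : 6 * L * (δ * uK / (48 * (L + 1))) / uK = δ / 8 * (L / (L + 1)) := by
      field_simp; ring
    rw [this]
    refine mul_le_of_le_one_right (by positivity) ?_
    rw [div_le_one (by positivity)]
    linarith
  have e2 : K * (4 * a ^ 2 * r) ≤ δ / 4 := by
    have : K * (4 * a ^ 2 * r) = 16 * r * L ^ 2 / δ / K * (δ / 4) := by
      rw [ha]; field_simp; ring
    rw [this]
    refine mul_le_of_le_one_left (by positivity) ?_
    rw [div_le_one hK0]
    exact hK2
  have e3 : K * (3 * b) ≤ δ / 48 := by nlinarith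
  have e4 : K * b ≤ δ / 48 := by nlinarith
  have e5 : K * o = K * (6 * a * ((1 + 4 * K) * b) / uK) + K * (4 * a ^ 2 * r) + K * (3 * b) := by
    rw [ho]; ring
  rw [hκK] at h1
  linarith

section Statistics

variable {σ Ω : Type*} [Fintype σ] [DecidableEq σ] [Fintype Ω]

theorem Ex_one_coord (μ : Wt Ω) (s : σ) (h : Ω → ℝ) :
    Ex μ (fun ω => h (ω s)) = ∑ a, μ.w a * h a := by
  rw [← Ex_avg μ s]
  have : avg μ s (fun ω => h (ω s)) = fun _ => ∑ a, μ.w a * h a := by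
    ext ω
    simp [avg]
  rw [this]
  exact Ex_const μ _

theorem Ex_two_coord (μ : Wt Ω) {x y : σ} (hxy : x ≠ y) (h : Ω → Ω → ℝ) :
    Ex μ (fun ω => h (ω x) (ω y)) = ∑ a, μ.w a * ∑ b, μ.w b * h a b := by
  rw [← Ex_avg μ x]
  have : avg μ x (fun ω => h (ω x) (ω y)) = fun ω => ∑ a, μ.w a * h a (ω y) := by
    ext ω
    simp [avg, Function.update_of_ne hxy.symm]
  rw [this, Ex_one_coord μ y (fun b => ∑ a, μ.w a * h a b)]
  simp only [Finset.mul_sum]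
  rw [Finset.sum_comm]
  exact Finset.sum_congr rfl fun _ _ => Finset.sum_congr rfl fun _ _ => by ring

/-- A statistic with coordinatewise Lipschitz constants at most `L` and of total at most `2 * N`. -/
def Conc (f : (σ → Ω) → ℝ) (N L : ℝ) : Prop :=
  ∃ c : σ → ℝ, (∀ s, 0 ≤ c s) ∧ (∀ s, c s ≤ L) ∧ (∀ s, Lip f s (c s)) ∧ ∑ s, c s ≤ 2 * N

theorem conc_sum_pairs {ρ : Type*} (P : Finset ρ) (x y : ρ → σ) (g : ρ → Ω → Ω → ℝ) {N L : ℝ}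
    (h0 : ∀ p a b, 0 ≤ g p a b) (h1 : ∀ p a b, g p a b ≤ 1)
    (hL : ∀ s, ((P.filter fun p => x p = s).card : ℝ) + (P.filter fun p => y p = s).card ≤ L)
    (hN : (P.card : ℝ) ≤ N) :
    Conc (fun ω : σ → Ω => ∑ p ∈ P, g p (ω (x p)) (ω (y p))) N L := by
  refine ⟨fun s => ((P.filter fun p => x p = s).card : ℝ) + (P.filter fun p => y p = s).card,
    fun s => by positivity, hL, ?_, ?_⟩
  · intro s ω a
    rw [← Finset.sum_sub_distrib]
    refine (Finset.abs_sum_le_sum_abs _ _).trans ?_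
    simp only [Finset.card_filter]
    push_cast
    rw [← Finset.sum_add_distrib]
    refine Finset.sum_le_sum fun p _ => ?_
    by_cases hx : x p = s
    · have : |g p (Function.update ω s a (x p)) (Function.update ω s a (y p)) -
          g p (ω (x p)) (ω (y p))| ≤ 1 := by
        rw [abs_le]
        constructor <;> linarith [h0 p (Function.update ω s a (x p)) (Function.update ω s a (y p)),
          h1 p (Function.update ω s a (x p)) (Function.update ω s a (y p)),
          h0 p (ω (x p)) (ω (y p)), h1 p (ω (x p)) (ω (y p))]
      refine this.trans ?_
      rw [if_pos hx]
      split_ifs <;> norm_num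
    · by_cases hy : y p = s
      · have : |g p (Function.update ω s a (x p)) (Function.update ω s a (y p)) -
            g p (ω (x p)) (ω (y p))| ≤ 1 := by
          rw [abs_le]
          constructor <;> linarith [h0 p (Function.update ω s a (x p)) (Function.update ω s a (y p)),
            h1 p (Function.update ω s a (x p)) (Function.update ω s a (y p)),
            h0 p (ω (x p)) (ω (y p)), h1 p (ω (x p)) (ω (y p))]
        refine this.trans ?_
        rw [if_pos hy]
        split_ifs <;> norm_num
      · rw [Function.update_of_ne hx, Function.update_of_ne hy]
        simp [hx, hy]
  · rw [Finset.sum_add_distrib]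
    have key : ∀ z : ρ → σ, ∑ s, ((P.filter fun p => z p = s).card : ℝ) = P.card := by
      intro z
      rw [Finset.card_eq_sum_card_fiberwise (s := P) (t := univ) (f := z) (fun _ _ => mem_univ _)]
      push_cast
      rfl
    rw [key, key]
    linarith

theorem exists_forall_abs_sub_Ex_le {J : Type*} [Fintype J] (μ : Wt Ω) (f : J → (σ → Ω) → ℝ)
    {N L β : ℝ} (hN : 0 < N) (hL : 0 < L) (hβ : 0 ≤ β) (hβ1 : β ≤ 1) (hf : ∀ j, Conc (f j) N L)
    (hJ : 2 * Fintype.card J * Real.exp (-(β ^ 2 * N / (8 * L))) < 1) :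
    ∃ ω, ∀ j, |f j ω - Ex μ (f j)| ≤ β * N := by
  have key : ∀ j, Pr μ (fun ω => β * N < |f j ω - Ex μ (f j)|) ≤
      2 * Real.exp (-(β ^ 2 * N / (8 * L))) := by
    intro j
    obtain ⟨c, hc0, hcL, hcf, hcs⟩ := hf j
    have hexp : (β * N) ^ 2 / (4 * (2 * N) * L) = β ^ 2 * N / (8 * L) := by field_simp; ring
    have hup := Pr_upper_tail μ (varF_one μ) zero_le_one (f j) c hL (A := 2 * N) (t := β * N)
      (by positivity) (by positivity) (by nlinarith) hc0 hcL hcf (by linarith)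
    have hlo := Pr_lower_tail μ (varF_one μ) zero_le_one (f j) c hL (A := 2 * N) (t := β * N)
      (by positivity) (by positivity) (by nlinarith) hc0 hcL hcf (by linarith)
    rw [hexp] at hup hlo
    have hor := Pr_or_le μ (fun ω => Ex μ (f j) + β * N < f j ω)
      (fun ω => f j ω < Ex μ (f j) - β * N)
    have hmono : Pr μ (fun ω => β * N < |f j ω - Ex μ (f j)|) ≤
        Pr μ (fun ω => Ex μ (f j) + β * N < f j ω ∨ f j ω < Ex μ (f j) - β * N) := by
      refine Pr_mono μ fun ω h => ?_
      rcases lt_abs.1 h with h | h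
      · left; linarith
      · right; linarith
    linarith
  obtain ⟨ω, hω⟩ := exists_not_of_Pr_lt_one μ
    (P := fun ω => ∃ j, β * N < |f j ω - Ex μ (f j)|) (by
      refine ((Pr_exists_le μ _).trans (Finset.sum_le_sum fun j _ => key j)).trans_lt ?_
      rw [Finset.sum_const, nsmul_eq_mul, Finset.card_univ]
      linarith)
  exact ⟨ω, fun j => not_lt.1 fun h => hω ⟨j, h⟩⟩

end Statistics

section Reserve

variable {V C : Type} [Fintype V] [DecidableEq V] [Fintype C] [DecidableEq C]

/-- Number of edges of colour `c` at `v`. -/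
def dc (φ : Sym2 V → C) (c : C) (v : V) : ℕ := (univ.filter fun u => u ≠ v ∧ φ s(v, u) = c).card

/-- Number of neighbours of `u` in `S` along edges with colour in `Q`. -/
def rdeg (φ : Sym2 V → C) (Q : Finset C) (u : V) (S : Finset V) : ℕ :=
  (S.filter fun v => v ≠ u ∧ φ s(u, v) ∈ Q).card

set_option maxHeartbeats 2000000 in
theorem exists_reserve (φ : Sym2 V → C) {q γ β Cl : ℝ} (hq0 : 0 ≤ q) (hq1 : q ≤ 1) (hγ : 0 < γ)
    (hγ1 : γ ≤ 1) (hβ : β = γ ^ 3 / 16) (hCl : 1 ≤ Cl) (hd : ∀ c v, (dc φ c v : ℝ) ≤ Cl)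
    (hβn : 1 ≤ β * Fintype.card V) (hCβ : Cl ≤ β * Fintype.card V)
    (hexp : 4 * (Fintype.card V : ℝ) ^ 2 * Real.exp (-(β ^ 2 * Fintype.card V / (16 * Cl))) < 1) :
    ∃ Q : Finset C, (∀ u, |(rdeg φ Q u univ : ℝ) - q * Fintype.card V| ≤ γ * Fintype.card V) ∧
      ∀ S : Finset V, ((univ.filter fun w =>
        (rdeg φ Q w S : ℝ) < q * S.card - γ * Fintype.card V).card : ℝ) ≤ γ * Fintype.card V := by
  set n := Fintype.card V with hn
  have hβ0 : 0 < β := by rw [hβ]; positivity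
  have hβ1 : β ≤ 1 := by
    rw [hβ]
    have : γ ^ 3 ≤ 1 := pow_le_one₀ hγ.le hγ1
    linarith
  have hβγ : 16 * β ≤ γ := by
    have : γ ^ 3 ≤ γ ^ 1 := pow_le_pow_of_le_one hγ.le hγ1 (by norm_num)
    rw [hβ]
    linarith
  have hn1 : (1 : ℝ) ≤ n := by
    by_contra! h
    nlinarith
  set f : V ⊕ V × V → (C → Bool) → ℝ := Sum.elim
    (fun u ω => ∑ v ∈ univ.erase u, if ω (φ s(u, v)) then 1 else 0)
    (fun p ω => ∑ w ∈ (univ.erase p.1).erase p.2,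
      if ω (φ s(p.1, w)) ∧ ω (φ s(p.2, w)) then 1 else 0) with hf
  have hcount : ∀ (P : Finset V) (u : V) (c : C), u ∉ P →
      ((P.filter fun v => φ s(u, v) = c).card : ℝ) ≤ Cl := by
    intro P u c hu
    refine le_trans ?_ (hd c u)
    rw [dc]
    refine Nat.cast_le.2 (Finset.card_le_card fun v hv => ?_)
    rw [mem_filter] at hv ⊢
    exact ⟨mem_univ _, fun h => hu (h ▸ hv.1), hv.2⟩
  have hconc : ∀ j, Conc (f j) n (2 * Cl) := by
    rintro (u | ⟨u, v⟩)
    · refine conc_sum_pairs (univ.erase u) (fun v => φ s(u, v)) (fun v => φ s(u, v))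
        (fun _ (a _ : Bool) => if a then 1 else 0) (fun _ a _ => by split_ifs <;> norm_num)
        (fun _ a _ => by split_ifs <;> norm_num) (fun c => ?_) ?_
      · linarith [hcount (univ.erase u) u c (notMem_erase _ _)]
      · exact Nat.cast_le.2 (Finset.card_le_univ _)
    · refine conc_sum_pairs ((univ.erase u).erase v) (fun w => φ s(u, w)) (fun w => φ s(v, w))
        (fun _ (a b : Bool) => if a ∧ b then 1 else 0) (fun _ a _ => by split_ifs <;> norm_num)
        (fun _ a _ => by split_ifs <;> norm_num) (fun c => ?_) ?_
      · linarith [hcount ((univ.erase u).erase v) u c (by simp),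
          hcount ((univ.erase u).erase v) v c (by simp)]
      · exact Nat.cast_le.2 (Finset.card_le_univ _)
  obtain ⟨ω, hω⟩ := exists_forall_abs_sub_Ex_le (bern q hq0 hq1) f (N := n) (L := 2 * Cl) (β := β)
    (by linarith) (by linarith) hβ0.le hβ1 hconc (by
      have h16 : β ^ 2 * n / (8 * (2 * Cl)) = β ^ 2 * n / (16 * Cl) := by ring
      rw [h16]
      refine lt_of_le_of_lt (mul_le_mul_of_nonneg_right ?_ (Real.exp_pos _).le) hexp
      rw [Fintype.card_sum, Fintype.card_prod]
      push_cast
      nlinarith)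
  set Q : Finset C := univ.filter fun c => ω c with hQ
  have hmemQ : ∀ c, c ∈ Q ↔ ω c = true := by simp [hQ]
  set A : V → V → ℝ := fun w u => if u ≠ w ∧ φ s(w, u) ∈ Q then 1 else 0 with hA
  have hA0 : ∀ w u, 0 ≤ A w u := fun w u => by simp only [hA]; split_ifs <;> norm_num
  have hA1 : ∀ w u, A w u ≤ 1 := fun w u => by simp only [hA]; split_ifs <;> norm_num
  have hAsymm : ∀ w u, A w u = A u w := fun w u => by
    simp only [hA, Sym2.eq_swap (a := w) (b := u), ne_comm (a := u) (b := w)]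
  have hrdeg : ∀ w S, (rdeg φ Q w S : ℝ) = ∑ u ∈ S, A w u := by
    intro w S
    simp [rdeg, hA]
  have hfu : ∀ u, f (Sum.inl u) ω = ∑ v, A u v := by
    intro u
    simp only [hf, Sum.elim_inl]
    rw [← Finset.add_sum_erase univ _ (mem_univ u)]
    have : A u u = 0 := by simp [hA]
    rw [this, zero_add]
    refine Finset.sum_congr rfl fun v hv => ?_
    simp [hA, hmemQ, ne_of_mem_erase hv]
  have hEu : ∀ u, Ex (bern q hq0 hq1) (f (Sum.inl u)) = q * (n - 1) := by
    intro u
    simp only [hf, Sum.elim_inl]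
    rw [Ex_sum]
    have : ∀ v ∈ univ.erase u, Ex (bern q hq0 hq1)
        (fun ω => if ω (φ s(u, v)) then (1 : ℝ) else 0) = q := by
      intro v _
      refine (Ex_one_coord _ (φ s(u, v)) (fun a : Bool => if a then (1 : ℝ) else 0)).trans ?_
      simp [bern]
    rw [Finset.sum_congr rfl this, Finset.sum_const, nsmul_eq_mul, Finset.card_erase_of_mem
      (mem_univ _), Finset.card_univ, Nat.cast_sub (by exact_mod_cast hn1)]
    push_cast
    ring
  have hdegu : ∀ u, |∑ v, A u v - q * (n - 1)| ≤ β * n := by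
    intro u
    have := hω (Sum.inl u)
    rwa [hfu, hEu] at this
  have hmono_bd : ∀ u v, u ≠ v → ∑ w, A w u * A w v ≤ q ^ 2 * n +
      (((univ.erase u).erase v).filter fun w => φ s(u, w) = φ s(v, w)).card + β * n := by
    intro u v huv
    have h1 := hω (Sum.inr (u, v))
    have h2 : f (Sum.inr (u, v)) ω = ∑ w, A w u * A w v := by
      simp only [hf, Sum.elim_inr]
      have hu : v ∈ univ.erase u := by simp [huv.symm]
      rw [← Finset.add_sum_erase univ _ (mem_univ u), ← Finset.add_sum_erase _ _ hu]
      have e1 : A u u = 0 := by simp [hA]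
      have e2 : A v v = 0 := by simp [hA]
      rw [e1, e2, zero_mul, mul_zero, zero_add, zero_add]
      refine Finset.sum_congr rfl fun w hw => ?_
      rw [hAsymm w u, hAsymm w v]
      have hwv := ne_of_mem_erase hw
      have hwu := ne_of_mem_erase (mem_of_mem_erase hw)
      simp only [hA, hmemQ, hwu, hwv, ne_eq, not_false_iff, true_and]
      split_ifs <;> simp_all
    have h3 : Ex (bern q hq0 hq1) (f (Sum.inr (u, v))) ≤ q ^ 2 * n +
        (((univ.erase u).erase v).filter fun w => φ s(u, w) = φ s(v, w)).card := by
      simp only [hf, Sum.elim_inr]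
      rw [Ex_sum]
      have : ∀ w ∈ (univ.erase u).erase v, Ex (bern q hq0 hq1)
          (fun ω => if ω (φ s(u, w)) ∧ ω (φ s(v, w)) then (1 : ℝ) else 0) ≤
          q ^ 2 + if φ s(u, w) = φ s(v, w) then 1 else 0 := by
        intro w _
        split_ifs with hc
        · rw [hc]
          refine (Ex_one_coord _ (φ s(v, w)) (fun a : Bool =>
            if a ∧ a then (1 : ℝ) else 0)).trans_le ?_
          simp only [bern, Fintype.sum_bool]
          simp
          nlinarith
        · refine (Ex_two_coord _ hc (fun a b : Bool =>
            if a ∧ b then (1 : ℝ) else 0)).trans_le ?_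
          simp only [bern, Fintype.sum_bool]
          simp
          nlinarith
      refine (Finset.sum_le_sum this).trans ?_
      rw [Finset.sum_add_distrib, Finset.sum_const, nsmul_eq_mul, Finset.card_filter]
      push_cast
      have : (((univ.erase u).erase v).card : ℝ) ≤ n := Nat.cast_le.2 (Finset.card_le_univ _)
      nlinarith [sq_nonneg q]
    rw [h2] at h1
    linarith [(abs_le.1 h1).2]
  refine ⟨Q, fun u => ?_, fun S => ?_⟩
  · rw [hrdeg]
    have := hdegu u
    rw [abs_le] at this ⊢
    constructor <;> nlinarith
  · set T : V → V → ℝ := fun u v => ∑ w, (A w u - q) * (A w v - q) with hT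
    set B : V → V → ℝ := fun u v => (if u = v then (n : ℝ) else 0) +
      (((univ.erase u).erase v).filter fun w => φ s(u, w) = φ s(v, w) ∧ u ≠ v).card +
      5 * β * n with hB
    have hTB : ∀ u v, T u v ≤ B u v := by
      intro u v
      by_cases huv : u = v
      · subst huv
        have : T u u ≤ n := by
          calc T u u ≤ ∑ _w : V, (1 : ℝ) := Finset.sum_le_sum fun w _ => by
                nlinarith [hA0 w u, hA1 w u]
            _ = n := by simp [hn]
        simp only [hB, if_true, ne_eq, not_true, and_false, filter_false, card_empty,
          Nat.cast_zero]
        nlinarith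
      · have h1 := hmono_bd u v huv
        have h2 := (abs_le.1 (hdegu u)).1
        have h3 := (abs_le.1 (hdegu v)).1
        have h4 : T u v = ∑ w, A w u * A w v - q * ∑ w, A u w - q * ∑ w, A v w + q ^ 2 * n := by
          simp only [hT, Finset.mul_sum, hAsymm u, hAsymm v]
          rw [← Finset.sum_sub_distrib, ← Finset.sum_sub_distrib]
          have : q ^ 2 * (n : ℝ) = ∑ _w : V, q ^ 2 := by simp [hn, mul_comm]
          rw [this, ← Finset.sum_add_distrib]
          exact Finset.sum_congr rfl fun w _ => by ring
        rw [h4]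
        simp only [hB, huv, if_false, ne_eq, not_false_iff, and_true]
        have h5 := mul_le_mul_of_nonneg_left h2 hq0
        have h6 := mul_le_mul_of_nonneg_left h3 hq0
        have h7 : q * (β * n) ≤ 1 * (β * n) := mul_le_mul_of_nonneg_right hq1 (by positivity)
        have h8 : q ^ 2 ≤ 1 := pow_le_one₀ hq0 hq1
        nlinarith
    have hB0 : ∀ u v, 0 ≤ B u v := fun u v => by
      simp only [hB]
      split_ifs <;> positivity
    have hBsum : ∑ u, ∑ v, B u v ≤ 7 * β * n ^ 3 := by
      simp only [hB, Finset.sum_add_distrib]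
      have s1 : ∑ u : V, ∑ v : V, (if u = v then (n : ℝ) else 0) = n ^ 2 := by
        simp [hn, pow_two]
      have s2 : ∑ _u : V, ∑ _v : V, 5 * β * n = 5 * β * n ^ 3 := by
        simp only [Finset.sum_const, Finset.card_univ, nsmul_eq_mul, ← hn]
        ring
      have s3 : ∑ u, ∑ v, ((((univ.erase u).erase v).filter
          fun w => φ s(u, w) = φ s(v, w) ∧ u ≠ v).card : ℝ) ≤ n * (n * Cl) := by
        calc _ ≤ ∑ _u : V, (n : ℝ) * Cl := Finset.sum_le_sum fun u _ => ?_
          _ = _ := by simp [hn]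
        have e1 : ∀ v, ((((univ.erase u).erase v).filter
            fun w => φ s(u, w) = φ s(v, w) ∧ u ≠ v).card : ℝ) ≤
            ∑ w : V, if v ≠ w ∧ φ s(w, v) = φ s(u, w) then 1 else 0 := by
          intro v
          rw [← Nat.cast_one (R := ℝ), ← Nat.cast_zero (R := ℝ)]
          simp only [← Nat.cast_ite]
          rw [← Nat.cast_sum, ← Finset.card_filter]
          refine Nat.cast_le.2 (Finset.card_le_card fun w hw => ?_)
          simp only [mem_filter, mem_erase, mem_univ, true_and, and_true] at hw ⊢
          refine ⟨hw.1.1.symm, ?_⟩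
          rw [Sym2.eq_swap, hw.2.1]
        refine (Finset.sum_le_sum fun v _ => e1 v).trans ?_
        rw [Finset.sum_comm]
        calc _ ≤ ∑ _w : V, Cl := Finset.sum_le_sum fun w _ => ?_
          _ = _ := by simp [hn]
        refine le_trans (le_of_eq ?_) (hd (φ s(u, w)) w)
        simp [dc]
      rw [s1, s2]
      have hnn : (0 : ℝ) ≤ (n : ℝ) ^ 2 := by positivity
      have e3 := mul_le_mul_of_nonneg_left hβn hnn
      have e4 := mul_le_mul_of_nonneg_left hCβ hnn
      nlinarith
    have hsq : ∑ w, (∑ u ∈ S, (A w u - q)) ^ 2 ≤ 7 * β * n ^ 3 := by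
      calc ∑ w, (∑ u ∈ S, (A w u - q)) ^ 2 = ∑ u ∈ S, ∑ v ∈ S, T u v := by
            simp only [hT, pow_two, Finset.sum_mul_sum]
            rw [Finset.sum_comm]
            exact Finset.sum_congr rfl fun u _ => Finset.sum_comm
        _ ≤ ∑ u ∈ S, ∑ v ∈ S, B u v :=
            Finset.sum_le_sum fun u _ => Finset.sum_le_sum fun v _ => hTB u v
        _ ≤ ∑ u, ∑ v, B u v := by
            refine (Finset.sum_le_sum fun u _ => Finset.sum_le_sum_of_subset_of_nonneg
              (subset_univ S) fun v _ _ => hB0 u v).trans ?_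
            exact Finset.sum_le_sum_of_subset_of_nonneg (subset_univ S)
              fun u _ _ => Finset.sum_nonneg fun v _ => hB0 u v
        _ ≤ _ := hBsum
    set Z := univ.filter fun w => (rdeg φ Q w S : ℝ) < q * S.card - γ * n with hZ
    have hZsum : Z.card * (γ * n) ^ 2 ≤ ∑ w, (∑ u ∈ S, (A w u - q)) ^ 2 := by
      calc Z.card * (γ * n) ^ 2 = ∑ w ∈ Z, (γ * n) ^ 2 := by rw [Finset.sum_const, nsmul_eq_mul]
        _ ≤ ∑ w ∈ Z, (∑ u ∈ S, (A w u - q)) ^ 2 := Finset.sum_le_sum fun w hw => by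
            have h1 := (mem_filter.1 hw).2
            rw [hrdeg] at h1
            rw [Finset.sum_sub_distrib, Finset.sum_const, nsmul_eq_mul]
            have : 0 < γ * n := by positivity
            nlinarith
        _ ≤ _ := Finset.sum_le_sum_of_subset_of_nonneg (subset_univ Z) fun w _ _ => sq_nonneg _
    by_contra! h
    have h1 : γ * n * (γ * n) ^ 2 < Z.card * (γ * n) ^ 2 :=
      mul_lt_mul_of_pos_right h (by positivity)
    have h2 : γ * n * (γ * n) ^ 2 = 16 * β * n ^ 3 := by rw [hβ]; ring
    have h3 : 0 < β * n ^ 3 := by positivity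
    linarith

end Reserve

section Labels

/-- The uniform weight on `Fin k`. -/
noncomputable def unif (k : ℕ) (hk : 0 < k) : Wt (Fin k) where
  w _ := 1 / k
  nonneg _ := by positivity
  sum_one := by
    have : (k : ℝ) ≠ 0 := by positivity
    simp [this]

variable {σ ρ : Type} [Fintype σ] [DecidableEq σ] {k : ℕ} {hk : 0 < k}

theorem Ex_card_eq (P : Finset ρ) (x : ρ → σ) (a : Fin k) :
    Ex (unif k hk) (fun ω : σ → Fin k => ((P.filter fun p => ω (x p) = a).card : ℝ)) =
      P.card / k := by
  simp only [Finset.card_filter, Nat.cast_sum, Nat.cast_ite, Nat.cast_one, Nat.cast_zero]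
  rw [Ex_sum]
  have : ∀ p ∈ P, Ex (unif k hk) (fun ω : σ → Fin k => if ω (x p) = a then (1 : ℝ) else 0) =
      1 / k := by
    intro p _
    refine (Ex_one_coord _ (x p) (fun b : Fin k => if b = a then (1 : ℝ) else 0)).trans ?_
    simp [unif]
  rw [Finset.sum_congr rfl this, Finset.sum_const, nsmul_eq_mul, mul_one_div]

theorem Ex_card_succ_le (P : Finset ρ) (x y : ρ → σ) (hxy : ∀ p ∈ P, x p ≠ y p) :
    Ex (unif k hk) (fun ω : σ → Fin k =>
      ((P.filter fun p => (ω (y p) : ℕ) = ω (x p) + 1).card : ℝ)) ≤ P.card / k := by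
  have hk' : (0 : ℝ) < k := by exact_mod_cast hk
  simp only [Finset.card_filter, Nat.cast_sum, Nat.cast_ite, Nat.cast_one, Nat.cast_zero]
  rw [Ex_sum]
  have : ∀ p ∈ P, Ex (unif k hk)
      (fun ω : σ → Fin k => if (ω (y p) : ℕ) = ω (x p) + 1 then (1 : ℝ) else 0) ≤ 1 / k := by
    intro p hp
    refine (Ex_two_coord _ (hxy p hp)
      (fun a b : Fin k => if (b : ℕ) = a + 1 then (1 : ℝ) else 0)).trans_le ?_
    calc _ ≤ ∑ a : Fin k, (unif k hk).w a * (1 / k) := by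
          refine Finset.sum_le_sum fun a _ =>
            mul_le_mul_of_nonneg_left ?_ ((unif k hk).nonneg a)
          simp only [unif]
          rw [← Finset.mul_sum]
          refine mul_le_of_le_one_right (by positivity) ?_
          rw [Finset.sum_boole, ← Nat.cast_one (R := ℝ)]
          refine Nat.cast_le.2 (Finset.card_le_one.2 fun b hb c hc => ?_)
          rw [mem_filter] at hb hc
          exact Fin.ext (hb.2.trans hc.2.symm)
      _ = 1 / k := by rw [← Finset.sum_mul, (unif k hk).sum_one, one_mul]
  refine (Finset.sum_le_sum this).trans ?_
  rw [Finset.sum_const, nsmul_eq_mul, mul_one_div]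

theorem conc_card_eq (P : Finset ρ) (x : ρ → σ) (a : Fin k) {N L : ℝ}
    (hL : ∀ s, ((P.filter fun p => x p = s).card : ℝ) ≤ L) (hN : (P.card : ℝ) ≤ N) :
    Conc (fun ω : σ → Fin k => ((P.filter fun p => ω (x p) = a).card : ℝ)) N (2 * L) := by
  have := conc_sum_pairs (Ω := Fin k) P x x (fun _ b _ => if b = a then 1 else 0) (N := N)
    (L := 2 * L) (fun _ b _ => by split_ifs <;> norm_num) (fun _ b _ => by split_ifs <;> norm_num)
    (fun s => by linarith [hL s]) hN
  simpa only [Finset.card_filter, Nat.cast_sum, Nat.cast_ite, Nat.cast_one, Nat.cast_zero] using this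

theorem conc_card_succ (P : Finset ρ) (x y : ρ → σ) {N L : ℝ}
    (hL : ∀ s, ((P.filter fun p => x p = s).card : ℝ) ≤ L)
    (hL' : ∀ s, ((P.filter fun p => y p = s).card : ℝ) ≤ L) (hN : (P.card : ℝ) ≤ N) :
    Conc (fun ω : σ → Fin k =>
      ((P.filter fun p => (ω (y p) : ℕ) = ω (x p) + 1).card : ℝ)) N (2 * L) := by
  have := conc_sum_pairs (Ω := Fin k) P x y (fun _ a b => if (b : ℕ) = a + 1 then 1 else 0)
    (N := N) (L := 2 * L) (fun _ b _ => by split_ifs <;> norm_num)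
    (fun _ b _ => by split_ifs <;> norm_num) (fun s => by linarith [hL s, hL' s]) hN
  simpa only [Finset.card_filter, Nat.cast_sum, Nat.cast_ite, Nat.cast_one, Nat.cast_zero] using this

variable {V C : Type} [Fintype V] [DecidableEq V] [Fintype C] [DecidableEq C]

/-- Ordered pairs joined by an edge of colour `c`. -/
def colPairs (φ : Sym2 V → C) (c : C) : Finset (V × V) :=
  univ.filter fun p => p.1 ≠ p.2 ∧ φ s(p.1, p.2) = c

theorem card_colPairs_fst (φ : Sym2 V → C) (c : C) (v : V) :
    ((colPairs φ c).filter fun p => p.1 = v).card = dc φ c v := by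
  refine Finset.card_bij' (fun p _ => p.2) (fun u _ => (v, u)) ?_ ?_ ?_ ?_
  · rintro ⟨a, b⟩ h
    simp only [colPairs, mem_filter, mem_univ, true_and] at h ⊢
    obtain ⟨⟨h1, h2⟩, rfl⟩ := h
    exact ⟨h1.symm, h2⟩
  · intro u h
    simp only [colPairs, mem_filter, mem_univ, true_and] at h ⊢
    exact ⟨⟨h.1.symm, h.2⟩, trivial⟩
  · rintro ⟨a, b⟩ h
    simp only [mem_filter] at h
    simp [h.2]
  · intro u h
    rfl

theorem card_colPairs_snd (φ : Sym2 V → C) (c : C) (v : V) :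
    ((colPairs φ c).filter fun p => p.2 = v).card = dc φ c v := by
  rw [← card_colPairs_fst]
  refine Finset.card_bij' (fun p _ => p.swap) (fun p _ => p.swap) ?_ ?_ ?_ ?_
  · rintro ⟨a, b⟩ h
    simp only [colPairs, mem_filter, mem_univ, true_and, Prod.swap] at h ⊢
    exact ⟨⟨h.1.1.symm, by rw [Sym2.eq_swap]; exact h.1.2⟩, h.2⟩
  · rintro ⟨a, b⟩ h
    simp only [colPairs, mem_filter, mem_univ, true_and, Prod.swap] at h ⊢
    exact ⟨⟨h.1.1.symm, by rw [Sym2.eq_swap]; exact h.1.2⟩, h.2⟩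
  · rintro ⟨a, b⟩ h
    rfl
  · rintro ⟨a, b⟩ h
    rfl

theorem card_colPairs (φ : Sym2 V → C) (c : C) : (colPairs φ c).card = ∑ v, dc φ c v := by
  rw [Finset.card_eq_sum_card_fiberwise (s := colPairs φ c) (t := univ) (f := Prod.fst)
    (fun _ _ => mem_univ _)]
  exact Finset.sum_congr rfl fun v _ => card_colPairs_fst φ c v

/-- Vertices joined to `u` by an edge whose colour is not in `Q`. -/
def nbrs (φ : Sym2 V → C) (Q : Finset C) (u : V) : Finset V :=
  univ.filter fun v => v ≠ u ∧ φ s(u, v) ∉ Q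

set_option maxHeartbeats 2000000 in
theorem exists_labels (φ : Sym2 V → C) (Q : Finset C) {t k : ℕ} (hk : 0 < k) {β Cl : ℝ}
    (hβ : 0 < β) (hβ1 : β ≤ 1) (hCl : 1 ≤ Cl) (hd : ∀ c v, (dc φ c v : ℝ) ≤ Cl)
    (hn0 : 0 < Fintype.card V)
    (he : ∀ c, (∑ v, dc φ c v) ≤ Fintype.card V) (ht : t ≤ Fintype.card V)
    (hkn : k ≤ Fintype.card V) (hC : Fintype.card C ≤ Fintype.card V ^ 2)
    (hexp : 12 * (Fintype.card V : ℝ) ^ 4 * Real.exp (-(β ^ 2 * Fintype.card V / (16 * Cl))) < 1) :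
    ∃ l : Fin t → V → Fin k,
      (∀ u i a, |(((nbrs φ Q u).filter fun v => l i v = a).card : ℝ) - (nbrs φ Q u).card / k| ≤
        β * Fintype.card V) ∧
      (∀ u v, u ≠ v → ((univ.filter fun i => (l i v : ℕ) = l i u + 1).card : ℝ) ≤
        t / k + β * Fintype.card V) ∧
      (∀ c i, (((colPairs φ c).filter fun p => (l i p.2 : ℕ) = l i p.1 + 1).card : ℝ) ≤
        (∑ v, (dc φ c v : ℝ)) / k + β * Fintype.card V) ∧
      (∀ v a, ((univ.filter fun i => l i v = a).card : ℝ) ≤ t / k + β * Fintype.card V) ∧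
      (∀ c i a, ∑ v ∈ univ.filter (fun v => l i v = a), (dc φ c v : ℝ) ≤
        (∑ v, (dc φ c v : ℝ)) / k + β * Fintype.card V) ∧
      (∀ i a, ((univ.filter fun v => l i v = a).card : ℝ) ≤
        Fintype.card V / k + β * Fintype.card V) := by
  set n := Fintype.card V with hn
  have hn1 : (1 : ℝ) ≤ n := by exact_mod_cast hn0
  let F : (V × Fin t × Fin k) ⊕ (V × V) ⊕ (C × Fin t) ⊕ (V × Fin k) ⊕ (C × Fin t × Fin k) ⊕
      (Fin t × Fin k) → (Fin t × V → Fin k) → ℝ :=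
    Sum.elim (fun j ω => (((nbrs φ Q j.1).filter fun v => ω (j.2.1, v) = j.2.2).card : ℝ)) <|
    Sum.elim (fun j ω => (((univ.filter fun _ : Fin t => j.1 ≠ j.2).filter
      fun i => (ω (i, j.2) : ℕ) = ω (i, j.1) + 1).card : ℝ)) <|
    Sum.elim (fun j ω => (((colPairs φ j.1).filter
      fun p => (ω (j.2, p.2) : ℕ) = ω (j.2, p.1) + 1).card : ℝ)) <|
    Sum.elim (fun j ω => ((univ.filter fun i => ω (i, j.1) = j.2).card : ℝ)) <|
    Sum.elim (fun j ω => (((colPairs φ j.1).filter fun p => ω (j.2.1, p.1) = j.2.2).card : ℝ)) <|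
    fun j ω => ((univ.filter fun v => ω (j.1, v) = j.2).card : ℝ)
  have hinj : ∀ {τ : Type} [DecidableEq τ] (P : Finset τ) (x : τ → Fin t × V),
      Function.Injective x → ∀ s, ((P.filter fun p => x p = s).card : ℝ) ≤ Cl := by
    intro τ _ P x hx s
    refine le_trans ?_ hCl
    rw [← Nat.cast_one (R := ℝ)]
    refine Nat.cast_le.2 (Finset.card_le_one.2 fun b hb c hc => ?_)
    rw [mem_filter] at hb hc
    exact hx (hb.2.trans hc.2.symm)
  have hi1 : ∀ i : Fin t, Function.Injective fun v : V => (i, v) := fun i a b h => by simpa using h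
  have hi2 : ∀ v : V, Function.Injective fun i : Fin t => (i, v) := fun i a b h => by simpa using h
  have hfst : ∀ c (i : Fin t) (s : Fin t × V),
      (((colPairs φ c).filter fun p => (i, p.1) = s).card : ℝ) ≤ Cl := by
    intro c i s
    refine le_trans (Nat.cast_le.2 (Finset.card_le_card fun p hp => ?_))
      ((Nat.cast_le.2 (card_colPairs_fst φ c s.2).le).trans (hd c s.2))
    rw [mem_filter] at hp ⊢
    exact ⟨hp.1, by rw [← hp.2]⟩
  have hsnd : ∀ c (i : Fin t) (s : Fin t × V),
      (((colPairs φ c).filter fun p => (i, p.2) = s).card : ℝ) ≤ Cl := by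
    intro c i s
    refine le_trans (Nat.cast_le.2 (Finset.card_le_card fun p hp => ?_))
      ((Nat.cast_le.2 (card_colPairs_snd φ c s.2).le).trans (hd c s.2))
    rw [mem_filter] at hp ⊢
    exact ⟨hp.1, by rw [← hp.2]⟩
  have hcard : ∀ c, ((colPairs φ c).card : ℝ) ≤ n := fun c => by
    rw [card_colPairs]; exact_mod_cast he c
  have ht' : ∀ P : Finset (Fin t), (P.card : ℝ) ≤ n := fun P => by
    have := Finset.card_le_univ P
    rw [Fintype.card_fin] at this
    exact_mod_cast this.trans ht
  have hconc : ∀ j, Conc (F j) n (2 * Cl) := by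
    rintro (⟨u, i, a⟩ | ⟨u, v⟩ | ⟨c, i⟩ | ⟨v, a⟩ | ⟨c, i, a⟩ | ⟨i, a⟩)
    · exact conc_card_eq (nbrs φ Q u) (fun v => (i, v)) a (hinj _ _ (hi1 i))
        (Nat.cast_le.2 (Finset.card_le_univ _))
    · exact conc_card_succ (univ.filter fun _ : Fin t => u ≠ v) (fun i => (i, u))
        (fun i => (i, v)) (hinj _ _ (hi2 u)) (hinj _ _ (hi2 v)) (ht' _)
    · exact conc_card_succ (colPairs φ c) (fun p => (i, p.1)) (fun p => (i, p.2)) (hfst c i)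
        (hsnd c i) (hcard c)
    · exact conc_card_eq univ (fun i => (i, v)) a (hinj _ _ (hi2 v)) (ht' _)
    · exact conc_card_eq (colPairs φ c) (fun p => (i, p.1)) a (hfst c i) (hcard c)
    · exact conc_card_eq univ (fun v => (i, v)) a (hinj _ _ (hi1 i))
        (Nat.cast_le.2 (Finset.card_le_univ _))
  obtain ⟨ω, hω⟩ := exists_forall_abs_sub_Ex_le (unif k hk) F (N := n) (L := 2 * Cl) (β := β)
    (by linarith) (by linarith) hβ.le hβ1 hconc (by
      have h16 : β ^ 2 * n / (8 * (2 * Cl)) = β ^ 2 * n / (16 * Cl) := by ring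
      rw [h16]
      refine lt_of_le_of_lt (mul_le_mul_of_nonneg_right ?_ (Real.exp_pos _).le) hexp
      simp only [Fintype.card_sum, Fintype.card_prod, Fintype.card_fin, ← hn]
      have h1 : n * (t * k) ≤ n ^ 4 := by
        calc n * (t * k) ≤ n * (n * n) := by gcongr
          _ = n ^ 3 := by ring
          _ ≤ n ^ 4 := Nat.pow_le_pow_right hn0 (by norm_num)
      have h2 : n * n ≤ n ^ 4 := by
        calc n * n = n ^ 2 := by ring
          _ ≤ n ^ 4 := Nat.pow_le_pow_right hn0 (by norm_num)
      have h3 : Fintype.card C * t ≤ n ^ 4 := by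
        calc Fintype.card C * t ≤ n ^ 2 * n := by gcongr
          _ = n ^ 3 := by ring
          _ ≤ n ^ 4 := Nat.pow_le_pow_right hn0 (by norm_num)
      have h4 : n * k ≤ n ^ 4 := le_trans (by gcongr) h2
      have h5 : Fintype.card C * (t * k) ≤ n ^ 4 := by
        calc Fintype.card C * (t * k) ≤ n ^ 2 * (n * n) := by gcongr
          _ = n ^ 4 := by ring
      have h6 : t * k ≤ n ^ 4 := le_trans (by gcongr) h2
      have : n * (t * k) + (n * n + (Fintype.card C * t + (n * k +
          (Fintype.card C * (t * k) + t * k)))) ≤ 6 * n ^ 4 := by linarith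
      have h7 : ((n * (t * k) + (n * n + (Fintype.card C * t + (n * k +
          (Fintype.card C * (t * k) + t * k)))) : ℕ) : ℝ) ≤ 6 * (n : ℝ) ^ 4 := by
        exact_mod_cast this
      linarith)
  have hup : ∀ j {x : ℝ}, Ex (unif k hk) (F j) ≤ x → F j ω ≤ x + β * n := fun j x hx => by
    linarith [(abs_le.1 (hω j)).2]
  have hk' : (0 : ℝ) < k := by exact_mod_cast hk
  have hsumc : ∀ c, ((colPairs φ c).card : ℝ) = ∑ v, (dc φ c v : ℝ) := fun c => by
    rw [card_colPairs]; push_cast; rfl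
  refine ⟨fun i v => ω (i, v), ?_, ?_, ?_, ?_, ?_, ?_⟩
  · intro u i a
    have := hω (Sum.inl (u, i, a))
    have h2 := Ex_card_eq (hk := hk) (nbrs φ Q u) (fun v => (i, v)) a
    simp only [F, Sum.elim_inl] at this
    rwa [h2] at this
  · intro u v huv
    have h1 : Ex (unif k hk) (F (Sum.inr (Sum.inl (u, v)))) ≤ t / k := by
      refine (Ex_card_succ_le (hk := hk) (univ.filter fun _ : Fin t => u ≠ v) (fun i => (i, u))
        (fun i => (i, v)) fun i _ h => huv (Prod.mk.inj h).2).trans ?_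
      simp [huv]
    have := hup _ h1
    simpa [F, huv] using this
  · intro c i
    have h1 : Ex (unif k hk) (F (Sum.inr (Sum.inr (Sum.inl (c, i))))) ≤
        (∑ v, (dc φ c v : ℝ)) / k := by
      refine (Ex_card_succ_le (hk := hk) (colPairs φ c) (fun p => (i, p.1)) (fun p => (i, p.2))
        fun p hp h => (mem_filter.1 hp).2.1 (Prod.mk.inj h).2).trans ?_
      rw [hsumc]
    exact hup _ h1
  · intro v a
    have h1 : Ex (unif k hk) (F (Sum.inr (Sum.inr (Sum.inr (Sum.inl (v, a)))))) ≤ t / k := by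
      refine (Ex_card_eq (hk := hk) univ (fun i : Fin t => (i, v)) a).le.trans ?_
      simp
    exact hup _ h1
  · intro c i a
    have h1 : Ex (unif k hk) (F (Sum.inr (Sum.inr (Sum.inr (Sum.inr (Sum.inl (c, i, a))))))) ≤
        (∑ v, (dc φ c v : ℝ)) / k := by
      refine (Ex_card_eq (hk := hk) (colPairs φ c) (fun p => (i, p.1)) a).le.trans ?_
      rw [hsumc]
    refine le_trans (le_of_eq ?_) (hup _ h1)
    simp only [F, Sum.elim_inr, Sum.elim_inl]
    rw [Finset.card_eq_sum_card_fiberwise (s := (colPairs φ c).filter fun p => ω (i, p.1) = a)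
      (t := univ.filter fun v => ω (i, v) = a) (f := Prod.fst)]
    · push_cast
      refine Finset.sum_congr rfl fun v hv => ?_
      rw [← card_colPairs_fst, Finset.filter_filter]
      congr 2
      ext p
      have := (mem_filter.1 hv).2
      simp only [mem_filter]
      constructor
      · rintro ⟨h1, h2⟩
        exact ⟨h1, by rw [h2]; exact this, h2⟩
      · rintro ⟨h1, _, h2⟩
        exact ⟨h1, h2⟩
    · intro p hp
      simpa using (mem_filter.1 hp).2
  · intro i a
    have h1 : Ex (unif k hk) (F (Sum.inr (Sum.inr (Sum.inr (Sum.inr (Sum.inr (i, a))))))) ≤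
        n / k := by
      refine (Ex_card_eq (hk := hk) univ (fun v => (i, v)) a).le.trans ?_
      simp [hn]
    exact hup _ h1

end Labels

section PathSystems

variable {V C : Type} [Fintype V] [DecidableEq V] [Fintype C] [DecidableEq C]

/-- Vertices without an outgoing (`b = true`) or incoming (`b = false`) arc in `P`. -/
def freeSet (P : Finset (V × V)) (b : Bool) : Finset V :=
  univ.filter fun v => ∀ w, (if b then (v, w) else (w, v)) ∉ P

/-- Arcs that are compatible with the labels and avoid the colours in `Q`. -/
abbrev Arc (φ : Sym2 V → C) (Q : Finset C) {t k : ℕ} (l : Fin t → V → Fin k) : Type :=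
  {p : V × V × Fin t // p.1 ≠ p.2.1 ∧ φ s(p.1, p.2.1) ∉ Q ∧ (l p.2.2 p.2.1 : ℕ) = l p.2.2 p.1 + 1}

/-- Ground set of the auxiliary hypergraph: edges, vertex ends, and colours, the latter two once
for each index. -/
abbrev Ground (V C : Type) (t : ℕ) : Type := Sym2 V ⊕ (Bool × V × Fin t) ⊕ (C × Fin t)

/-- The hyperedge corresponding to an arc. -/
def hyper (φ : Sym2 V → C) (Q : Finset C) {t k : ℕ} (l : Fin t → V → Fin k) (f : Arc φ Q l) :
    Finset (Ground V C t) :=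
  {Sum.inl s(f.1.1, f.1.2.1), Sum.inr (Sum.inl (true, f.1.1, f.1.2.2)),
    Sum.inr (Sum.inl (false, f.1.2.1, f.1.2.2)), Sum.inr (Sum.inr (φ s(f.1.1, f.1.2.1), f.1.2.2))}

instance (φ : Sym2 V → C) (Q : Finset C) {t k : ℕ} (l : Fin t → V → Fin k) (x y : Ground V C t) :
    DecidablePred fun f : Arc φ Q l => x ∈ hyper φ Q l f ∧ y ∈ hyper φ Q l f :=
  fun _ => @instDecidableAnd _ _ (Finset.decidableMem x _) (Finset.decidableMem y _)

variable {φ : Sym2 V → C} {Q : Finset C} {t k : ℕ} {l : Fin t → V → Fin k}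

theorem card_hyper (f : Arc φ Q l) : (hyper φ Q l f).card = 4 := by
  simp [hyper]

theorem inl_mem_hyper {f : Arc φ Q l} {e : Sym2 V} :
    Sum.inl e ∈ hyper φ Q l f ↔ e = s(f.1.1, f.1.2.1) := by
  simp [hyper]

theorem out_mem_hyper {f : Arc φ Q l} {v : V} {i : Fin t} :
    Sum.inr (Sum.inl (true, v, i)) ∈ hyper φ Q l f ↔ v = f.1.1 ∧ i = f.1.2.2 := by
  simp [hyper]

theorem in_mem_hyper {f : Arc φ Q l} {v : V} {i : Fin t} :
    Sum.inr (Sum.inl (false, v, i)) ∈ hyper φ Q l f ↔ v = f.1.2.1 ∧ i = f.1.2.2 := by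
  simp [hyper, Prod.ext_iff]

theorem col_mem_hyper {f : Arc φ Q l} {c : C} {i : Fin t} :
    Sum.inr (Sum.inr (c, i)) ∈ hyper φ Q l f ↔ c = φ s(f.1.1, f.1.2.1) ∧ i = f.1.2.2 := by
  simp [hyper]

theorem card_arc_le {A : Finset (Arc φ Q l)} {B : Finset (V × V × Fin t)}
    (h : ∀ f ∈ A, f.1 ∈ B) : A.card ≤ B.card :=
  Finset.card_le_card_of_injOn (fun f => f.1) h (fun _ _ _ _ h => Subtype.ext h)

theorem codeg_hyper_le (φ : Sym2 V → C) (Q : Finset C) {t k : ℕ} (l : Fin t → V → Fin k) {Cl : ℝ} (hCl : 2 ≤ Cl) (hd : ∀ c v, (dc φ c v : ℝ) ≤ Cl)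
    (x y : Ground V C t) (hxy : x ≠ y) :
    ((univ.filter fun f : Arc φ Q l => x ∈ hyper φ Q l f ∧ y ∈ hyper φ Q l f).card : ℝ) ≤ Cl := by
  have hsymm : ∀ x y : Ground V C t,
      (univ.filter fun f : Arc φ Q l => x ∈ hyper φ Q l f ∧ y ∈ hyper φ Q l f) =
      univ.filter fun f : Arc φ Q l => y ∈ hyper φ Q l f ∧ x ∈ hyper φ Q l f := by
    intro x y
    simp only [and_comm]
  have hempty : ∀ x y : Ground V C t,
      (∀ f : Arc φ Q l, x ∈ hyper φ Q l f → y ∈ hyper φ Q l f → False) →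
      ((univ.filter fun f : Arc φ Q l => x ∈ hyper φ Q l f ∧ y ∈ hyper φ Q l f).card : ℝ) ≤ Cl := by
    intro x y h
    rw [Finset.filter_false_of_mem (fun f _ hf => h f hf.1 hf.2)]
    simp
    linarith
  have hpair : ∀ (a b : V) (i : Fin t) (y : Ground V C t),
      (∀ f : Arc φ Q l, y ∈ hyper φ Q l f → f.1.2.2 = i) →
      ((univ.filter fun f : Arc φ Q l =>
        Sum.inl s(a, b) ∈ hyper φ Q l f ∧ y ∈ hyper φ Q l f).card : ℝ) ≤ Cl := by
    intro a b i y hy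
    refine le_trans ?_ hCl
    have h := card_arc_le (A := univ.filter fun f : Arc φ Q l =>
        Sum.inl s(a, b) ∈ hyper φ Q l f ∧ y ∈ hyper φ Q l f)
      (B := {(a, b, i), (b, a, i)}) (by
        intro f hf
        obtain ⟨h1, h2⟩ := (mem_filter.1 hf).2
        rw [inl_mem_hyper, Sym2.eq_iff] at h1
        have h3 := hy f h2
        obtain ⟨⟨u, v, j⟩, hf'⟩ := f
        simp only at h1 h3
        rcases h1 with ⟨rfl, rfl⟩ | ⟨rfl, rfl⟩ <;> simp [h3])
    exact_mod_cast h.trans Finset.card_le_two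
  have hout : ∀ (v : V) (i : Fin t) (c : C) (j : Fin t), ((univ.filter fun f : Arc φ Q l =>
        Sum.inr (Sum.inl (true, v, i)) ∈ hyper φ Q l f ∧
        Sum.inr (Sum.inr (c, j)) ∈ hyper φ Q l f).card : ℝ) ≤ Cl := by
    intro v i c j
    refine le_trans ?_ (hd c v)
    have h := card_arc_le (A := univ.filter fun f : Arc φ Q l =>
        Sum.inr (Sum.inl (true, v, i)) ∈ hyper φ Q l f ∧ Sum.inr (Sum.inr (c, j)) ∈ hyper φ Q l f)
      (B := (univ.filter fun u => u ≠ v ∧ φ s(v, u) = c).image fun u => (v, u, i)) (by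
        intro f hf
        obtain ⟨h1, h2⟩ := (mem_filter.1 hf).2
        rw [out_mem_hyper] at h1
        rw [col_mem_hyper] at h2
        obtain ⟨⟨u, w, j⟩, hf'⟩ := f
        simp only at h1 h2 hf'
        obtain ⟨rfl, rfl⟩ := h1
        simp only [mem_image, mem_filter, mem_univ, true_and]
        exact ⟨w, ⟨hf'.1.symm, h2.1.symm⟩, rfl⟩)
    exact_mod_cast h.trans Finset.card_image_le
  have hin : ∀ (v : V) (i : Fin t) (c : C) (j : Fin t), ((univ.filter fun f : Arc φ Q l =>
        Sum.inr (Sum.inl (false, v, i)) ∈ hyper φ Q l f ∧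
        Sum.inr (Sum.inr (c, j)) ∈ hyper φ Q l f).card : ℝ) ≤ Cl := by
    intro v i c j
    refine le_trans ?_ (hd c v)
    have h := card_arc_le (A := univ.filter fun f : Arc φ Q l =>
        Sum.inr (Sum.inl (false, v, i)) ∈ hyper φ Q l f ∧ Sum.inr (Sum.inr (c, j)) ∈ hyper φ Q l f)
      (B := (univ.filter fun u => u ≠ v ∧ φ s(v, u) = c).image fun u => (u, v, i)) (by
        intro f hf
        obtain ⟨h1, h2⟩ := (mem_filter.1 hf).2
        rw [in_mem_hyper] at h1
        rw [col_mem_hyper] at h2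
        obtain ⟨⟨u, w, j⟩, hf'⟩ := f
        simp only at h1 h2 hf'
        obtain ⟨rfl, rfl⟩ := h1
        simp only [mem_image, mem_filter, mem_univ, true_and]
        exact ⟨u, ⟨hf'.1, by rw [Sym2.eq_swap]; exact h2.1.symm⟩, rfl⟩)
    exact_mod_cast h.trans Finset.card_image_le
  have hends : ∀ (v : V) (i : Fin t) (w : V) (j : Fin t), ((univ.filter fun f : Arc φ Q l =>
        Sum.inr (Sum.inl (true, v, i)) ∈ hyper φ Q l f ∧
        Sum.inr (Sum.inl (false, w, j)) ∈ hyper φ Q l f).card : ℝ) ≤ Cl := by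
    intro v i w j
    have h := card_arc_le (A := univ.filter fun f : Arc φ Q l =>
        Sum.inr (Sum.inl (true, v, i)) ∈ hyper φ Q l f ∧
        Sum.inr (Sum.inl (false, w, j)) ∈ hyper φ Q l f)
      (B := {(v, w, i)}) (by
        intro f hf
        obtain ⟨h1, h2⟩ := (mem_filter.1 hf).2
        rw [out_mem_hyper] at h1
        rw [in_mem_hyper] at h2
        obtain ⟨⟨u, w', j⟩, hf'⟩ := f
        simp only at h1 h2
        simp [h1, h2])
    rw [card_singleton] at h
    have : ((univ.filter fun f : Arc φ Q l =>
        Sum.inr (Sum.inl (true, v, i)) ∈ hyper φ Q l f ∧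
        Sum.inr (Sum.inl (false, w, j)) ∈ hyper φ Q l f).card : ℝ) ≤ 1 := by exact_mod_cast h
    linarith
  have hidx : ∀ (y : Ground V C t) , (∀ e, y ≠ Sum.inl e) →
      ∃ i, ∀ f : Arc φ Q l, y ∈ hyper φ Q l f → f.1.2.2 = i := by
    rintro (e | ⟨b, v, i⟩ | ⟨c, i⟩) hy
    · exact absurd rfl (hy e)
    · refine ⟨i, fun f hf => ?_⟩
      cases b
      · exact (in_mem_hyper.1 hf).2.symm
      · exact (out_mem_hyper.1 hf).2.symm
    · exact ⟨i, fun f hf => (col_mem_hyper.1 hf).2.symm⟩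
  rcases x with e | x
  · rcases y with e' | y
    · refine hempty _ _ fun f h1 h2 => hxy ?_
      rw [inl_mem_hyper.1 h1, inl_mem_hyper.1 h2]
    · obtain ⟨i, hi⟩ := hidx (Sum.inr y) (by simp)
      induction e with
      | _ a b => exact hpair a b i _ hi
  · rcases y with e' | y
    · rw [hsymm]
      obtain ⟨i, hi⟩ := hidx (Sum.inr x) (by simp)
      induction e' with
      | _ a b => exact hpair a b i _ hi
    · rcases x with ⟨b, v, i⟩ | ⟨c, i⟩ <;> rcases y with ⟨b', v', i'⟩ | ⟨c', i'⟩
      · cases b <;> cases b'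
        · refine hempty _ _ fun f h1 h2 => hxy ?_
          rw [(in_mem_hyper.1 h1).1, (in_mem_hyper.1 h1).2, (in_mem_hyper.1 h2).1,
            (in_mem_hyper.1 h2).2]
        · rw [hsymm]
          exact hends _ _ _ _
        · exact hends _ _ _ _
        · refine hempty _ _ fun f h1 h2 => hxy ?_
          rw [(out_mem_hyper.1 h1).1, (out_mem_hyper.1 h1).2, (out_mem_hyper.1 h2).1,
            (out_mem_hyper.1 h2).2]
      · cases b
        · exact hin _ _ _ _
        · exact hout _ _ _ _
      · rw [hsymm]
        cases b'
        · exact hin _ _ _ _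
        · exact hout _ _ _ _
      · refine hempty _ _ fun f h1 h2 => hxy ?_
        rw [(col_mem_hyper.1 h1).1, (col_mem_hyper.1 h1).2, (col_mem_hyper.1 h2).1,
            (col_mem_hyper.1 h2).2]

/-- Test weights on vertex ends. -/
noncomputable def endWt (φ : Sym2 V → C) (t : ℕ) (j : V ⊕ (C × Fin t) ⊕ Fin t) (v : V)
    (i : Fin t) : ℝ :=
  match j with
  | Sum.inl v₀ => if v = v₀ then 1 / Fintype.card V else 0
  | Sum.inr (Sum.inl (c, i₀)) => if i = i₀ then dc φ c v / Fintype.card V else 0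
  | Sum.inr (Sum.inr i₀) => if i = i₀ then 1 / Fintype.card V else 0

theorem endWt_nonneg (j : V ⊕ (C × Fin t) ⊕ Fin t) (v : V) (i : Fin t) : 0 ≤ endWt φ t j v i := by
  rcases j with j | ⟨c, j⟩ | j <;> simp only [endWt] <;> split_ifs <;> positivity

theorem endWt_le {Cl : ℝ} (hCl : 1 ≤ Cl) (hd : ∀ c v, (dc φ c v : ℝ) ≤ Cl)
    (j : V ⊕ (C × Fin t) ⊕ Fin t) (v : V) (i : Fin t) :
    endWt φ t j v i ≤ Cl / Fintype.card V := by
  have h0 : 0 ≤ Cl / Fintype.card V := by positivity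
  rcases j with j | ⟨c, j⟩ | j <;> simp only [endWt] <;> split_ifs <;> try exact h0
  · gcongr
  · exact div_le_div_of_nonneg_right (hd c v) (by positivity)
  · gcongr

theorem sum_endWt_le (hV : 0 < Fintype.card V) (ht : t ≤ Fintype.card V)
    (he : ∀ c, ∑ v, dc φ c v ≤ Fintype.card V) (j : V ⊕ (C × Fin t) ⊕ Fin t) :
    ∑ v, ∑ i, endWt φ t j v i ≤ 1 := by
  have hV' : (0 : ℝ) < Fintype.card V := by exact_mod_cast hV
  rcases j with j | ⟨c, j⟩ | j
  · rw [Finset.sum_comm]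
    simp only [endWt, Finset.sum_ite_eq', mem_univ, if_true, Finset.sum_const, card_univ,
      Fintype.card_fin, nsmul_eq_mul, mul_one_div]
    rw [div_le_one hV']
    exact_mod_cast ht
  · simp only [endWt, Finset.sum_ite_eq', mem_univ, if_true]
    rw [← Finset.sum_div, div_le_one hV']
    exact_mod_cast he c
  · simp only [endWt, Finset.sum_ite_eq', mem_univ, if_true, Finset.sum_const, card_univ,
      nsmul_eq_mul, mul_one_div]
    rw [div_self hV'.ne']

end PathSystems

theorem dg_univ {X ι : Type*} [Fintype X] [DecidableEq X] [Fintype ι] (H : ι → Finset X) (x : X) :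
    dg H univ x = (univ.filter fun f => x ∈ H f).card := by
  simp [dg]

section PathSystems

variable {V C : Type} [Fintype V] [DecidableEq V] [Fintype C] [DecidableEq C]

instance (φ : Sym2 V → C) (Q : Finset C) {t k : ℕ} (l : Fin t → V → Fin k) (x : Ground V C t) :
    DecidablePred fun f : Arc φ Q l => x ∈ hyper φ Q l f :=
  fun _ => Finset.decidableMem x _

/-- Whether an end at `v` can be used, given its label. -/
def Good {t k : ℕ} (l : Fin t → V → Fin k) (b : Bool) (v : V) (i : Fin t) : Prop :=
  if b then (l i v : ℕ) + 1 < k else 0 < (l i v : ℕ)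

instance {t k : ℕ} (l : Fin t → V → Fin k) (b : Bool) (v : V) (i : Fin t) :
    Decidable (Good l b v i) := by
  unfold Good
  infer_instance

theorem dg_hyper_out (φ : Sym2 V → C) (Q : Finset C) {t k : ℕ} (l : Fin t → V → Fin k) (v : V)
    (i : Fin t) : dg (hyper φ Q l) univ (Sum.inr (Sum.inl (true, v, i))) =
      ((nbrs φ Q v).filter fun w => (l i w : ℕ) = l i v + 1).card := by
  rw [dg_univ]
  refine Finset.card_bij' (fun f _ => f.1.2.1) (fun w hw => ⟨(v, w, i), ?_⟩) ?_ ?_ ?_ ?_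
  · simp only [nbrs, mem_filter, mem_univ, true_and] at hw
    exact ⟨hw.1.1.symm, hw.1.2, hw.2⟩
  · intro f hf
    have h := out_mem_hyper.1 (mem_filter.1 hf).2
    obtain ⟨⟨u, w, j⟩, h1, h2, h3⟩ := f
    obtain ⟨rfl, rfl⟩ := h
    simp only [nbrs, mem_filter, mem_univ, true_and]
    exact ⟨⟨h1.symm, h2⟩, h3⟩
  · intro w hw
    simp [out_mem_hyper]
  · intro f hf
    have h := out_mem_hyper.1 (mem_filter.1 hf).2
    obtain ⟨⟨u, w, j⟩, h1, h2, h3⟩ := f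
    obtain ⟨rfl, rfl⟩ := h
    rfl
  · intro w hw
    rfl

theorem dg_hyper_in (φ : Sym2 V → C) (Q : Finset C) {t k : ℕ} (l : Fin t → V → Fin k) (v : V)
    (i : Fin t) : dg (hyper φ Q l) univ (Sum.inr (Sum.inl (false, v, i))) =
      ((nbrs φ Q v).filter fun w => (l i v : ℕ) = l i w + 1).card := by
  rw [dg_univ]
  refine Finset.card_bij' (fun f _ => f.1.1) (fun w hw => ⟨(w, v, i), ?_⟩) ?_ ?_ ?_ ?_
  · simp only [nbrs, mem_filter, mem_univ, true_and] at hw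
    exact ⟨hw.1.1, by rw [Sym2.eq_swap]; exact hw.1.2, hw.2⟩
  · intro f hf
    have h := in_mem_hyper.1 (mem_filter.1 hf).2
    obtain ⟨⟨u, w, j⟩, h1, h2, h3⟩ := f
    obtain ⟨rfl, rfl⟩ := h
    simp only [nbrs, mem_filter, mem_univ, true_and]
    exact ⟨⟨h1, by rw [Sym2.eq_swap]; exact h2⟩, h3⟩
  · intro w hw
    simp [in_mem_hyper]
  · intro f hf
    have h := in_mem_hyper.1 (mem_filter.1 hf).2
    obtain ⟨⟨u, w, j⟩, h1, h2, h3⟩ := f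
    obtain ⟨rfl, rfl⟩ := h
    rfl
  · intro w hw
    rfl

theorem exists_label_of_good {t k : ℕ} (l : Fin t → V → Fin k) (b : Bool) (v : V) (i : Fin t)
    (h : Good l b v i) : ∃ a : Fin k, ∀ w,
      (if b then (l i w : ℕ) = l i v + 1 else (l i v : ℕ) = l i w + 1) ↔ l i w = a := by
  cases b
  · simp only [Good, Bool.false_eq_true, if_false] at h ⊢
    refine ⟨⟨l i v - 1, by have := (l i v).2; omega⟩, fun w => ?_⟩
    rw [Fin.ext_iff]
    simp only
    omega
  · simp only [Good, if_true] at h ⊢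
    exact ⟨⟨l i v + 1, h⟩, fun w => by rw [Fin.ext_iff]⟩

theorem not_label_of_not_good {t k : ℕ} (l : Fin t → V → Fin k) (b : Bool) (v : V) (i : Fin t)
    (h : ¬ Good l b v i) (w : V) :
      ¬ (if b then (l i w : ℕ) = l i v + 1 else (l i v : ℕ) = l i w + 1) := by
  cases b
  · simp only [Good, Bool.false_eq_true, if_false] at h ⊢
    omega
  · simp only [Good, if_true] at h ⊢
    have := (l i w).2
    omega

theorem dg_hyper_end (φ : Sym2 V → C) (Q : Finset C) {t k : ℕ} (l : Fin t → V → Fin k) (b : Bool)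
    (v : V) (i : Fin t) : dg (hyper φ Q l) univ (Sum.inr (Sum.inl (b, v, i))) =
      ((nbrs φ Q v).filter fun w =>
        if b then (l i w : ℕ) = l i v + 1 else (l i v : ℕ) = l i w + 1).card := by
  cases b
  · simpa using dg_hyper_in φ Q l v i
  · simpa using dg_hyper_out φ Q l v i

theorem dg_hyper_edge (φ : Sym2 V → C) (Q : Finset C) {t k : ℕ} (l : Fin t → V → Fin k) (a b : V) :
    dg (hyper φ Q l) univ (Sum.inl s(a, b)) ≤
      (univ.filter fun i => (l i b : ℕ) = l i a + 1).card +
      (univ.filter fun i => (l i a : ℕ) = l i b + 1).card := by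
  rw [dg_univ]
  refine (card_arc_le (B := ((univ.filter fun i => (l i b : ℕ) = l i a + 1).image
    fun i => (a, b, i)) ∪ ((univ.filter fun i => (l i a : ℕ) = l i b + 1).image
    fun i => (b, a, i))) ?_).trans
    ((card_union_le _ _).trans (Nat.add_le_add card_image_le card_image_le))
  intro f hf
  have h := inl_mem_hyper.1 (mem_filter.1 hf).2
  obtain ⟨⟨u, w, j⟩, h1, h2, h3⟩ := f
  simp only at h h3 ⊢
  rw [Sym2.eq_iff] at h
  simp only [mem_union, mem_image, mem_filter, mem_univ, true_and]
  rcases h with ⟨rfl, rfl⟩ | ⟨rfl, rfl⟩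
  · exact Or.inl ⟨j, h3, rfl⟩
  · exact Or.inr ⟨j, h3, rfl⟩

theorem dg_hyper_diag (φ : Sym2 V → C) (Q : Finset C) {t k : ℕ} (l : Fin t → V → Fin k) (a : V) :
    dg (hyper φ Q l) univ (Sum.inl s(a, a)) = 0 := by
  rw [dg_univ]
  rw [card_eq_zero, filter_eq_empty_iff]
  rintro f - h
  rw [inl_mem_hyper, Sym2.eq_iff] at h
  rcases h with h | h
  · exact f.2.1 (h.1.symm.trans h.2)
  · exact f.2.1 (h.2.symm.trans h.1)

theorem dg_hyper_col (φ : Sym2 V → C) (Q : Finset C) {t k : ℕ} (l : Fin t → V → Fin k) (c : C)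
    (i : Fin t) : dg (hyper φ Q l) univ (Sum.inr (Sum.inr (c, i))) ≤
      ((colPairs φ c).filter fun p => (l i p.2 : ℕ) = l i p.1 + 1).card := by
  rw [dg_univ]
  refine (card_arc_le (B := ((colPairs φ c).filter fun p => (l i p.2 : ℕ) = l i p.1 + 1).image
    fun p => (p.1, p.2, i)) ?_).trans card_image_le
  intro f hf
  have h := col_mem_hyper.1 (mem_filter.1 hf).2
  obtain ⟨⟨u, w, j⟩, h1, h2, h3⟩ := f
  obtain ⟨rfl, rfl⟩ := h
  simp only [mem_image, mem_filter, mem_univ, true_and, colPairs, Prod.exists]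
  exact ⟨u, w, ⟨⟨h1, rfl⟩, h3⟩, rfl⟩

end PathSystems

/-- A system of rainbow linear forests: index `i` gives a set `P i` of arcs avoiding the colours
in `Q`, increasing labels. -/
structure PathSystem {V C : Type} (φ : Sym2 V → C) (Q : Finset C) {t k : ℕ}
    (l : Fin t → V → Fin k) (P : Fin t → Finset (V × V)) : Prop where
  ne : ∀ i, ∀ p ∈ P i, p.1 ≠ p.2
  col : ∀ i, ∀ p ∈ P i, φ s(p.1, p.2) ∉ Q
  label : ∀ i, ∀ p ∈ P i, (l i p.1 : ℕ) < l i p.2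
  out : ∀ i, ∀ p ∈ P i, ∀ p' ∈ P i, p.1 = p'.1 → p = p'
  inn : ∀ i, ∀ p ∈ P i, ∀ p' ∈ P i, p.2 = p'.2 → p = p'
  rainbow : ∀ i, ∀ p ∈ P i, ∀ p' ∈ P i, φ s(p.1, p.2) = φ s(p'.1, p'.2) → p = p'
  disj : ∀ i j, ∀ p ∈ P i, ∀ p' ∈ P j, s(p.1, p.2) = s(p'.1, p'.2) → i = j

section PathSystems

variable {V C : Type} [Fintype V] [DecidableEq V] [Fintype C] [DecidableEq C]
  {φ : Sym2 V → C} {Q : Finset C} {t k : ℕ} {l : Fin t → V → Fin k}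

/-- The arcs of index `i` chosen by a matching `M`. -/
def arcsOf (M : Finset (Arc φ Q l)) (i : Fin t) : Finset (V × V) :=
  univ.filter fun p => ∃ f ∈ M, f.1 = (p.1, p.2, i)

theorem mem_arcsOf {M : Finset (Arc φ Q l)} {i : Fin t} {p : V × V} :
    p ∈ arcsOf M i ↔ ∃ f ∈ M, f.1 = (p.1, p.2, i) := by
  simp [arcsOf]

theorem pathSystem_arcsOf {M : Finset (Arc φ Q l)}
    (hM : ∀ f ∈ M, ∀ g ∈ M, f ≠ g → Disjoint (hyper φ Q l f) (hyper φ Q l g)) :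
    PathSystem φ Q l (arcsOf M) := by
  have key : ∀ f ∈ M, ∀ g ∈ M, ∀ x, x ∈ hyper φ Q l f → x ∈ hyper φ Q l g → f = g := by
    intro f hf g hg x h1 h2
    by_contra h
    exact Finset.disjoint_left.1 (hM f hf g hg h) h1 h2
  have keq : ∀ {i j : Fin t} {p p' : V × V} (x : Ground V C t),
      p ∈ arcsOf M i → p' ∈ arcsOf M j →
      (∀ f : Arc φ Q l, f.1 = (p.1, p.2, i) → x ∈ hyper φ Q l f) →
      (∀ f : Arc φ Q l, f.1 = (p'.1, p'.2, j) → x ∈ hyper φ Q l f) → p = p' ∧ i = j := by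
    intro i j p p' x hp hp' h1 h2
    obtain ⟨f, hf, hf'⟩ := mem_arcsOf.1 hp
    obtain ⟨g, hg, hg'⟩ := mem_arcsOf.1 hp'
    have := key f hf g hg x (h1 f hf') (h2 g hg')
    subst this
    rw [hf'] at hg'
    simp only [Prod.mk.injEq] at hg'
    exact ⟨Prod.ext hg'.1 hg'.2.1, hg'.2.2⟩
  refine ⟨?_, ?_, ?_, ?_, ?_, ?_, ?_⟩
  · intro i p hp
    obtain ⟨f, hf, hf'⟩ := mem_arcsOf.1 hp
    have := f.2.1
    rw [hf'] at this
    exact this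
  · intro i p hp
    obtain ⟨f, hf, hf'⟩ := mem_arcsOf.1 hp
    have := f.2.2.1
    rw [hf'] at this
    exact this
  · intro i p hp
    obtain ⟨f, hf, hf'⟩ := mem_arcsOf.1 hp
    have := f.2.2.2
    rw [hf'] at this
    simp only at this
    omega
  · intro i p hp p' hp' h
    refine (keq (Sum.inr (Sum.inl (true, p.1, i))) hp hp' ?_ ?_).1
    · intro f hf
      rw [out_mem_hyper, hf]
      exact ⟨rfl, rfl⟩
    · intro f hf
      rw [out_mem_hyper, hf]
      exact ⟨h, rfl⟩
  · intro i p hp p' hp' h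
    refine (keq (Sum.inr (Sum.inl (false, p.2, i))) hp hp' ?_ ?_).1
    · intro f hf
      rw [in_mem_hyper, hf]
      exact ⟨rfl, rfl⟩
    · intro f hf
      rw [in_mem_hyper, hf]
      exact ⟨h, rfl⟩
  · intro i p hp p' hp' h
    refine (keq (Sum.inr (Sum.inr (φ s(p.1, p.2), i))) hp hp' ?_ ?_).1
    · intro f hf
      rw [col_mem_hyper, hf]
      exact ⟨rfl, rfl⟩
    · intro f hf
      rw [col_mem_hyper, hf]
      exact ⟨h, rfl⟩
  · intro i j p hp p' hp' h
    refine (keq (Sum.inl s(p.1, p.2)) hp hp' ?_ ?_).2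
    · intro f hf
      rw [inl_mem_hyper, hf]
    · intro f hf
      rw [inl_mem_hyper, hf]
      exact h

theorem end_not_mem_of_freeSet {M : Finset (Arc φ Q l)} {b : Bool} {v : V} {i : Fin t}
    (h : v ∈ freeSet (arcsOf M i) b) :
    Sum.inr (Sum.inl (b, v, i)) ∉ M.biUnion (hyper φ Q l) := by
  rw [mem_biUnion]
  rintro ⟨f, hf, hx⟩
  simp only [freeSet, mem_filter, mem_univ, true_and] at h
  cases b
  · rw [in_mem_hyper] at hx
    refine h f.1.1 ?_
    simp only [Bool.false_eq_true, if_false]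
    rw [mem_arcsOf]
    exact ⟨f, hf, by rw [hx.1, hx.2]⟩
  · rw [out_mem_hyper] at hx
    refine h f.1.2.1 ?_
    simp only [if_true]
    rw [mem_arcsOf]
    exact ⟨f, hf, by rw [hx.1, hx.2]⟩

/-- Test weights on the ground set. -/
noncomputable def groundWt (φ : Sym2 V → C) {t k : ℕ} (l : Fin t → V → Fin k)
    (j : (V ⊕ (C × Fin t) ⊕ Fin t) × Bool) : Ground V C t → ℝ
  | Sum.inr (Sum.inl (b, v, i)) => if b = j.2 ∧ Good l b v i then endWt φ t j.1 v i else 0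
  | _ => 0

theorem groundWt_nonneg (j : (V ⊕ (C × Fin t) ⊕ Fin t) × Bool) (x : Ground V C t) :
    0 ≤ groundWt φ l j x := by
  rcases x with x | ⟨b, v, i⟩ | x <;> simp only [groundWt, le_refl]
  split_ifs
  · exact endWt_nonneg _ _ _
  · exact le_rfl

theorem groundWt_le {m : ℝ} (hm : 0 ≤ m) (h : ∀ j v i, endWt φ t j v i ≤ m)
    (j : (V ⊕ (C × Fin t) ⊕ Fin t) × Bool) (x : Ground V C t) :
    groundWt φ l j x ≤ m := by
  rcases x with x | ⟨b, v, i⟩ | x <;> simp only [groundWt, hm]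
  split_ifs
  · exact h _ _ _
  · exact hm

theorem sum_groundWt_le (h : ∀ j, ∑ v, ∑ i, endWt φ t j v i ≤ 1)
    (j : (V ⊕ (C × Fin t) ⊕ Fin t) × Bool) : ∑ x, groundWt φ l j x ≤ 1 := by
  refine le_trans ?_ (h j.1)
  rw [Fintype.sum_sum_type, Fintype.sum_sum_type]
  simp only [groundWt, Finset.sum_const_zero, zero_add, add_zero]
  rw [Fintype.sum_prod_type]
  have : ∀ b : Bool, ∑ y : V × Fin t, (if b = j.2 ∧ Good l b y.1 y.2 then
      endWt φ t j.1 y.1 y.2 else 0) ≤ if b = j.2 then ∑ v, ∑ i, endWt φ t j.1 v i else 0 := by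
    intro b
    by_cases hb : b = j.2
    · rw [if_pos hb, ← Fintype.sum_prod_type']
      refine Finset.sum_le_sum fun y _ => ?_
      split_ifs
      · exact le_rfl
      · exact endWt_nonneg _ _ _
    · simp [hb]
  refine (Finset.sum_le_sum fun b _ => this b).trans ?_
  simp

theorem sum_free_le {δ : ℝ} {M : Finset (Arc φ Q l)}
    (hM : ∀ j, ∑ x ∈ univ \ M.biUnion (hyper φ Q l), groundWt φ l j x ≤ δ) (b : Bool)
    (j : V ⊕ (C × Fin t) ⊕ Fin t) (T : Finset (V × Fin t))
    (hT : ∀ y ∈ T, y.1 ∈ freeSet (arcsOf M y.2) b ∧ Good l b y.1 y.2) :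
    ∑ y ∈ T, endWt φ t j y.1 y.2 ≤ δ := by
  refine le_trans ?_ (hM (j, b))
  have hinj : Function.Injective
      (fun y : V × Fin t => (Sum.inr (Sum.inl (b, y)) : Ground V C t)) := by
    intro y y' h
    simpa using h
  have : ∑ y ∈ T, endWt φ t j y.1 y.2 =
      ∑ x ∈ T.map ⟨_, hinj⟩, groundWt φ l (j, b) x := by
    rw [Finset.sum_map]
    refine Finset.sum_congr rfl fun y hy => ?_
    simp [groundWt, (hT y hy).2]
  rw [this]
  refine Finset.sum_le_sum_of_subset_of_nonneg ?_ fun x _ _ => groundWt_nonneg _ _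
  intro x hx
  obtain ⟨y, hy, rfl⟩ := mem_map.1 hx
  rw [mem_sdiff]
  exact ⟨mem_univ _, end_not_mem_of_freeSet (hT y hy).1⟩

theorem exists_label_of_not_good {t k : ℕ} (hk : 0 < k) (l : Fin t → V → Fin k) (b : Bool) :
    ∃ a : Fin k, ∀ v i, ¬ Good l b v i → l i v = a := by
  cases b
  · refine ⟨⟨0, hk⟩, fun v i h => ?_⟩
    simp only [Good, Bool.false_eq_true, if_false] at h
    rw [Fin.ext_iff]
    simp only
    omega
  · refine ⟨⟨k - 1, by omega⟩, fun v i h => ?_⟩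
    simp only [Good, if_true] at h
    rw [Fin.ext_iff]
    have := (l i v).2
    simp only
    omega

end PathSystems

section PathSystems

variable {V C : Type} [Fintype V] [DecidableEq V] [Fintype C] [DecidableEq C]

theorem card_ground_le {t : ℕ} (hV : 0 < Fintype.card V) (ht : t ≤ Fintype.card V)
    (hC : Fintype.card C ≤ Fintype.card V ^ 2) :
    (Fintype.card (Ground V C t) : ℝ) ≤ 4 * (Fintype.card V : ℝ) ^ 3 := by
  have h : Fintype.card (Ground V C t) ≤ 4 * Fintype.card V ^ 3 := by
    simp only [Ground, Fintype.card_sum, Fintype.card_prod, Fintype.card_bool, Fintype.card_fin,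
      Sym2.card]
    set n := Fintype.card V
    have h1 : (n + 1).choose 2 ≤ n ^ 2 := by
      rw [Nat.choose_two_right, Nat.add_sub_cancel]
      apply Nat.div_le_of_le_mul
      nlinarith
    have h2 : n * t ≤ n ^ 2 := by nlinarith
    have h3 : Fintype.card C * t ≤ n ^ 2 * n := Nat.mul_le_mul hC ht
    have h4 : n ^ 2 ≤ n ^ 3 := Nat.pow_le_pow_right hV (by norm_num)
    have h5 : n ^ 2 * n = n ^ 3 := by ring
    omega
  exact_mod_cast h

theorem card_testIndex_le {t : ℕ} (hV : 0 < Fintype.card V) (ht : t ≤ Fintype.card V)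
    (hC : Fintype.card C ≤ Fintype.card V ^ 2) :
    (Fintype.card ((V ⊕ (C × Fin t) ⊕ Fin t) × Bool) : ℝ) ≤ 6 * (Fintype.card V : ℝ) ^ 3 := by
  have h : Fintype.card ((V ⊕ (C × Fin t) ⊕ Fin t) × Bool) ≤ 6 * Fintype.card V ^ 3 := by
    simp only [Fintype.card_sum, Fintype.card_prod, Fintype.card_bool, Fintype.card_fin]
    set n := Fintype.card V
    have h3 : Fintype.card C * t ≤ n ^ 2 * n := Nat.mul_le_mul hC ht
    have h4 : n ^ 1 ≤ n ^ 3 := Nat.pow_le_pow_right hV (by norm_num)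
    rw [pow_one] at h4
    have h5 : n ^ 2 * n = n ^ 3 := by ring
    omega
  exact_mod_cast h

theorem dg_hyper_le {φ : Sym2 V → C} {Q : Finset C} {t k : ℕ} {l : Fin t → V → Fin k} {β D : ℝ}
    (hβ : 0 < β) (hD : 0 < D)
    (h1 : ∀ u v, u ≠ v →
      ((univ.filter fun i => (l i v : ℕ) = l i u + 1).card : ℝ) ≤ (1 + β) * D / 2)
    (h2 : ∀ c i, (((colPairs φ c).filter fun p => (l i p.2 : ℕ) = l i p.1 + 1).card : ℝ) ≤
      (1 + β) * D)
    (h3 : ∀ u i a, |(((nbrs φ Q u).filter fun v => l i v = a).card : ℝ) - D| ≤ β * D)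
    (x : Ground V C t) : (dg (hyper φ Q l) univ x : ℝ) ≤ (1 + β) * D := by
  rcases x with e | ⟨b, v, i⟩ | ⟨c, i⟩
  · induction e with
    | _ a b =>
      by_cases hab : a = b
      · rw [hab, dg_hyper_diag]
        simp only [Nat.cast_zero]
        positivity
      · have h : (dg (hyper φ Q l) univ (Sum.inl s(a, b)) : ℝ) ≤
          (univ.filter fun i => (l i b : ℕ) = l i a + 1).card +
          (univ.filter fun i => (l i a : ℕ) = l i b + 1).card := by
          exact_mod_cast dg_hyper_edge φ Q l a b
        have := h1 a b hab
        have := h1 b a (Ne.symm hab)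
        linarith
  · rw [dg_hyper_end]
    by_cases hg : Good l b v i
    · obtain ⟨a, ha⟩ := exists_label_of_good l b v i hg
      simp only [ha]
      have := (abs_le.1 (h3 v i a)).2
      linarith
    · rw [Finset.filter_false_of_mem fun w _ => not_label_of_not_good l b v i hg w]
      simp only [card_empty, Nat.cast_zero]
      positivity
  · exact le_trans (by exact_mod_cast dg_hyper_col φ Q l c i) (h2 c i)

theorem le_dg_hyper {φ : Sym2 V → C} {Q : Finset C} {t k : ℕ} {l : Fin t → V → Fin k} {β D : ℝ}
    (h3 : ∀ u i a, |(((nbrs φ Q u).filter fun v => l i v = a).card : ℝ) - D| ≤ β * D)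
    (b : Bool) (v : V) (i : Fin t) (hg : Good l b v i) :
    (1 - β) * D ≤ (dg (hyper φ Q l) univ (Sum.inr (Sum.inl (b, v, i))) : ℝ) := by
  rw [dg_hyper_end]
  obtain ⟨a, ha⟩ := exists_label_of_good l b v i hg
  simp only [ha]
  have := (abs_le.1 (h3 v i a)).1
  linarith

end PathSystems

/-- Almost spanning rainbow path systems exist for suitable label functions. -/
theorem exists_pathSystem (δ : ℝ) (hδ : 0 < δ) : ∃ β : ℝ, 0 < β ∧
    ∀ (V C : Type) [Fintype V] [DecidableEq V] [Fintype C] [DecidableEq C]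
      (φ : Sym2 V → C) (Q : Finset C) (t k : ℕ) (l : Fin t → V → Fin k) (D Cl γ : ℝ),
      0 < k → 0 < Fintype.card V → t ≤ Fintype.card V → Fintype.card C ≤ Fintype.card V ^ 2 →
      2 ≤ Cl → (∀ c v, (dc φ c v : ℝ) ≤ Cl) → (∀ c, ∑ v, dc φ c v ≤ Fintype.card V) →
      Cl ≤ β * D →
      (∀ u v, u ≠ v →
        ((univ.filter fun i => (l i v : ℕ) = l i u + 1).card : ℝ) ≤ (1 + β) * D / 2) →
      (∀ c i, (((colPairs φ c).filter fun p => (l i p.2 : ℕ) = l i p.1 + 1).card : ℝ) ≤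
        (1 + β) * D) →
      (∀ u i a, |(((nbrs φ Q u).filter fun v => l i v = a).card : ℝ) - D| ≤ β * D) →
      8 * (Fintype.card V : ℝ) ^ 3 * Real.exp (-(β * D / Cl)) +
        18 * (Fintype.card V : ℝ) ^ 3 * Real.exp (-(β * Fintype.card V / Cl)) < 1 →
      (∀ v a, ((univ.filter fun i => l i v = a).card : ℝ) ≤ γ * Fintype.card V) →
      (∀ c i a, ∑ v ∈ univ.filter (fun v => l i v = a), (dc φ c v : ℝ) ≤ γ * Fintype.card V) →
      (∀ i a, ((univ.filter fun v => l i v = a).card : ℝ) ≤ γ * Fintype.card V) →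
      ∃ P : Fin t → Finset (V × V), PathSystem φ Q l P ∧
        (∀ b i, ((freeSet (P i) b).card : ℝ) ≤ (δ + γ) * Fintype.card V) ∧
        (∀ b i c, ∑ v ∈ freeSet (P i) b, (dc φ c v : ℝ) ≤ (δ + γ) * Fintype.card V) ∧
        (∀ b v, ((univ.filter fun i => v ∈ freeSet (P i) b).card : ℝ) ≤
          (δ + γ) * Fintype.card V) := by
  obtain ⟨β, hβ, H⟩ := nibble 4 (by norm_num) δ hδ
  refine ⟨β, hβ, ?_⟩
  intro V C _ _ _ _ φ Q t k l D Cl γ hk hV ht hC hCl hd he hClD h1 h2 h3 hexp g1 g2 g3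
  have hV' : (0 : ℝ) < Fintype.card V := by exact_mod_cast hV
  have hD : 0 < D := by
    by_contra h
    push Not at h
    nlinarith
  obtain ⟨M, hM, hM'⟩ := H (Ground V C t) (Arc φ Q l) ((V ⊕ (C × Fin t) ⊕ Fin t) × Bool)
    (hyper φ Q l) (fun x => ∃ b v i, x = Sum.inr (Sum.inl (b, v, i)) ∧ Good l b v i)
    (groundWt φ l) D Cl (Cl / Fintype.card V) card_hyper (by linarith) hClD
    (dg_hyper_le hβ hD h1 h2 h3)
    (by
      rintro x ⟨b, v, i, rfl, hg⟩
      exact le_dg_hyper h3 b v i hg)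
    (codeg_hyper_le φ Q l hCl hd) (by positivity) groundWt_nonneg
    (groundWt_le (by positivity) (endWt_le (by linarith) hd))
    (by
      rintro j (x | ⟨b, v, i⟩ | x) hx
      · rfl
      · simp only [groundWt]
        rw [if_neg]
        rintro ⟨-, hg⟩
        exact hx ⟨b, v, i, rfl, hg⟩
      · rfl)
    (sum_groundWt_le (sum_endWt_le hV ht he))
    (by
      refine lt_of_le_of_lt (add_le_add ?_ ?_) hexp
      · have := card_ground_le hV ht hC
        refine mul_le_mul_of_nonneg_right ?_ (Real.exp_pos _).le
        linarith
      · have := card_testIndex_le hV ht hC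
        rw [div_div_eq_mul_div]
        refine mul_le_mul_of_nonneg_right ?_ (Real.exp_pos _).le
        linarith)
  have hfree := fun b j T hT => sum_free_le (b := b) (j := j) (T := T) hM' hT
  refine ⟨arcsOf M, pathSystem_arcsOf hM, ?_, ?_, ?_⟩
  · intro b i
    obtain ⟨a, ha⟩ := exists_label_of_not_good hk l b
    have e1 := hfree b (Sum.inr (Sum.inr i))
      (((freeSet (arcsOf M i) b).filter fun v => Good l b v i) ×ˢ {i}) (by
        rintro ⟨v, i'⟩ hy
        simp only [mem_product, mem_filter, mem_singleton] at hy
        obtain ⟨hy, rfl⟩ := hy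
        exact hy)
    rw [Finset.sum_product] at e1
    simp only [sum_singleton, endWt, if_true, sum_const, nsmul_eq_mul, mul_one_div] at e1
    rw [div_le_iff₀ hV'] at e1
    have e2 : (((freeSet (arcsOf M i) b).filter fun v => ¬ Good l b v i).card : ℝ) ≤
        γ * Fintype.card V := by
      refine le_trans ?_ (g3 i a)
      refine Nat.cast_le.2 (card_le_card fun v hv => ?_)
      exact mem_filter.2 ⟨mem_univ _, ha v i (mem_filter.1 hv).2⟩
    have e3 : ((freeSet (arcsOf M i) b).card : ℝ) =
        ((freeSet (arcsOf M i) b).filter fun v => Good l b v i).card +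
        ((freeSet (arcsOf M i) b).filter fun v => ¬ Good l b v i).card := by
      exact_mod_cast (Finset.card_filter_add_card_filter_not _).symm
    rw [e3]
    linarith
  · intro b i c
    obtain ⟨a, ha⟩ := exists_label_of_not_good hk l b
    have e1 := hfree b (Sum.inr (Sum.inl (c, i)))
      (((freeSet (arcsOf M i) b).filter fun v => Good l b v i) ×ˢ {i}) (by
        rintro ⟨v, i'⟩ hy
        simp only [mem_product, mem_filter, mem_singleton] at hy
        obtain ⟨hy, rfl⟩ := hy
        exact hy)
    rw [Finset.sum_product] at e1
    simp only [sum_singleton, endWt, if_true] at e1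
    rw [← Finset.sum_div, div_le_iff₀ hV'] at e1
    have e2 : ∑ v ∈ (freeSet (arcsOf M i) b).filter fun v => ¬ Good l b v i, (dc φ c v : ℝ) ≤
        γ * Fintype.card V := by
      refine le_trans ?_ (g2 c i a)
      refine Finset.sum_le_sum_of_subset_of_nonneg (fun v hv => ?_) fun _ _ _ => by positivity
      exact mem_filter.2 ⟨mem_univ _, ha v i (mem_filter.1 hv).2⟩
    rw [← Finset.sum_filter_add_sum_filter_not _ (fun v => Good l b v i)]
    linarith
  · intro b v
    obtain ⟨a, ha⟩ := exists_label_of_not_good hk l b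
    have e1 := hfree b (Sum.inl v)
      ({v} ×ˢ ((univ.filter fun i => v ∈ freeSet (arcsOf M i) b).filter fun i => Good l b v i)) (by
        rintro ⟨v', i⟩ hy
        simp only [mem_product, mem_filter, mem_singleton, mem_univ, true_and] at hy
        obtain ⟨rfl, hy⟩ := hy
        exact hy)
    rw [Finset.sum_product] at e1
    simp only [sum_singleton, endWt, if_true, sum_const, nsmul_eq_mul, mul_one_div] at e1
    rw [div_le_iff₀ hV'] at e1
    have e2 : (((univ.filter fun i => v ∈ freeSet (arcsOf M i) b).filter
        fun i => ¬ Good l b v i).card : ℝ) ≤ γ * Fintype.card V := by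
      refine le_trans ?_ (g1 v a)
      refine Nat.cast_le.2 (card_le_card fun i hi => ?_)
      exact mem_filter.2 ⟨mem_univ _, ha v i (mem_filter.1 hi).2⟩
    have e3 : ((univ.filter fun i => v ∈ freeSet (arcsOf M i) b).card : ℝ) =
        ((univ.filter fun i => v ∈ freeSet (arcsOf M i) b).filter fun i => Good l b v i).card +
        ((univ.filter fun i => v ∈ freeSet (arcsOf M i) b).filter
          fun i => ¬ Good l b v i).card := by
      exact_mod_cast (Finset.card_filter_add_card_filter_not _).symm
    rw [e3]
    linarith

theorem card_nbrs_add {V C : Type} [Fintype V] [DecidableEq V] [Fintype C] [DecidableEq C]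
    (φ : Sym2 V → C) (Q : Finset C) (u : V) :
    (nbrs φ Q u).card + rdeg φ Q u univ + 1 = Fintype.card V := by
  have h : (univ.erase u).card = (nbrs φ Q u).card + rdeg φ Q u univ := by
    rw [← Finset.card_filter_add_card_filter_not (s := univ.erase u) (fun v => φ s(u, v) ∉ Q)]
    unfold nbrs rdeg
    congr 2 <;> ext v <;> simp
  rw [card_erase_of_mem (mem_univ u), card_univ] at h
  have : 0 < Fintype.card V := Fintype.card_pos_iff.2 ⟨u⟩
  omega

set_option maxHeartbeats 1000000 in
/-- A reserved set of colours together with almost spanning rainbow path systems avoiding it. -/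
theorem exists_reserved_pathSystem {q γ : ℝ} (hq : 0 < q) (hq1 : q ≤ 1 / 4) (hγ : 0 < γ)
    (hγ1 : γ ≤ 1) : ∃ κ : ℝ, 0 < κ ∧ ∃ k : ℕ,
    ∀ (V C : Type) [Fintype V] [DecidableEq V] [Fintype C] [DecidableEq C]
      (φ : Sym2 V → C) (t : ℕ) (Cl : ℝ),
      1 ≤ κ * Fintype.card V → 2 ≤ Cl → Cl ≤ κ * Fintype.card V →
      (∀ c v, (dc φ c v : ℝ) ≤ Cl) →
      (∀ c, ∑ v, (dc φ c v : ℝ) ≤ (1 - q) * Fintype.card V) →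
      (t : ℝ) ≤ (1 - q) * Fintype.card V / 2 → Fintype.card C ≤ Fintype.card V ^ 2 →
      100 * (Fintype.card V : ℝ) ^ 4 * Real.exp (-(κ * Fintype.card V / Cl)) < 1 →
      ∃ (Q : Finset C) (l : Fin t → V → Fin k) (P : Fin t → Finset (V × V)),
        PathSystem φ Q l P ∧
        (∀ b i, ((freeSet (P i) b).card : ℝ) ≤ γ * Fintype.card V) ∧
        (∀ b i c, ∑ v ∈ freeSet (P i) b, (dc φ c v : ℝ) ≤ γ * Fintype.card V) ∧
        (∀ b v, ((univ.filter fun i => v ∈ freeSet (P i) b).card : ℝ) ≤ γ * Fintype.card V) ∧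
        (∀ u, |(rdeg φ Q u univ : ℝ) - q * Fintype.card V| ≤ γ * Fintype.card V) ∧
        ∀ S : Finset V, ((univ.filter fun w =>
          (rdeg φ Q w S : ℝ) < q * S.card - γ * Fintype.card V).card : ℝ) ≤
            γ * Fintype.card V := by
  obtain ⟨β₀, hβ₀, H⟩ := exists_pathSystem (γ / 2) (by positivity)
  obtain ⟨k, hk⟩ := exists_nat_ge (4 / γ)
  have hk0 : (0 : ℝ) < k := lt_of_lt_of_le (by positivity) hk
  have hk0' : 0 < k := by exact_mod_cast hk0
  have hkγ : 1 / (k : ℝ) ≤ γ / 4 := by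
    rw [div_le_iff₀ hk0]
    rw [div_le_iff₀ hγ] at hk
    linarith
  have hq' : 0 < 1 - q := by linarith
  set b := min 1 (min (γ / 4) (β₀ * (1 - q) / (2 * k))) with hb
  have hb0 : 0 < b := by rw [hb]; positivity
  have hb1 : b ≤ 1 := min_le_left _ _
  have hbγ : b ≤ γ / 4 := (min_le_right _ _).trans (min_le_left _ _)
  have hbβ : b ≤ β₀ * (1 - q) / (2 * k) := (min_le_right _ _).trans (min_le_right _ _)
  set γ₁ := min γ (β₀ * (1 - q) / 4) with hγ₁
  have hγ₁0 : 0 < γ₁ := by rw [hγ₁]; positivity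
  have hγ₁γ : γ₁ ≤ γ := min_le_left _ _
  have hγ₁β : γ₁ ≤ β₀ * (1 - q) / 4 := min_le_right _ _
  set β₁ := γ₁ ^ 3 / 16 with hβ₁
  have hβ₁0 : 0 < β₁ := by rw [hβ₁]; positivity
  obtain ⟨κ, hκ, k1, k2, k3, k4, k5, k6, k7⟩ : ∃ κ : ℝ, 0 < κ ∧ κ ≤ β₁ ∧ κ ≤ β₁ ^ 2 / 16 ∧
      κ ≤ b ^ 2 / 16 ∧ κ ≤ β₀ * ((1 - q) / k) ∧ κ ≤ β₀ ∧ κ ≤ 1 / k ∧ κ ≤ β₀ * (1 - q) / 4 := by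
    refine ⟨min β₁ (min (β₁ ^ 2 / 16) (min (b ^ 2 / 16) (min (β₀ * ((1 - q) / k)) (min β₀
      (min (1 / k) (β₀ * (1 - q) / 4)))))), by positivity, ?_, ?_, ?_, ?_, ?_, ?_, ?_⟩ <;>
      simp only [min_le_iff, le_refl, true_or, or_true]
  refine ⟨κ, hκ, k, ?_⟩
  intro V C _ _ _ _ φ t Cl hn hCl hCκ hd he ht hC hexp
  set n := Fintype.card V with hnV
  have hn0 : (0 : ℝ) < n := by
    by_contra h
    nlinarith
  have hn0' : 0 < n := by exact_mod_cast hn0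
  have hn1 : (1 : ℝ) ≤ n := by exact_mod_cast hn0'
  have hκa : ∀ a : ℝ, κ ≤ a → κ * n ≤ a * n := fun a h => by gcongr
  have hexpa : ∀ a : ℝ, κ * n ≤ a → Real.exp (-(a / Cl)) ≤ Real.exp (-(κ * n / Cl)) := by
    intro a h
    refine Real.exp_le_exp.2 ?_
    gcongr
  have hpow : ∀ j, j ≤ 4 → (n : ℝ) ^ j ≤ (n : ℝ) ^ 4 := fun j hj => pow_le_pow_right₀ hn1 hj
  have hE0 := (Real.exp_pos (-(κ * n / Cl))).le
  obtain ⟨Q, hQ1, hQ2⟩ := exists_reserve φ hq.le (by linarith) hγ₁0 (hγ₁γ.trans hγ1) hβ₁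
    (by linarith : (1 : ℝ) ≤ Cl) hd (hn.trans (hκa _ k1)) (hCκ.trans (hκa _ k1)) (by
      refine lt_of_le_of_lt ?_ hexp
      have e1 := hexpa (β₁ ^ 2 / 16 * n) (hκa _ k2)
      have e2 : β₁ ^ 2 / 16 * n / Cl = β₁ ^ 2 * n / (16 * Cl) := by field_simp
      rw [e2] at e1
      refine mul_le_mul ?_ e1 (Real.exp_pos _).le (by positivity)
      have := hpow 2 (by norm_num)
      nlinarith [pow_pos hn0 4])
  have he' : ∀ c, ∑ v, dc φ c v ≤ Fintype.card V := by
    intro c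
    have h1 := he c
    have h2 : ((∑ v, dc φ c v : ℕ) : ℝ) ≤ (n : ℝ) := by
      push_cast
      nlinarith
    exact_mod_cast h2
  have htn : (t : ℝ) ≤ n := by nlinarith
  have htn' : t ≤ Fintype.card V := by exact_mod_cast htn
  have hkn : k ≤ Fintype.card V := by
    have h := hn.trans (hκa _ k6)
    rw [one_div, inv_mul_eq_div, le_div_iff₀ hk0, one_mul] at h
    exact_mod_cast h
  obtain ⟨l, l1, l2, l3, l4, l5, l6⟩ := exists_labels φ Q hk0' hb0 hb1
    (by linarith : (1 : ℝ) ≤ Cl) hd hn0' he' htn' hkn hC (by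
      refine lt_of_le_of_lt ?_ hexp
      have e1 := hexpa (b ^ 2 / 16 * n) (hκa _ k3)
      have e2 : b ^ 2 / 16 * n / Cl = b ^ 2 * n / (16 * Cl) := by field_simp
      rw [e2] at e1
      refine mul_le_mul ?_ e1 (Real.exp_pos _).le (by positivity)
      nlinarith [pow_pos hn0 4])
  have hbn : b * n ≤ β₀ * ((1 - q) * n / k) / 2 := by
    have : β₀ * ((1 - q) * n / k) / 2 = β₀ * (1 - q) / (2 * k) * n := by field_simp
    rw [this]
    gcongr
  have hbn' : b * n ≤ γ / 4 * n := by gcongr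
  have hnk : (n : ℝ) / k ≤ γ / 4 * n := by
    have : (n : ℝ) / k = 1 / k * n := by ring
    rw [this]
    gcongr
  have hD0 : 0 < (1 - q) * n / k := by positivity
  obtain ⟨P, hP, p1, p2, p3⟩ := H V C φ Q t k l ((1 - q) * n / k) Cl (γ / 2) hk0' hn0' htn' hC hCl
    hd he'
    (by
      refine (hCκ.trans (hκa _ k4)).trans (le_of_eq ?_)
      ring)
    (by
      intro u v huv
      refine (l2 u v huv).trans ?_
      have h1 : (t : ℝ) / k ≤ (1 - q) * n / k / 2 := by
        rw [div_right_comm]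
        gcongr
      linarith)
    (by
      intro c i
      refine (l3 c i).trans ?_
      have h1 : (∑ v, (dc φ c v : ℝ)) / k ≤ (1 - q) * n / k := by
        gcongr
        exact he c
      nlinarith)
    (by
      intro u i a
      have h1 := abs_le.1 (l1 u i a)
      have h2 := abs_le.1 (hQ1 u)
      have h3 : ((nbrs φ Q u).card : ℝ) + rdeg φ Q u univ + 1 = n := by
        exact_mod_cast card_nbrs_add φ Q u
      have h4 : γ₁ * n ≤ β₀ * (1 - q) / 4 * n := by gcongr
      have h5 := hn.trans (hκa _ k7)
      have h6 : ((nbrs φ Q u).card : ℝ) / k ≤ (1 - q) * n / k + β₀ * ((1 - q) * n / k) / 2 := by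
        rw [div_le_iff₀ hk0]
        have : ((1 - q) * n / k + β₀ * ((1 - q) * n / k) / 2) * k =
          (1 - q) * n + β₀ * (1 - q) / 2 * n := by field_simp
        rw [this]
        linarith
      have h7 : (1 - q) * n / k - β₀ * ((1 - q) * n / k) / 2 ≤ ((nbrs φ Q u).card : ℝ) / k := by
        rw [le_div_iff₀ hk0]
        have : ((1 - q) * n / k - β₀ * ((1 - q) * n / k) / 2) * k =
          (1 - q) * n - β₀ * (1 - q) / 2 * n := by field_simp
        rw [this]
        linarith
      rw [abs_le]
      constructor <;> linarith)
    (by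
      refine lt_of_le_of_lt ?_ hexp
      have e1 := hexpa (β₀ * ((1 - q) * n / k)) (by
        refine (hκa _ k4).trans (le_of_eq ?_)
        ring)
      have e2 := hexpa (β₀ * n) (hκa _ k5)
      have h3 := hpow 3 (by norm_num)
      have h30 := pow_pos hn0 3
      calc _ ≤ 8 * (n : ℝ) ^ 3 * Real.exp (-(κ * n / Cl)) +
            18 * (n : ℝ) ^ 3 * Real.exp (-(κ * n / Cl)) := by gcongr
        _ = 26 * (n : ℝ) ^ 3 * Real.exp (-(κ * n / Cl)) := by ring
        _ ≤ 100 * (n : ℝ) ^ 4 * Real.exp (-(κ * n / Cl)) := by gcongr; norm_num)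
    (by
      intro v a
      refine (l4 v a).trans ?_
      have h1 : (t : ℝ) / k ≤ n / k := by gcongr
      linarith)
    (by
      intro c i a
      refine (l5 c i a).trans ?_
      have h1 : (∑ v, (dc φ c v : ℝ)) / k ≤ n / k := by
        gcongr
        exact_mod_cast he' c
      linarith)
    (by
      intro i a
      refine (l6 i a).trans ?_
      linarith)
  rw [add_halves] at p1 p2 p3
  have hγn : γ₁ * n ≤ γ * n := by gcongr
  refine ⟨Q, l, P, hP, p1, p2, p3, fun u => (hQ1 u).trans hγn, fun S => ?_⟩
  refine le_trans (Nat.cast_le.2 (card_le_card fun w hw => ?_)) ((hQ2 S).trans hγn)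
  rw [mem_filter] at hw ⊢
  exact ⟨mem_univ _, by linarith [hw.2]⟩

section CyclicLists

variable {α : Type*}

/-- All cyclically consecutive pairs of the list are related. -/
def CycRel (R : α → α → Prop) (L : List α) : Prop :=
  L.IsChain R ∧ ∀ x ∈ L.getLast?, ∀ y ∈ L.head?, R x y

variable {R S : α → α → Prop}

theorem CycRel.swap {A B : List α} (h : CycRel R (A ++ B)) : CycRel R (B ++ A) := by
  rcases A.eq_nil_or_concat with rfl | ⟨A', a, rfl⟩
  · simpa using h
  rcases B.eq_nil_or_concat with rfl | ⟨B', b, rfl⟩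
  · simpa using h
  obtain ⟨h1, h2⟩ := h
  rw [List.isChain_append] at h1
  refine ⟨List.isChain_append.2 ⟨h1.2.1, h1.1, ?_⟩, ?_⟩
  · intro x hx y hy
    refine h2 x ?_ y ?_
    · rw [List.getLast?_append, Option.mem_def.1 hx]
      rfl
    · rw [List.head?_append, Option.mem_def.1 hy]
      rfl
  · intro x hx y hy
    refine h1.2.2 x ?_ y ?_
    · rw [List.getLast?_append] at hx
      simpa using hx
    · cases B' <;> simpa using hy

theorem CycRel.reverse (hR : ∀ x y, R x y → R y x) {L : List α} (h : CycRel R L) :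
    CycRel R L.reverse := by
  refine ⟨List.isChain_reverse.2 (h.1.imp fun x y => hR x y), ?_⟩
  intro x hx y hy
  rw [List.getLast?_reverse] at hx
  rw [List.head?_reverse] at hy
  exact hR _ _ (h.2 y hy x hx)

theorem CycRel.imp_of_mem {L : List α} (h : CycRel R L)
    (hRS : ∀ x ∈ L, ∀ y ∈ L, R x y → S x y) : CycRel S L := by
  refine ⟨h.1.imp_of_mem_imp fun x y hx hy => hRS x hx y hy, fun x hx y hy => ?_⟩
  exact hRS x (List.mem_of_getLast? hx) y (List.mem_of_head? hy) (h.2 x hx y hy)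

theorem cycRel_append_reverse_append {L₁ L₂ L₃ : List α} (hR : ∀ x y, R x y → R y x)
    (h1 : L₁.IsChain R) (h2 : L₂.IsChain R) (h3 : L₃.IsChain R)
    {x₁ y₁ x₂ y₂ x₃ y₃ : α} (hx₁ : L₁.head? = some x₁) (hy₁ : L₁.getLast? = some y₁)
    (hx₂ : L₂.head? = some x₂) (hy₂ : L₂.getLast? = some y₂)
    (hx₃ : L₃.head? = some x₃) (hy₃ : L₃.getLast? = some y₃)
    (r1 : R y₁ y₃) (r2 : R x₃ x₂) (r3 : R y₂ x₁) :
    CycRel R (L₁ ++ L₃.reverse ++ L₂) := by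
  have h3' : L₃.reverse.IsChain R := List.isChain_reverse.2 (h3.imp fun x y => hR x y)
  refine ⟨?_, ?_⟩
  · rw [List.isChain_append, List.isChain_append]
    refine ⟨⟨h1, h3', ?_⟩, h2, ?_⟩
    · rw [List.head?_reverse, hy₁, hy₃]
      simpa using r1
    · rw [List.getLast?_append, List.getLast?_reverse, hx₃, hx₂]
      simpa using r2
  · rw [List.getLast?_append, hy₂, List.head?_append, List.head?_append, hx₁]
    simpa using r3

theorem cycRel_reverse_append_reverse {L₁ L₂ L₃ : List α} (hR : ∀ x y, R x y → R y x)
    (h1 : L₁.IsChain R) (h2 : L₂.IsChain R) (h3 : L₃.IsChain R)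
    {x₁ y₁ x₂ y₂ x₃ y₃ : α} (hx₁ : L₁.head? = some x₁) (hy₁ : L₁.getLast? = some y₁)
    (hx₂ : L₂.head? = some x₂) (hy₂ : L₂.getLast? = some y₂)
    (hx₃ : L₃.head? = some x₃) (hy₃ : L₃.getLast? = some y₃)
    (r1 : R x₁ x₂) (r2 : R y₂ y₃) (r3 : R x₃ y₁) :
    CycRel R (L₁.reverse ++ L₂ ++ L₃.reverse) := by
  have h1' : L₁.reverse.IsChain R := List.isChain_reverse.2 (h1.imp fun x y => hR x y)
  have h3' : L₃.reverse.IsChain R := List.isChain_reverse.2 (h3.imp fun x y => hR x y)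
  refine ⟨?_, ?_⟩
  · rw [List.isChain_append, List.isChain_append]
    refine ⟨⟨h1', h2, ?_⟩, h3', ?_⟩
    · rw [List.getLast?_reverse, hx₁, hx₂]
      simpa using r1
    · rw [List.getLast?_append, List.head?_reverse, hy₂, hy₃]
      simpa using r2
  · rw [List.getLast?_append, List.getLast?_reverse, hx₃, List.head?_append, List.head?_append,
      List.head?_reverse, hy₁]
    simpa using r3

theorem chain_of_closed {T : Set (Sym2 α)} {a b : α} {L : List α} (hL : L.Nodup)
    (h3 : 3 ≤ L.length) (ha : L.head? = some a) (hb : L.getLast? = some b)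
    (h : L.IsChain fun x y => s(x, y) ∈ T ∨ s(x, y) = s(b, a)) :
    L.IsChain fun x y => s(x, y) ∈ T := by
  rw [List.isChain_iff_getElem] at h ⊢
  intro i hi
  refine (h i hi).resolve_right fun he => ?_
  rw [List.head?_eq_getElem?, List.getElem?_eq_some_iff] at ha
  rw [List.getLast?_eq_getElem?, List.getElem?_eq_some_iff] at hb
  obtain ⟨ha', rfl⟩ := ha
  obtain ⟨hb', rfl⟩ := hb
  rw [Sym2.eq_iff, hL.getElem_inj_iff, hL.getElem_inj_iff, hL.getElem_inj_iff,
    hL.getElem_inj_iff] at he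
  omega

theorem cycRel_or_exists_closed {T : Set (Sym2 α)} {a b : α} {L : List α} (hL : L.Nodup)
    (h3 : 3 ≤ L.length) (h : CycRel (fun x y => s(x, y) ∈ T ∨ s(x, y) = s(b, a)) L) :
    CycRel (fun x y => s(x, y) ∈ T) L ∨ ∃ L' : List α, L'.Perm L ∧
      L'.IsChain (fun x y => s(x, y) ∈ T) ∧ L'.head? = some a ∧ L'.getLast? = some b := by
  by_cases hT : CycRel (fun x y => s(x, y) ∈ T) L
  · exact Or.inl hT
  right
  have hsymm : ∀ x y : α, (s(x, y) ∈ T ∨ s(x, y) = s(b, a)) → (s(y, x) ∈ T ∨ s(y, x) = s(b, a)) := by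
    intro x y hxy
    rwa [Sym2.eq_swap (a := y)]
  have key : ∃ L' : List α, L'.Perm L ∧
      CycRel (fun x y => s(x, y) ∈ T ∨ s(x, y) = s(b, a)) L' ∧
      ∃ x y, L'.head? = some x ∧ L'.getLast? = some y ∧ s(y, x) = s(b, a) := by
    by_cases hc : L.IsChain fun x y => s(x, y) ∈ T
    · have h2 : ¬ ∀ x ∈ L.getLast?, ∀ y ∈ L.head?, s(x, y) ∈ T := fun h' => hT ⟨hc, h'⟩
      push Not at h2
      obtain ⟨x, hx, y, hy, hxy⟩ := h2
      exact ⟨L, List.Perm.refl _, h, y, x, hy, hx, (h.2 x hx y hy).resolve_left hxy⟩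
    · rw [List.isChain_iff_forall_rel_of_append_cons_cons] at hc
      push Not at hc
      obtain ⟨x, y, A, B, rfl, hxy⟩ := hc
      have hxy' := (List.isChain_iff_forall_rel_of_append_cons_cons.1 h.1 rfl).resolve_left hxy
      have e : A ++ x :: y :: B = (A ++ [x]) ++ (y :: B) := by simp
      refine ⟨(y :: B) ++ (A ++ [x]), ?_, ?_, y, x, rfl, ?_, hxy'⟩
      · rw [e]
        exact List.perm_append_comm
      · rw [e] at h
        exact h.swap
      · simp only [List.getLast?_append, List.getLast?_singleton, Option.some_or]
  obtain ⟨L', hp, hL', x, y, hx, hy, hxy⟩ := key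
  have hn' : L'.Nodup := hp.nodup_iff.2 hL
  have h3' : 3 ≤ L'.length := by rwa [hp.length_eq]
  rw [Sym2.eq_iff] at hxy
  rcases hxy with ⟨rfl, rfl⟩ | ⟨rfl, rfl⟩
  · exact ⟨L', hp, chain_of_closed hn' h3' hx hy hL'.1, hx, hy⟩
  · refine ⟨L'.reverse, (List.reverse_perm _).trans hp,
      chain_of_closed (List.nodup_reverse.2 hn') (by simpa using h3') ?_ ?_
        (hL'.reverse hsymm).1, ?_, ?_⟩ <;>
    simp [hx, hy]

end CyclicLists

section Linearise

variable {V : Type} [DecidableEq V]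

/-- `(x, y)` is an arc, or `x` has no out-arc and `y` no in-arc within `U`. -/
def ArcOrFree (P : Finset (V × V)) (U : Finset V) (x y : V) : Prop :=
  (x, y) ∈ P ∨ ((∀ w ∈ U, (x, w) ∉ P) ∧ ∀ w ∈ U, (w, y) ∉ P)

theorem exists_list_arcOrFree {P : Finset (V × V)} {l : V → ℕ}
    (hl : ∀ p ∈ P, l p.1 < l p.2)
    (ho : ∀ p ∈ P, ∀ p' ∈ P, p.1 = p'.1 → p = p')
    (hi : ∀ p ∈ P, ∀ p' ∈ P, p.2 = p'.2 → p = p') (U : Finset V) :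
    ∃ L : List V, L.Nodup ∧ (∀ x, x ∈ L ↔ x ∈ U) ∧ L.IsChain (ArcOrFree P U) ∧
      (∀ x ∈ L.head?, ∀ w ∈ U, (w, x) ∉ P) ∧ ∀ x ∈ L.getLast?, ∀ w ∈ U, (x, w) ∉ P := by
  induction U using Finset.induction_on_max_value l with
  | empty => exact ⟨[], by simp⟩
  | insert z U hz hmax ih =>
    obtain ⟨L, hL, hmem, hch, hh, hla⟩ := ih
    have hzo : ∀ w ∈ insert z U, (z, w) ∉ P := by
      intro w hw hp
      have h1 := hl _ hp
      rcases Finset.mem_insert.1 hw with rfl | hw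
      · exact lt_irrefl _ h1
      · exact absurd h1 (not_lt.2 (hmax w hw))
    have hU : ∀ x y, x ∈ U → y ∈ U → (x, z) ∉ P → ArcOrFree P U x y →
        ArcOrFree P (insert z U) x y := by
      rintro x y hx hy hxz (h | ⟨h1, h2⟩)
      · exact Or.inl h
      · refine Or.inr ⟨fun w hw => ?_, fun w hw => ?_⟩
        · rcases Finset.mem_insert.1 hw with rfl | hw
          exacts [hxz, h1 w hw]
        · rcases Finset.mem_insert.1 hw with rfl | hw
          exacts [hzo y (Finset.mem_insert_of_mem hy), h2 w hw]
    have hzL : z ∉ L := fun h => hz ((hmem z).1 h)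
    by_cases hu : ∃ u ∈ U, (u, z) ∈ P
    · obtain ⟨u, huU, huz⟩ := hu
      obtain ⟨A, B, rfl⟩ := List.append_of_mem ((hmem u).2 huU)
      have huniq : ∀ x, (x, z) ∈ P → x = u := fun x hx => congrArg Prod.fst (hi _ hx _ huz rfl)
      have hmem' : ∀ x ∈ A ++ u :: B, x ∈ U := fun x hx => (hmem x).1 hx
      have hnA : ∀ x ∈ A, x ≠ u := by
        rintro x hx rfl
        rw [List.nodup_append] at hL
        exact hL.2.2 _ hx x (by simp) rfl
      have hnB : ∀ x ∈ B, x ≠ u := by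
        rintro x hx rfl
        rw [List.nodup_append, List.nodup_cons] at hL
        exact hL.2.1.1 hx
      rw [List.isChain_append, List.isChain_cons] at hch
      refine ⟨A ++ u :: z :: B, ?_, ?_, ?_, ?_, ?_⟩
      · have : (A ++ u :: z :: B).Perm (z :: (A ++ u :: B)) := by
          rw [show A ++ u :: z :: B = (A ++ [u]) ++ z :: B by simp,
            show z :: (A ++ u :: B) = z :: ((A ++ [u]) ++ B) by simp]
          exact List.perm_middle
        exact this.nodup_iff.2 (List.nodup_cons.2 ⟨hzL, hL⟩)
      · intro x
        rw [Finset.mem_insert, ← hmem x]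
        simp only [List.mem_append, List.mem_cons]
        tauto
      · rw [List.isChain_append, List.isChain_cons, List.isChain_cons]
        refine ⟨?_, ⟨?_, ?_, ?_⟩, ?_⟩
        · exact hch.1.imp_of_mem_imp fun x y hx hy h => hU x y (hmem' x (by simp [hx]))
            (hmem' y (by simp [hy])) (fun h' => hnA x hx (huniq x h')) h
        · intro y hy
          simp only [List.head?_cons, Option.mem_def, Option.some.injEq] at hy
          subst hy
          exact Or.inl huz
        · intro y hy
          have hyB : y ∈ B := List.mem_of_head? hy
          have hyU := hmem' y (by simp [hyB])
          rcases hch.2.1.1 y hy with h | h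
          · have : y = z := congrArg Prod.snd (ho _ h _ huz rfl)
            exact absurd (this ▸ hyU) hz
          · refine Or.inr ⟨hzo, fun w hw => ?_⟩
            rcases Finset.mem_insert.1 hw with rfl | hw
            exacts [hzo y (Finset.mem_insert_of_mem hyU), h.2 w hw]
        · exact hch.2.1.2.imp_of_mem_imp fun x y hx hy h => hU x y (hmem' x (by simp [hx]))
            (hmem' y (by simp [hy])) (fun h' => hnB x hx (huniq x h')) h
        · intro x hx y hy
          have hxA : x ∈ A := List.mem_of_getLast? hx
          simp only [List.head?_cons, Option.mem_def, Option.some.injEq] at hy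
          subst hy
          exact hU _ _ (hmem' x (by simp [hxA])) (hmem' _ (by simp))
            (fun h' => hnA x hxA (huniq x h')) (hch.2.2 x hx _ (by simp))
      · intro x hx w hw
        have hx' : x ∈ (A ++ u :: B).head? := by
          cases A <;> simpa using hx
        have hxU := hmem' x (List.mem_of_head? hx')
        rcases Finset.mem_insert.1 hw with rfl | hw
        exacts [hzo x (Finset.mem_insert_of_mem hxU), hh x hx' w hw]
      · intro x hx w hw
        rcases B.eq_nil_or_concat with rfl | ⟨B, y, rfl⟩
        · have : x = z := by simpa [List.getLast?_append] using hx.symm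
          subst this
          exact hzo w hw
        · have hxy : x = y := by
            have : A ++ u :: z :: (B ++ [y]) = (A ++ u :: z :: B) ++ [y] := by simp
            simp only [List.concat_eq_append] at hx
            rw [this, List.getLast?_concat] at hx
            exact (Option.some.inj hx).symm
          subst hxy
          rcases Finset.mem_insert.1 hw with rfl | hw
          · exact fun h' => hnB x (by simp) (huniq x h')
          · refine hla x ?_ w hw
            have : A ++ u :: (B ++ [x]) = (A ++ u :: B) ++ [x] := by simp
            simp only [List.concat_eq_append]
            rw [this, List.getLast?_concat]
            rfl
    · push Not at hu
      refine ⟨L ++ [z], ?_, ?_, ?_, ?_, ?_⟩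
      · rw [List.nodup_append_comm]
        exact List.nodup_cons.2 ⟨hzL, hL⟩
      · intro x
        rw [Finset.mem_insert, ← hmem x]
        simp only [List.mem_append, List.mem_singleton]
        tauto
      · rw [List.isChain_append]
        refine ⟨?_, List.isChain_singleton _, ?_⟩
        · exact hch.imp_of_mem_imp fun x y hx hy h => hU x y ((hmem x).1 hx)
            ((hmem y).1 hy) (hu x ((hmem x).1 hx)) h
        · intro x hx y hy
          simp only [List.head?_cons, Option.mem_def, Option.some.injEq] at hy
          subst hy
          refine Or.inr ⟨fun w hw => ?_, fun w hw => ?_⟩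
          · rcases Finset.mem_insert.1 hw with rfl | hw
            exacts [hu x ((hmem x).1 (List.mem_of_getLast? hx)), hla x hx w hw]
          · rcases Finset.mem_insert.1 hw with rfl | hw
            exacts [hzo _ (Finset.mem_insert_self _ _), hu w hw]
      · intro x hx w hw
        rcases L with _ | ⟨y, L⟩
        · have : x = z := by simpa using hx.symm
          subst this
          rcases Finset.mem_insert.1 hw with rfl | hw
          exacts [hzo _ (Finset.mem_insert_self _ _), hu w hw]
        · have hx' : x ∈ (y :: L).head? := by simpa using hx
          have hxU := (hmem x).1 (List.mem_of_head? hx')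
          rcases Finset.mem_insert.1 hw with rfl | hw
          exacts [hzo x (Finset.mem_insert_of_mem hxU), hh x hx' w hw]
      · intro x hx w hw
        have : x = z := by simpa using hx.symm
        subst this
        exact hzo w hw

theorem exists_list_junctions [Fintype V] {P : Finset (V × V)} {l : V → ℕ}
    (hl : ∀ p ∈ P, l p.1 < l p.2)
    (ho : ∀ p ∈ P, ∀ p' ∈ P, p.1 = p'.1 → p = p')
    (hi : ∀ p ∈ P, ∀ p' ∈ P, p.2 = p'.2 → p = p') :
    ∃ (L : List V) (J : Finset (V × V)), L.Nodup ∧ (∀ x, x ∈ L) ∧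
      (∀ p ∈ J, p.1 ∈ freeSet P true ∧ p.2 ∈ freeSet P false) ∧
      (∀ p ∈ J, ∀ p' ∈ J, p.1 = p'.1 → p = p') ∧
      (∀ p ∈ J, ∀ p' ∈ J, p.2 = p'.2 → p = p') ∧
      CycRel (fun x y => (x, y) ∈ P ∨ (x, y) ∈ J) L := by
  obtain ⟨L, hL, hmem, hch, hh, hla⟩ := exists_list_arcOrFree hl ho hi univ
  have hA : ∀ x y, ArcOrFree P univ x y →
      ((x, y) ∈ P ∨ x ∈ freeSet P true ∧ y ∈ freeSet P false) := by
    rintro x y (h | ⟨h1, h2⟩)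
    · exact Or.inl h
    · right
      simp only [freeSet, mem_filter, mem_univ, true_and]
      exact ⟨fun w => h1 w (mem_univ _), fun w => h2 w (mem_univ _)⟩
  refine ⟨L, univ.filter fun p => p.2 = L.formPerm p.1 ∧ p.1 ∈ freeSet P true ∧
    p.2 ∈ freeSet P false, hL, fun x => (hmem x).2 (mem_univ _), ?_, ?_, ?_, ?_, ?_⟩
  · intro p hp
    exact (mem_filter.1 hp).2.2
  · intro p hp p' hp' h
    have h1 := (mem_filter.1 hp).2.1
    have h2 := (mem_filter.1 hp').2.1
    exact Prod.ext h (by rw [h1, h2, h])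
  · intro p hp p' hp' h
    have h1 := (mem_filter.1 hp).2.1
    have h2 := (mem_filter.1 hp').2.1
    refine Prod.ext (L.formPerm.injective ?_) h
    rw [← h1, ← h2, h]
  · rw [List.isChain_iff_getElem] at hch ⊢
    intro i hi
    rcases hA _ _ (hch i hi) with h | h
    · exact Or.inl h
    · exact Or.inr (mem_filter.2 ⟨mem_univ _, (List.formPerm_apply_lt_getElem _ hL _ hi).symm, h⟩)
  · intro x hx y hy
    right
    have hne : L ≠ [] := by
      rintro rfl
      simp at hx
    obtain ⟨z, L', rfl⟩ := List.exists_cons_of_ne_nil hne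
    refine mem_filter.2 ⟨mem_univ _, ?_, ?_, ?_⟩
    · rw [List.getLast?_eq_getLast_of_ne_nil hne] at hx
      simp only [Option.mem_def, Option.some.injEq, List.head?_cons] at hx hy
      subst hx hy
      exact (List.formPerm_apply_getLast _ _).symm
    · simp only [freeSet, mem_filter, mem_univ, true_and]
      exact fun w => hla x hx w (mem_univ _)
    · simp only [freeSet, mem_filter, mem_univ, true_and]
      exact fun w => hh y hy w (mem_univ _)

end Linearise

section Rotation

variable {V : Type} [DecidableEq V]

theorem rotate_first {T : Set (Sym2 V)} {a b : V} {L : List V}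
    (hch : L.IsChain fun x y => s(x, y) ∈ T) (ha : L.head? = some a) (hb : L.getLast? = some b)
    {s u : ℕ} (hsu : s < u) (hu : u + 1 < L.length) :
    ∃ L' : List V, L'.Perm L ∧ CycRel (fun x y => s(x, y) ∈ T ∨ s(x, y) = s(b, L[s]) ∨
      s(x, y) = s(a, L[u]) ∨ s(x, y) = s(L[s + 1], L[u + 1])) L' := by
  have hR : ∀ x y : V, (s(x, y) ∈ T ∨ s(x, y) = s(b, L[s]) ∨
      s(x, y) = s(a, L[u]) ∨ s(x, y) = s(L[s + 1], L[u + 1])) → (s(y, x) ∈ T ∨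
      s(y, x) = s(b, L[s]) ∨ s(y, x) = s(a, L[u]) ∨ s(y, x) = s(L[s + 1], L[u + 1])) := by
    intro x y h
    rwa [Sym2.eq_swap (a := y)]
  have himp := hch.imp (S := fun x y => (s(x, y) ∈ T ∨ s(x, y) = s(b, L[s]) ∨
      s(x, y) = s(a, L[u]) ∨ s(x, y) = s(L[s + 1], L[u + 1]))) fun x y h => Or.inl h
  refine ⟨L.take (s + 1) ++ (L.drop (u + 1)).reverse ++ (L.drop (s + 1)).take (u - s), ?_,
    cycRel_append_reverse_append hR (himp.take _) ((himp.drop _).take _) (himp.drop _)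
      (x₁ := a) (y₁ := L[s]) (x₂ := L[s + 1]) (y₂ := L[u]) (x₃ := L[u + 1]) (y₃ := b)
      ?_ ?_ ?_ ?_ ?_ ?_ ?_ ?_ ?_⟩
  · have h1 : L.drop (u + 1) = (L.drop (s + 1)).drop (u - s) := by
      rw [List.drop_drop]
      congr 1
      omega
    rw [List.append_assoc]
    refine (List.Perm.append_left _ (?_ : List.Perm _ (L.drop (s + 1)))).trans
      (List.Perm.of_eq (List.take_append_drop _ _))
    refine (List.perm_append_comm).trans ?_
    refine (List.Perm.append_left _ (List.reverse_perm _)).trans ?_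
    rw [h1, List.take_append_drop]
  · rw [List.head?_take, if_neg (by omega), ha]
  · rw [List.getLast?_take, if_neg (by omega)]
    simp [List.getElem?_eq_getElem (show s < L.length by omega)]
  · rw [List.head?_take, if_neg (by omega), List.head?_drop, List.getElem?_eq_getElem]
  · rw [List.getLast?_take, if_neg (by omega), List.getElem?_drop,
      show s + 1 + (u - s - 1) = u by omega, List.getElem?_eq_getElem (show u < L.length by omega)]
    rfl
  · rw [List.head?_drop, List.getElem?_eq_getElem]
  · rw [List.getLast?_drop, if_neg (by omega), hb]
  · right; left
    exact Sym2.eq_swap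
  · right; right; right
    exact Sym2.eq_swap
  · right; right; left
    exact Sym2.eq_swap

theorem rotate_second {T : Set (Sym2 V)} {a b : V} {L : List V}
    (hch : L.IsChain fun x y => s(x, y) ∈ T) (ha : L.head? = some a) (hb : L.getLast? = some b)
    {s u : ℕ} (hsu : s < u) (hu : u + 1 < L.length) :
    ∃ L' : List V, L'.Perm L ∧ CycRel (fun x y => s(x, y) ∈ T ∨ s(x, y) = s(a, L[s + 1]) ∨
      s(x, y) = s(b, L[u]) ∨ s(x, y) = s(L[s], L[u + 1])) L' := by
  have hR : ∀ x y : V, (s(x, y) ∈ T ∨ s(x, y) = s(a, L[s + 1]) ∨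
      s(x, y) = s(b, L[u]) ∨ s(x, y) = s(L[s], L[u + 1])) → (s(y, x) ∈ T ∨
      s(y, x) = s(a, L[s + 1]) ∨ s(y, x) = s(b, L[u]) ∨ s(y, x) = s(L[s], L[u + 1])) := by
    intro x y h
    rwa [Sym2.eq_swap (a := y)]
  have himp := hch.imp (S := fun x y => (s(x, y) ∈ T ∨ s(x, y) = s(a, L[s + 1]) ∨
      s(x, y) = s(b, L[u]) ∨ s(x, y) = s(L[s], L[u + 1]))) fun x y h => Or.inl h
  refine ⟨(L.take (s + 1)).reverse ++ (L.drop (s + 1)).take (u - s) ++ (L.drop (u + 1)).reverse, ?_,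
    cycRel_reverse_append_reverse hR (himp.take _) ((himp.drop _).take _) (himp.drop _)
      (x₁ := a) (y₁ := L[s]) (x₂ := L[s + 1]) (y₂ := L[u]) (x₃ := L[u + 1]) (y₃ := b)
      ?_ ?_ ?_ ?_ ?_ ?_ ?_ ?_ ?_⟩
  · have h1 : L.drop (u + 1) = (L.drop (s + 1)).drop (u - s) := by
      rw [List.drop_drop]
      congr 1
      omega
    rw [List.append_assoc]
    refine (List.Perm.append (List.reverse_perm _) (?_ : List.Perm _ (L.drop (s + 1)))).trans
      (List.Perm.of_eq (List.take_append_drop _ _))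
    refine (List.Perm.append_left _ (List.reverse_perm _)).trans ?_
    rw [h1, List.take_append_drop]
  · rw [List.head?_take, if_neg (by omega), ha]
  · rw [List.getLast?_take, if_neg (by omega)]
    simp [List.getElem?_eq_getElem (show s < L.length by omega)]
  · rw [List.head?_take, if_neg (by omega), List.head?_drop, List.getElem?_eq_getElem]
  · rw [List.getLast?_take, if_neg (by omega), List.getElem?_drop,
      show s + 1 + (u - s - 1) = u by omega, List.getElem?_eq_getElem (show u < L.length by omega)]
    rfl
  · rw [List.head?_drop, List.getElem?_eq_getElem]
  · rw [List.getLast?_drop, if_neg (by omega), hb]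
  · right; left; rfl
  · right; right; left
    exact Sym2.eq_swap
  · right; right; right
    exact Sym2.eq_swap

theorem exists_half (Y : Finset ℕ) : ∃ h : ℕ, (Y.filter (· < h)).card = Y.card / 2 := by
  have h1 : ∀ m : ℕ, m ≤ Y.card → ∃ h : ℕ, (Y.filter (· < h)).card = m := by
    intro m hm
    by_contra hne
    push Not at hne
    have : ∀ h : ℕ, (Y.filter (· < h)).card < m := by
      intro h
      induction h with
      | zero =>
        have h0 := hne 0
        simp at h0 ⊢
        omega
      | succ h ih =>
        have h2 : (Y.filter (· < h + 1)).card ≤ (Y.filter (· < h)).card + 1 := by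
          refine (card_le_card (t := insert h (Y.filter (· < h))) ?_).trans (card_insert_le _ _)
          intro x hx
          simp only [mem_filter, mem_insert] at hx ⊢
          rcases Nat.lt_succ_iff_lt_or_eq.1 hx.2 with h3 | h3
          exacts [Or.inr ⟨hx.1, h3⟩, Or.inl h3]
        have := hne (h + 1)
        omega
    obtain ⟨N, hN⟩ := Y.exists_nat_subset_range
    have h3 := this N
    rw [filter_true_of_mem (fun x hx => mem_range.1 (hN hx))] at h3
    omega
  exact h1 _ (Nat.div_le_self _ _)

theorem card_le_card_filter_succ [Fintype V] {f : ℕ → V} {n : ℕ}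
    (hf : Set.InjOn f (Set.Iio n)) (N : Finset V) {Y : Finset ℕ} (hY : ∀ j ∈ Y, j < n) :
    Y.card ≤ (Y.filter fun j => j + 1 < n ∧ f (j + 1) ∈ N).card + Nᶜ.card + 1 := by
  have h1 : (Y.filter fun j => j + 1 < n ∧ f (j + 1) ∉ N).card ≤ Nᶜ.card := by
    refine card_le_card_of_injOn (fun j => f (j + 1)) ?_ ?_
    · intro j hj
      simpa using (mem_filter.1 hj).2.2
    · intro j hj j' hj' h
      have := hf (mem_filter.1 hj).2.1 (mem_filter.1 hj').2.1 h
      omega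
  have h2 : Y ⊆ (Y.filter fun j => j + 1 < n ∧ f (j + 1) ∈ N) ∪
      (Y.filter fun j => j + 1 < n ∧ f (j + 1) ∉ N) ∪ {n - 1} := by
    intro j hj
    have := hY j hj
    simp only [mem_union, mem_filter, mem_singleton, hj, true_and]
    by_cases h3 : f (j + 1) ∈ N <;> simp [h3] <;> omega
  have h3 := card_le_card h2
  have h4 := card_union_le ((Y.filter fun j => j + 1 < n ∧ f (j + 1) ∈ N) ∪
      (Y.filter fun j => j + 1 < n ∧ f (j + 1) ∉ N)) {n - 1}
  have h5 := card_union_le (Y.filter fun j => j + 1 < n ∧ f (j + 1) ∈ N)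
      (Y.filter fun j => j + 1 < n ∧ f (j + 1) ∉ N)
  rw [card_singleton] at h4
  omega

theorem card_le_card_filter_pred [Fintype V] {f : ℕ → V} {n : ℕ}
    (hf : Set.InjOn f (Set.Iio n)) (N : Finset V) {Y : Finset ℕ} (hY : ∀ j ∈ Y, j < n) :
    Y.card ≤ (Y.filter fun j => 0 < j ∧ f (j - 1) ∈ N).card + Nᶜ.card + 1 := by
  have h1 : (Y.filter fun j => 0 < j ∧ f (j - 1) ∉ N).card ≤ Nᶜ.card := by
    refine card_le_card_of_injOn (fun j => f (j - 1)) ?_ ?_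
    · intro j hj
      simpa using (mem_filter.1 hj).2.2
    · intro j hj j' hj' h
      have h1 := (mem_filter.1 hj).2.1
      have h2 := (mem_filter.1 hj').2.1
      have h3 := hY j (mem_filter.1 hj).1
      have h4 := hY j' (mem_filter.1 hj').1
      have := hf (show j - 1 < n by omega) (show j' - 1 < n by omega) h
      omega
  have h2 : Y ⊆ (Y.filter fun j => 0 < j ∧ f (j - 1) ∈ N) ∪
      (Y.filter fun j => 0 < j ∧ f (j - 1) ∉ N) ∪ {0} := by
    intro j hj
    have := hY j hj
    simp only [mem_union, mem_filter, mem_singleton, hj, true_and]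
    by_cases h3 : f (j - 1) ∈ N <;> simp [h3] <;> omega
  have h3 := card_le_card h2
  have h4 := card_union_le ((Y.filter fun j => 0 < j ∧ f (j - 1) ∈ N) ∪
      (Y.filter fun j => 0 < j ∧ f (j - 1) ∉ N)) {0}
  have h5 := card_union_le (Y.filter fun j => 0 < j ∧ f (j - 1) ∈ N)
      (Y.filter fun j => 0 < j ∧ f (j - 1) ∉ N)
  rw [card_singleton] at h4
  omega

/-- Closing a Hamilton path from `a` to `b` by exchanging edges: there are many choices of two
new neighbours `α s`, `β u` of the ends, each of which determines a third new edge. -/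
theorem exists_rotations [Fintype V] {T : Set (Sym2 V)} {a b : V} {L : List V} (hL : L.Nodup)
    (hmem : ∀ x, x ∈ L) (hch : L.IsChain fun x y => s(x, y) ∈ T) (ha : L.head? = some a)
    (hb : L.getLast? = some b) (N Xa Xb : Finset V) {M : ℕ} (hXa : M ≤ Xa.card)
    (hXb : M ≤ Xb.card) :
    ∃ (c d : V) (Xc Xd : Finset V) (A B : Finset ℕ) (α α' β β' : ℕ → V),
      ((c = b ∧ d = a ∧ Xc = Xb ∧ Xd = Xa) ∨ (c = a ∧ d = b ∧ Xc = Xa ∧ Xd = Xb)) ∧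
      M ≤ 2 * A.card + 2 * Nᶜ.card + 4 ∧ M ≤ 2 * B.card + 2 * Nᶜ.card + 4 ∧
      Set.InjOn α A ∧ Set.InjOn α' A ∧ Set.InjOn β B ∧ Set.InjOn β' B ∧
      (∀ s ∈ A, α s ∈ Xc ∧ α' s ∈ N) ∧ (∀ u ∈ B, β u ∈ Xd ∧ β' u ∈ N) ∧
      (∀ s ∈ A, ∀ u ∈ B, α s ≠ β u ∧ α' s ≠ β' u) ∧
      ∀ s ∈ A, ∀ u ∈ B, ∃ L' : List V, L'.Perm L ∧ CycRel (fun x y => s(x, y) ∈ T ∨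
        s(x, y) = s(c, α s) ∨ s(x, y) = s(d, β u) ∨ s(x, y) = s(α' s, β' u)) L' := by
  set n := L.length with hn
  set f : ℕ → V := fun j => L.getD j a with hf
  have hfj : ∀ j (hj : j < n), f j = L[j] := fun j hj => List.getD_eq_getElem _ _ hj
  have hinj : Set.InjOn f (Set.Iio n) := by
    intro j hj j' hj' h
    rw [hfj j hj, hfj j' hj'] at h
    exact (hL.getElem_inj_iff).1 h
  have hpre : ∀ X : Finset V, X.card ≤ ((range n).filter fun j => f j ∈ X).card := by
    intro X
    refine card_le_card_of_surjOn f ?_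
    intro x hx
    obtain ⟨j, hj, rfl⟩ := List.getElem_of_mem (hmem x)
    refine ⟨j, ?_, hfj j hj⟩
    simp only [coe_filter, mem_range, Set.mem_ofPred_eq, hfj j hj]
    exact ⟨hj, hx⟩
  set Ya := (range n).filter fun j => f j ∈ Xa with hYa
  set Yb := (range n).filter fun j => f j ∈ Xb with hYb
  have hYan : ∀ j ∈ Ya, j < n ∧ f j ∈ Xa := fun j hj => by simpa [hYa] using hj
  have hYbn : ∀ j ∈ Yb, j < n ∧ f j ∈ Xb := fun j hj => by simpa [hYb] using hj
  have hca : Xa.card ≤ Ya.card := hpre Xa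
  have hcb : Xb.card ≤ Yb.card := hpre Xb
  obtain ⟨h, hh⟩ := exists_half Yb
  have hb2 := card_filter_add_card_filter_not (s := Yb) (· < h)
  have ha2 := card_filter_add_card_filter_not (s := Ya) (· < h)
  have hne : ∀ j j', j < n → j' < n → j ≠ j' → f j ≠ f j' := fun j j' hj hj' h1 h2 =>
    h1 (hinj hj hj' h2)
  by_cases hcase : Ya.card ≤ 2 * (Ya.filter fun j => ¬ j < h).card
  · have hA := card_le_card_filter_succ hinj N (Y := Yb.filter (· < h))
      (fun j hj => (hYbn j (mem_filter.1 hj).1).1)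
    have hB := card_le_card_filter_succ hinj N (Y := Ya.filter fun j => ¬ j < h)
      (fun j hj => (hYan j (mem_filter.1 hj).1).1)
    set A := (Yb.filter (· < h)).filter fun j => j + 1 < n ∧ f (j + 1) ∈ N with hAdef
    set B := (Ya.filter fun j => ¬ j < h).filter fun j => j + 1 < n ∧ f (j + 1) ∈ N with hBdef
    have hAm : ∀ s ∈ A, f s ∈ Xb ∧ s < h ∧ s + 1 < n ∧ f (s + 1) ∈ N := by
      intro s hs
      simp only [hAdef, mem_filter] at hs
      exact ⟨(hYbn s hs.1.1).2, hs.1.2, hs.2⟩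
    have hBm : ∀ s ∈ B, f s ∈ Xa ∧ h ≤ s ∧ s + 1 < n ∧ f (s + 1) ∈ N := by
      intro s hs
      simp only [hBdef, mem_filter] at hs
      exact ⟨(hYan s hs.1.1).2, not_lt.1 hs.1.2, hs.2⟩
    refine ⟨b, a, Xb, Xa, A, B, f, fun s => f (s + 1), f, fun s => f (s + 1),
      Or.inl ⟨rfl, rfl, rfl, rfl⟩, by omega, by omega, ?_, ?_, ?_, ?_, ?_, ?_, ?_, ?_⟩
    · intro s hs s' hs' he
      have h1 := hAm s hs
      have h2 := hAm s' hs'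
      exact hinj (show s < n by omega) (show s' < n by omega) he
    · intro s hs s' hs' he
      have h1 := hAm s hs
      have h2 := hAm s' hs'
      have := hinj (show s + 1 < n by omega) (show s' + 1 < n by omega) he
      omega
    · intro s hs s' hs' he
      have h1 := hBm s hs
      have h2 := hBm s' hs'
      exact hinj (show s < n by omega) (show s' < n by omega) he
    · intro s hs s' hs' he
      have h1 := hBm s hs
      have h2 := hBm s' hs'
      have := hinj (show s + 1 < n by omega) (show s' + 1 < n by omega) he
      omega
    · exact fun s hs => ⟨(hAm s hs).1, (hAm s hs).2.2.2⟩
    · exact fun s hs => ⟨(hBm s hs).1, (hBm s hs).2.2.2⟩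
    · intro s hs u hu
      have h1 := hAm s hs
      have h2 := hBm u hu
      exact ⟨hne _ _ (by omega) (by omega) (by omega), hne _ _ (by omega) (by omega) (by omega)⟩
    · intro s hs u hu
      have h1 := hAm s hs
      have h2 := hBm u hu
      have := rotate_first hch ha hb (show s < u by omega) h2.2.2.1
      rwa [← hfj, ← hfj, ← hfj, ← hfj] at this
  · have hA := card_le_card_filter_pred hinj N (Y := Ya.filter (· < h))
      (fun j hj => (hYan j (mem_filter.1 hj).1).1)
    have hB := card_le_card_filter_succ hinj N (Y := Yb.filter fun j => ¬ j < h)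
      (fun j hj => (hYbn j (mem_filter.1 hj).1).1)
    set A := (Ya.filter (· < h)).filter fun j => 0 < j ∧ f (j - 1) ∈ N with hAdef
    set B := (Yb.filter fun j => ¬ j < h).filter fun j => j + 1 < n ∧ f (j + 1) ∈ N with hBdef
    have hAm : ∀ s ∈ A, f s ∈ Xa ∧ s < h ∧ s < n ∧ 0 < s ∧ f (s - 1) ∈ N := by
      intro s hs
      simp only [hAdef, mem_filter] at hs
      exact ⟨(hYan s hs.1.1).2, hs.1.2, (hYan s hs.1.1).1, hs.2⟩
    have hBm : ∀ s ∈ B, f s ∈ Xb ∧ h ≤ s ∧ s + 1 < n ∧ f (s + 1) ∈ N := by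
      intro s hs
      simp only [hBdef, mem_filter] at hs
      exact ⟨(hYbn s hs.1.1).2, not_lt.1 hs.1.2, hs.2⟩
    refine ⟨a, b, Xa, Xb, A, B, f, fun s => f (s - 1), f, fun s => f (s + 1),
      Or.inr ⟨rfl, rfl, rfl, rfl⟩, by omega, by omega, ?_, ?_, ?_, ?_, ?_, ?_, ?_, ?_⟩
    · intro s hs s' hs' he
      have h1 := hAm s hs
      have h2 := hAm s' hs'
      exact hinj (show s < n by omega) (show s' < n by omega) he
    · intro s hs s' hs' he
      have h1 := hAm s hs
      have h2 := hAm s' hs'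
      have := hinj (show s - 1 < n by omega) (show s' - 1 < n by omega) he
      omega
    · intro s hs s' hs' he
      have h1 := hBm s hs
      have h2 := hBm s' hs'
      exact hinj (show s < n by omega) (show s' < n by omega) he
    · intro s hs s' hs' he
      have h1 := hBm s hs
      have h2 := hBm s' hs'
      have := hinj (show s + 1 < n by omega) (show s' + 1 < n by omega) he
      omega
    · exact fun s hs => ⟨(hAm s hs).1, (hAm s hs).2.2.2.2⟩
    · exact fun s hs => ⟨(hBm s hs).1, (hBm s hs).2.2.2⟩
    · intro s hs u hu
      have h1 := hAm s hs
      have h2 := hBm u hu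
      exact ⟨hne _ _ (by omega) (by omega) (by omega), hne _ _ (by omega) (by omega) (by omega)⟩
    · intro s hs u hu
      have h1 := hAm s hs
      have h2 := hBm u hu
      obtain ⟨s, rfl⟩ : ∃ s', s = s' + 1 := ⟨s - 1, by omega⟩
      have := rotate_second hch ha hb (show s < u by omega) h2.2.2.1
      rwa [← hfj, ← hfj, ← hfj, ← hfj] at this

end Rotation

section Options

variable {V C : Type} [Fintype V] [DecidableEq V] [DecidableEq C]

/-- The number of edges at `b` and `v`, respectively, which share their colour. -/
def sharedColours (φ : Sym2 V → C) (b v : V) : ℝ :=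
  ∑ x ∈ univ.filter (· ≠ b), (dc φ (φ s(b, x)) v : ℝ)

/-- The number of edges at `v` whose colour appears on `F`. -/
def colourLoss (φ : Sym2 V → C) (F : Finset (Sym2 V)) (v : V) : ℝ :=
  ∑ c ∈ F.image φ, (dc φ c v : ℝ)

theorem dc_eq_sum (φ : Sym2 V → C) (c : C) (v : V) :
    (dc φ c v : ℝ) = ∑ w ∈ univ.filter (· ≠ v), if φ s(v, w) = c then (1 : ℝ) else 0 := by
  rw [dc, ← filter_filter, card_filter]
  push_cast
  rfl

theorem sharedColours_eq (φ : Sym2 V → C) (b v : V) :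
    sharedColours φ b v = ∑ w ∈ univ.filter (· ≠ v), (dc φ (φ s(v, w)) b : ℝ) := by
  simp_rw [sharedColours, dc_eq_sum]
  rw [sum_comm]
  refine sum_congr rfl fun x _ => sum_congr rfl fun y _ => ?_
  simp only [eq_comm]

theorem sharedColours_nonneg (φ : Sym2 V → C) (b v : V) : 0 ≤ sharedColours φ b v :=
  sum_nonneg fun _ _ => Nat.cast_nonneg _

theorem colourLoss_insert_le (φ : Sym2 V → C) (F : Finset (Sym2 V)) (e : Sym2 V) (v : V) :
    colourLoss φ (insert e F) v ≤ dc φ (φ e) v + colourLoss φ F v := by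
  rw [colourLoss, image_insert]
  by_cases h : φ e ∈ F.image φ
  · rw [insert_eq_of_mem h]
    exact le_add_of_nonneg_left (Nat.cast_nonneg _)
  · rw [sum_insert h]
    rfl

theorem sum_sharedColours_le (φ : Sym2 V → C) (S : Finset V) (v : V) {g : ℝ} (hg0 : 0 ≤ g)
    (hg : ∀ c, ∑ b ∈ S, (dc φ c b : ℝ) ≤ g) :
    ∑ b ∈ S, sharedColours φ b v ≤ Fintype.card V * g := by
  simp_rw [sharedColours_eq]
  rw [sum_comm]
  refine (sum_le_sum fun w _ => hg _).trans ?_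
  rw [sum_const, nsmul_eq_mul]
  gcongr
  exact card_le_univ _

theorem sum_dc_end_le {φ : Sym2 V → C} {A B : Finset ℕ} {α β : ℕ → V} {c : V}
    (hα : Set.InjOn α A) (hβ : Set.InjOn β B) (hc : ∀ s ∈ A, α s ≠ c) (v : V) :
    ∑ s ∈ A, ∑ _u ∈ B, (dc φ (φ s(c, α s)) v : ℝ) ≤
      Fintype.card V * sharedColours φ c v := by
  have h1 : (B.card : ℝ) ≤ Fintype.card V := by
    rw [← card_image_of_injOn hβ]
    exact_mod_cast card_le_univ _
  have h2 : ∑ s ∈ A, (dc φ (φ s(c, α s)) v : ℝ) ≤ sharedColours φ c v := by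
    rw [← sum_image (f := fun x => (dc φ (φ s(c, x)) v : ℝ)) hα]
    refine sum_le_sum_of_subset_of_nonneg ?_ fun _ _ _ => Nat.cast_nonneg _
    intro x hx
    obtain ⟨s, hs, rfl⟩ := mem_image.1 hx
    simpa using hc s hs
  simp_rw [sum_const, nsmul_eq_mul]
  rw [← mul_sum]
  exact mul_le_mul h1 h2 (sum_nonneg fun _ _ => Nat.cast_nonneg _) (Nat.cast_nonneg _)

theorem sum_dc_mid_le {φ : Sym2 V → C} {A B : Finset ℕ} {α β : ℕ → V}
    (hα : Set.InjOn α A) (hβ : Set.InjOn β B) (hne : ∀ s ∈ A, ∀ u ∈ B, α s ≠ β u)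
    (hsum : ∀ c, ∑ v, (dc φ c v : ℝ) ≤ Fintype.card V) (v : V) :
    ∑ s ∈ A, ∑ u ∈ B, (dc φ (φ s(α s, β u)) v : ℝ) ≤
      (Fintype.card V : ℝ) * Fintype.card V := by
  refine le_trans ?_ (sum_sharedColours_le φ univ v (Nat.cast_nonneg _) hsum)
  calc ∑ s ∈ A, ∑ u ∈ B, (dc φ (φ s(α s, β u)) v : ℝ) ≤ ∑ s ∈ A, sharedColours φ (α s) v := by
        refine sum_le_sum fun s hs => ?_
        rw [← sum_image (f := fun x => (dc φ (φ s(α s, x)) v : ℝ)) hβ]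
        refine sum_le_sum_of_subset_of_nonneg ?_ fun _ _ _ => Nat.cast_nonneg _
        intro x hx
        obtain ⟨u, hu, rfl⟩ := mem_image.1 hx
        simpa using (hne s hs u hu).symm
    _ = ∑ x ∈ A.image α, sharedColours φ x v :=
        (sum_image (f := fun x => sharedColours φ x v) hα).symm
    _ ≤ _ := sum_le_sum_of_subset_of_nonneg (subset_univ _) fun _ _ _ => sharedColours_nonneg _ _ _

theorem exists_option_potential_le {φ : Sym2 V → C} {A B : Finset ℕ} {α α' β β' : ℕ → V}
    {c d : V} (hα : Set.InjOn α A) (hα' : Set.InjOn α' A) (hβ : Set.InjOn β B)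
    (hβ' : Set.InjOn β' B) (hc : ∀ s ∈ A, α s ≠ c) (hd : ∀ u ∈ B, β u ≠ d)
    (hne : ∀ s ∈ A, ∀ u ∈ B, α' s ≠ β' u)
    (hsum : ∀ c, ∑ v, (dc φ c v : ℝ) ≤ Fintype.card V) {Cl μ : ℝ} (hCl : 0 < Cl)
    (hdc : ∀ c v, (dc φ c v : ℝ) ≤ Cl) (hμ : 0 < μ) (hn : 0 < Fintype.card V)
    {O : Finset (ℕ × ℕ)} (hO : O ⊆ A ×ˢ B) (hOcard : μ * (Fintype.card V : ℝ) ^ 2 ≤ O.card)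
    (Λ : V → ℝ) :
    ∃ o ∈ O, ∑ v, Real.exp (Λ v + 1 / (3 * Cl) * (dc φ (φ s(c, α o.1)) v +
        dc φ (φ s(d, β o.2)) v + dc φ (φ s(α' o.1, β' o.2)) v)) ≤
      ∑ v, Real.exp (Λ v + 2 * (1 / (3 * Cl)) * (sharedColours φ c v + sharedColours φ d v +
        Fintype.card V) / (μ * Fintype.card V)) := by
  set n : ℝ := (Fintype.card V : ℝ) with hnV
  set θ : ℝ := 1 / (3 * Cl) with hθ
  have hn0 : 0 < n := by rw [hnV]; exact_mod_cast hn
  have hθ0 : 0 < θ := by rw [hθ]; positivity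
  have hO0 : (0 : ℝ) < O.card := lt_of_lt_of_le (by positivity) hOcard
  have hOne : O.Nonempty := by
    rw [← card_pos]
    exact_mod_cast hO0
  refine exists_le_of_sum_le hOne ?_
  rw [sum_comm, sum_const, nsmul_eq_mul, mul_sum]
  refine sum_le_sum fun v _ => ?_
  set X : ℕ × ℕ → ℝ := fun o => dc φ (φ s(c, α o.1)) v + dc φ (φ s(d, β o.2)) v +
    dc φ (φ s(α' o.1, β' o.2)) v with hX
  set Y : ℝ := sharedColours φ c v + sharedColours φ d v + n with hY
  have hX0 : ∀ o, 0 ≤ X o := fun o => by rw [hX]; positivity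
  have hXO : ∑ o ∈ O, X o ≤ n * Y := by
    refine (sum_le_sum_of_subset_of_nonneg hO fun o _ _ => hX0 o).trans ?_
    rw [sum_product, hX]
    simp only [sum_add_distrib]
    have h1 := sum_dc_end_le (φ := φ) hα hβ hc v
    have h2 := sum_dc_end_le (φ := φ) hβ hα hd v
    rw [sum_comm] at h2
    have h3 := sum_dc_mid_le hα' hβ' hne hsum v
    rw [hY]
    linarith
  have hexp : ∀ o, Real.exp (θ * X o) ≤ 1 + 2 * (θ * X o) := by
    intro o
    have h1 : X o ≤ 3 * Cl := by
      have h1 := hdc (φ s(c, α o.1)) v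
      have h2 := hdc (φ s(d, β o.2)) v
      have h3 := hdc (φ s(α' o.1, β' o.2)) v
      simp only [hX]
      linarith
    have h2 : θ * X o ≤ 1 := by
      rw [hθ, one_div, inv_mul_le_iff₀ (by positivity)]
      linarith
    have h3 : 0 ≤ θ * X o := mul_nonneg hθ0.le (hX0 o)
    have h4 := Real.abs_exp_sub_one_le (x := θ * X o) (by rwa [abs_of_nonneg h3])
    rw [abs_of_nonneg h3] at h4
    linarith [(abs_le.1 h4).2]
  have hY0 : 0 ≤ Y := by
    have h1 := sharedColours_nonneg φ c v
    have h2 := sharedColours_nonneg φ d v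
    rw [hY]
    positivity
  simp_rw [Real.exp_add]
  rw [← mul_sum, mul_left_comm]
  refine mul_le_mul_of_nonneg_left ?_ (Real.exp_pos _).le
  calc ∑ o ∈ O, Real.exp (θ * X o) ≤ ∑ o ∈ O, (1 + 2 * (θ * X o)) := sum_le_sum fun o _ => hexp o
    _ = O.card + 2 * θ * ∑ o ∈ O, X o := by
        rw [sum_add_distrib, sum_const, nsmul_eq_mul, mul_one, mul_sum]
        congr 1
        exact sum_congr rfl fun o _ => by ring
    _ ≤ O.card + 2 * θ * (n * Y) := by gcongr
    _ ≤ O.card * (1 + 2 * θ * Y / (μ * n)) := by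
        rw [mul_add (O.card : ℝ) 1, mul_one]
        refine add_le_add le_rfl ?_
        rw [mul_div_assoc' (O.card : ℝ), le_div_iff₀ (by positivity)]
        have := mul_le_mul_of_nonneg_right hOcard (show 0 ≤ 2 * θ * Y by positivity)
        nlinarith
    _ ≤ _ := by
        gcongr
        rw [add_comm]
        exact Real.add_one_le_exp _

end Options

section Counting

variable {V C : Type} [Fintype V] [DecidableEq V] [DecidableEq C]

theorem card_filter_edge_mem_le (E : Finset (Sym2 V)) (x : V) {B : Finset ℕ} {β : ℕ → V}
    (hβ : Set.InjOn β B) :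
    (B.filter fun u => s(x, β u) ∈ E).card ≤ (E.filter fun e => x ∈ e).card := by
  refine card_le_card_of_injOn (fun u => s(x, β u)) ?_ ?_
  · intro u hu
    have := (mem_filter.1 hu).2
    simpa using this
  · intro u hu u' hu' h
    exact hβ (mem_filter.1 hu).1 (mem_filter.1 hu').1 (Sym2.congr_right.1 h)

theorem card_filter_colour_eq_le (φ : Sym2 V → C) (c : C) (x : V) {B : Finset ℕ} {β : ℕ → V}
    (hβ : Set.InjOn β B) (hx : ∀ u ∈ B, β u ≠ x) :
    (B.filter fun u => φ s(x, β u) = c).card ≤ dc φ c x := by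
  refine card_le_card_of_injOn β ?_ ?_
  · intro u hu
    have := mem_filter.1 hu
    simpa using ⟨hx u this.1, this.2⟩
  · exact fun u hu u' hu' h => hβ (mem_filter.1 hu).1 (mem_filter.1 hu').1 h

theorem card_filter_colour_mem_le (φ : Sym2 V → C) (F : Finset (Sym2 V)) (x : V) {B : Finset ℕ}
    {β : ℕ → V} (hβ : Set.InjOn β B) (hx : ∀ u ∈ B, β u ≠ x) :
    ((B.filter fun u => φ s(x, β u) ∈ F.image φ).card : ℝ) ≤ colourLoss φ F x := by
  have : (B.filter fun u => φ s(x, β u) ∈ F.image φ) =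
      (F.image φ).biUnion fun c => B.filter fun u => φ s(x, β u) = c := by
    ext u
    simp only [mem_filter, mem_biUnion]
    constructor
    · rintro ⟨h1, h2⟩
      exact ⟨_, h2, h1, rfl⟩
    · rintro ⟨c, h2, h1, rfl⟩
      exact ⟨h1, h2⟩
  rw [this, colourLoss]
  refine (Nat.cast_le.2 card_biUnion_le).trans ?_
  push_cast
  exact sum_le_sum fun c _ => Nat.cast_le.2 (card_filter_colour_eq_le φ c x hβ hx)

theorem card_filter_product_le {A B : Finset ℕ} (p : ℕ → ℕ → Prop) [∀ s u, Decidable (p s u)]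
    {a b : ℝ} (hb : 0 ≤ b) (hA : (A.card : ℝ) ≤ a)
    (h : ∀ s ∈ A, ((B.filter fun u => p s u).card : ℝ) ≤ b) :
    (((A ×ˢ B).filter fun o => p o.1 o.2).card : ℝ) ≤ a * b := by
  rw [card_filter, sum_product]
  push_cast
  calc ∑ s ∈ A, ∑ u ∈ B, (if p s u then (1 : ℝ) else 0) ≤ ∑ _s ∈ A, b := by
        refine sum_le_sum fun s hs => ?_
        have := h s hs
        rw [card_filter] at this
        push_cast at this
        exact this
    _ ≤ a * b := by
        rw [sum_const, nsmul_eq_mul]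
        gcongr

theorem card_filter_product_le_swap {A B : Finset ℕ} (p : ℕ → ℕ → Prop)
    [∀ s u, Decidable (p s u)] {a b : ℝ} (hb : 0 ≤ b) (hB : (B.card : ℝ) ≤ a)
    (h : ∀ u ∈ B, ((A.filter fun s => p s u).card : ℝ) ≤ b) :
    (((A ×ˢ B).filter fun o => p o.1 o.2).card : ℝ) ≤ a * b := by
  refine le_trans ?_ (card_filter_product_le (fun u s => p s u) hb hB h)
  refine Nat.cast_le.2 (card_le_card_of_injOn Prod.swap ?_ Prod.swap_injective.injOn)
  intro o ho
  have := mem_filter.1 ho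
  have h2 := mem_product.1 this.1
  simp [h2.1, h2.2, this.2]

/-- The exchanges all of whose new edges are admissible. -/
def options (φ : Sym2 V → C) (Q : Finset C) (E F : Finset (Sym2 V)) (A B : Finset ℕ)
    (α α' β β' : ℕ → V) (c d : V) : Finset (ℕ × ℕ) :=
  (A ×ˢ B).filter fun o => φ s(α' o.1, β' o.2) ∈ Q ∧ s(α' o.1, β' o.2) ∉ E ∧
    φ s(α' o.1, β' o.2) ∉ F.image φ ∧ φ s(α' o.1, β' o.2) ≠ φ s(c, α o.1) ∧
    φ s(α' o.1, β' o.2) ≠ φ s(d, β o.2) ∧ φ s(d, β o.2) ≠ φ s(c, α o.1)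

theorem le_card_options {φ : Sym2 V → C} {Q : Finset C} {E F : Finset (Sym2 V)} {A B : Finset ℕ}
    {α α' β β' : ℕ → V} {c d : V} (hα' : Set.InjOn α' A) (hβ : Set.InjOn β B)
    (hβ' : Set.InjOn β' B) (hd : ∀ u ∈ B, β u ≠ d) (hne : ∀ s ∈ A, ∀ u ∈ B, α' s ≠ β' u)
    {q g U Lm Cl : ℝ} (hU : 0 ≤ U) (hLm : 0 ≤ Lm) (hCl : 0 ≤ Cl)
    (hqr : ∀ S : Finset V, ((univ.filter fun w => (rdeg φ Q w S : ℝ) < q * S.card - g).card : ℝ) ≤ g)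
    (hdc : ∀ c v, (dc φ c v : ℝ) ≤ Cl)
    (hE : ∀ s ∈ A, ((E.filter fun e => α' s ∈ e).card : ℝ) ≤ U)
    (hF : ∀ s ∈ A, colourLoss φ F (α' s) ≤ Lm) (hB : g ≤ q * B.card) :
    (A.card - g) * (q * B.card - g) - Fintype.card V * (U + Lm + 3 * Cl) ≤
      ((options φ Q E F A B α α' β β' c d).card : ℝ) := by
  set n : ℝ := (Fintype.card V : ℝ) with hn
  have hAn : (A.card : ℝ) ≤ n := by
    rw [← card_image_of_injOn hα']
    exact Nat.cast_le.2 (card_le_univ _)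
  have hBn : (B.card : ℝ) ≤ n := by
    rw [← card_image_of_injOn hβ]
    exact Nat.cast_le.2 (card_le_univ _)
  have hG : (A.card - g) * (q * B.card - g) ≤
      (((A ×ˢ B).filter fun o => φ s(α' o.1, β' o.2) ∈ Q).card : ℝ) := by
    set A' := A.filter fun s => q * (B.image β').card - g ≤ (rdeg φ Q (α' s) (B.image β') : ℝ)
      with hA'
    have h1 : (A.card : ℝ) - g ≤ A'.card := by
      have h2 := card_filter_add_card_filter_not (s := A)
        (fun s => q * (B.image β').card - g ≤ (rdeg φ Q (α' s) (B.image β') : ℝ))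
      have h3 : ((A.filter fun s => ¬ (q * (B.image β').card - g ≤
          (rdeg φ Q (α' s) (B.image β') : ℝ))).card : ℝ) ≤ g := by
        refine le_trans (Nat.cast_le.2 (card_le_card_of_injOn α' ?_ ?_)) (hqr (B.image β'))
        · intro s hs
          exact mem_coe.2 (mem_filter.2 ⟨mem_univ _, not_le.1 (mem_filter.1 hs).2⟩)
        · exact fun s hs s' hs' h => hα' (mem_filter.1 hs).1 (mem_filter.1 hs').1 h
      have h4 : (A.card : ℝ) = A'.card + ((A.filter fun s => ¬ (q * (B.image β').card - g ≤
          (rdeg φ Q (α' s) (B.image β') : ℝ))).card : ℝ) := by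
        rw [← h2]
        push_cast
        rfl
      linarith
    calc (A.card - g) * (q * B.card - g) ≤ A'.card * (q * B.card - g) := by
          gcongr
      _ = ∑ s ∈ A', (q * B.card - g) := by rw [sum_const, nsmul_eq_mul]
      _ ≤ ∑ s ∈ A', ((B.filter fun u => φ s(α' s, β' u) ∈ Q).card : ℝ) := by
          refine sum_le_sum fun s hs => ?_
          have h1 := (mem_filter.1 hs).2
          rw [card_image_of_injOn hβ'] at h1
          refine h1.trans (Nat.cast_le.2 ?_)
          rw [rdeg]
          refine card_le_card_of_surjOn β' ?_
          intro x hx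
          simp only [coe_filter, mem_image, Set.mem_ofPred_eq] at hx
          obtain ⟨⟨u, hu, rfl⟩, -, hx⟩ := hx
          exact ⟨u, by simp [hu, hx], rfl⟩
      _ ≤ ∑ s ∈ A, ((B.filter fun u => φ s(α' s, β' u) ∈ Q).card : ℝ) :=
          sum_le_sum_of_subset_of_nonneg (filter_subset _ _) fun _ _ _ => Nat.cast_nonneg _
      _ = _ := by
          rw [card_filter, sum_product]
          push_cast
          refine sum_congr rfl fun s _ => ?_
          rw [card_filter]
          push_cast
          rfl
  have b1 := card_filter_product_le (A := A) (B := B) (fun s u => s(α' s, β' u) ∈ E) hU hAn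
    fun s hs => (Nat.cast_le.2 (card_filter_edge_mem_le E (α' s) hβ')).trans (hE s hs)
  have b2 := card_filter_product_le (A := A) (B := B) (fun s u => φ s(α' s, β' u) ∈ F.image φ)
    hLm hAn fun s hs =>
      (card_filter_colour_mem_le φ F (α' s) hβ' fun u hu => (hne s hs u hu).symm).trans (hF s hs)
  have b3 := card_filter_product_le (A := A) (B := B)
    (fun s u => φ s(α' s, β' u) = φ s(c, α s)) hCl hAn fun s hs =>
      (Nat.cast_le.2 (card_filter_colour_eq_le φ _ (α' s) hβ'
        fun u hu => (hne s hs u hu).symm)).trans (hdc _ _)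
  have b4 := card_filter_product_le_swap (A := A) (B := B)
    (fun s u => φ s(β' u, α' s) = φ s(d, β u)) hCl hBn fun u hu =>
      (Nat.cast_le.2 (card_filter_colour_eq_le φ _ (β' u) hα'
        fun s hs => hne s hs u hu)).trans (hdc _ _)
  have b5 := card_filter_product_le (A := A) (B := B)
    (fun s u => φ s(d, β u) = φ s(c, α s)) hCl hAn fun s hs =>
      (Nat.cast_le.2 (card_filter_colour_eq_le φ _ d hβ hd)).trans (hdc _ _)
  set G := (A ×ˢ B).filter fun o => φ s(α' o.1, β' o.2) ∈ Q
  set B1 := (A ×ˢ B).filter fun o => s(α' o.1, β' o.2) ∈ E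
  set B2 := (A ×ˢ B).filter fun o => φ s(α' o.1, β' o.2) ∈ F.image φ
  set B3 := (A ×ˢ B).filter fun o => φ s(α' o.1, β' o.2) = φ s(c, α o.1)
  set B4 := (A ×ˢ B).filter fun o => φ s(β' o.2, α' o.1) = φ s(d, β o.2)
  set B5 := (A ×ˢ B).filter fun o => φ s(d, β o.2) = φ s(c, α o.1)
  have hsub : G ⊆ options φ Q E F A B α α' β β' c d ∪ (B1 ∪ (B2 ∪ (B3 ∪ (B4 ∪ B5)))) := by
    intro o ho
    have h1 := mem_filter.1 ho
    simp only [options, mem_union, mem_filter, B1, B2, B3, B4, B5, h1.1, true_and, h1.2,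
      Sym2.eq_swap (a := β' o.2)]
    tauto
  have hcard : G.card ≤ (options φ Q E F A B α α' β β' c d).card + (B1.card + (B2.card +
      (B3.card + (B4.card + B5.card)))) := by
    refine (card_le_card hsub).trans ((card_union_le _ _).trans (Nat.add_le_add_left ?_ _))
    refine (card_union_le _ _).trans (Nat.add_le_add_left ?_ _)
    refine (card_union_le _ _).trans (Nat.add_le_add_left ?_ _)
    exact (card_union_le _ _).trans (Nat.add_le_add_left (card_union_le _ _) _)
  have hcard' : (G.card : ℝ) ≤ (options φ Q E F A B α α' β β' c d).card + (B1.card + (B2.card +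
      (B3.card + (B4.card + B5.card)))) := by exact_mod_cast hcard
  linarith

/-- Vertices `x` of `N` such that `b x` can be used as a new edge. -/
def available (φ : Sym2 V → C) (Q : Finset C) (E F : Finset (Sym2 V)) (N : Finset V) (b : V) :
    Finset V :=
  univ.filter fun x => x ≠ b ∧ φ s(b, x) ∈ Q ∧ s(b, x) ∉ E ∧ φ s(b, x) ∉ F.image φ ∧ x ∈ N

theorem rdeg_le_card_available (φ : Sym2 V → C) (Q : Finset C) (E F : Finset (Sym2 V))
    (N : Finset V) (b : V) :
    (rdeg φ Q b univ : ℝ) ≤ (available φ Q E F N b).card + ((E.filter fun e => b ∈ e).card +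
      (colourLoss φ F b + Nᶜ.card)) := by
  set B2 := univ.filter fun x => s(b, x) ∈ E
  set B3 := univ.filter fun x => x ≠ b ∧ φ s(b, x) ∈ F.image φ
  have h2 : B2.card ≤ (E.filter fun e => b ∈ e).card := by
    refine card_le_card_of_injOn (fun u => s(b, u)) ?_ ?_
    · intro u hu
      have := (mem_filter.1 hu).2
      simpa using this
    · exact fun u _ u' _ h => Sym2.congr_right.1 h
  have h3 : (B3.card : ℝ) ≤ colourLoss φ F b := by
    have : B3 = (F.image φ).biUnion fun c => univ.filter fun x => x ≠ b ∧ φ s(b, x) = c := by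
      ext x
      simp only [B3, mem_filter, mem_biUnion, mem_univ, true_and]
      constructor
      · rintro ⟨h1, h2⟩
        exact ⟨_, h2, h1, rfl⟩
      · rintro ⟨c, h2, h1, rfl⟩
        exact ⟨h1, h2⟩
    rw [this, colourLoss]
    refine (Nat.cast_le.2 card_biUnion_le).trans ?_
    push_cast
    exact le_rfl
  have hsub : (univ.filter fun v => v ≠ b ∧ φ s(b, v) ∈ Q) ⊆
      available φ Q E F N b ∪ (B2 ∪ (B3 ∪ Nᶜ)) := by
    intro x hx
    have h1 := (mem_filter.1 hx).2
    simp only [available, mem_union, mem_filter, B2, B3, mem_univ, true_and, mem_compl]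
    tauto
  have hcard : rdeg φ Q b univ ≤ (available φ Q E F N b).card + (B2.card + (B3.card +
      Nᶜ.card)) := by
    refine (card_le_card hsub).trans ((card_union_le _ _).trans (Nat.add_le_add_left ?_ _))
    exact (card_union_le _ _).trans (Nat.add_le_add_left (card_union_le _ _) _)
  have hcard' : (rdeg φ Q b univ : ℝ) ≤ (available φ Q E F N b).card + (B2.card + (B3.card +
      Nᶜ.card)) := by exact_mod_cast hcard
  have h2' : (B2.card : ℝ) ≤ (E.filter fun e => b ∈ e).card := by exact_mod_cast h2
  linarith

end Counting

section Step

variable {V C : Type} [Fintype V] [DecidableEq V] [DecidableEq C]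

/-- The underlying edges of a set of arcs. -/
def undirect (P : Finset (V × V)) : Finset (Sym2 V) := P.image fun p => s(p.1, p.2)

/-- The number of edges of `F` and ends of junctions of `J` at `v`. -/
def usage (F : Finset (Sym2 V)) (J : Finset (V × V)) (v : V) : ℕ :=
  (F.filter fun e => v ∈ e).card + ((J.filter fun p => p.1 = v).card +
    (J.filter fun p => p.2 = v).card)

/-- The contribution of the junctions of `J` to the exponent of the potential. -/
noncomputable def junctionWeight (φ : Sym2 V → C) (Cl μ : ℝ) (J : Finset (V × V)) (v : V) : ℝ :=
  ∑ p ∈ J, 2 * (1 / (3 * Cl)) * (sharedColours φ p.1 v + sharedColours φ p.2 v +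
    Fintype.card V) / (μ * Fintype.card V)

/-- The potential which keeps control of the colour losses. -/
noncomputable def potential (φ : Sym2 V → C) (Cl μ : ℝ) (F : Finset (Sym2 V)) (J : Finset (V × V)) : ℝ :=
  ∑ v, Real.exp (junctionWeight φ Cl μ J v + 1 / (3 * Cl) * colourLoss φ F v)

theorem undirect_subset_insert (J : Finset (V × V)) (p : V × V) {e : Sym2 V}
    (he : e ∈ undirect J) : e ∈ undirect (J.erase p) ∨ e = s(p.1, p.2) := by
  obtain ⟨p', hp', rfl⟩ := mem_image.1 he
  by_cases h : p' = p
  · exact Or.inr (by rw [h])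
  · exact Or.inl (mem_image.2 ⟨p', mem_erase.2 ⟨h, hp'⟩, rfl⟩)

theorem le_of_min_card {q τ n : ℝ} {X N A M : ℕ} (hq : 0 < q) (hq1 : q ≤ 1)
    (hτ : 2048 * τ = q ^ 3) (hn : 0 < n) (hX : (q - τ) * n - (τ * n + (τ * n + τ * n)) ≤ X)
    (hM : M = X) (hA : M ≤ 2 * A + 2 * N + 4) (hN : (N : ℝ) ≤ τ * n) (h4 : 4 ≤ τ * n) :
    q * n / 4 ≤ A := by
  subst hM
  have hA' : (M : ℝ) ≤ 2 * A + 2 * N + 4 := by exact_mod_cast hA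
  have h1 : q ^ 3 ≤ q := by
    have := pow_le_pow_of_le_one hq.le hq1 (show 1 ≤ 3 by norm_num)
    simpa using this
  have h2 : τ * n ≤ q * n / 2048 := by
    have : τ ≤ q / 2048 := by linarith
    have := mul_le_mul_of_nonneg_right this hn.le
    linarith
  have h3 : 0 < q * n := by positivity
  nlinarith

theorem options_numeric {q τ n A B Cl O : ℝ} (hq : 0 < q) (hq1 : q ≤ 1)
    (hτ : 2048 * τ = q ^ 3) (hn : 0 < n) (hA : q * n / 4 ≤ A) (hB : q * n / 4 ≤ B)
    (hCl : Cl ≤ τ * n)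
    (hO : (A - τ * n) * (q * B - τ * n) - n * (τ * n + τ * n + 3 * Cl) ≤ O) :
    16 * τ * n ^ 2 ≤ O := by
  have e : q ^ 3 = q * q ^ 2 := by ring
  have h1 : q ^ 3 ≤ q ^ 2 := pow_le_pow_of_le_one hq.le hq1 (by norm_num)
  have h1' : q ^ 2 ≤ q := by nlinarith
  have h2 : τ * n ≤ q * n / 8 := by
    have : τ ≤ q / 8 := by linarith
    have := mul_le_mul_of_nonneg_right this hn.le
    linarith
  have h3 : τ * n ≤ q ^ 2 * n / 8 := by
    have : τ ≤ q ^ 2 / 8 := by linarith [sq_nonneg q]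
    have := mul_le_mul_of_nonneg_right this hn.le
    linarith
  have h4 : q * n / 8 ≤ A - τ * n := by linarith
  have h5 : q ^ 2 * n / 8 ≤ q * B - τ * n := by
    have := mul_le_mul_of_nonneg_left hB hq.le
    nlinarith
  have h6 : q * n / 8 * (q ^ 2 * n / 8) ≤ (A - τ * n) * (q * B - τ * n) :=
    mul_le_mul h4 h5 (by positivity) (le_trans (by positivity) h4)
  have h7 : q * n / 8 * (q ^ 2 * n / 8) = 32 * τ * n ^ 2 := by
    have : q * n / 8 * (q ^ 2 * n / 8) = q ^ 3 * n ^ 2 / 64 := by ring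
    rw [this, ← hτ]
    ring
  have h8 : n * (τ * n + τ * n + 3 * Cl) ≤ 5 * τ * n ^ 2 := by
    have := mul_le_mul_of_nonneg_left hCl hn.le
    nlinarith
  have hτ0 : 0 < τ := by
    have : 0 < q ^ 3 := by positivity
    linarith
  have h9 : 0 ≤ τ * n ^ 2 := by positivity
  nlinarith

theorem usage_insert_le {F : Finset (Sym2 V)} {J : Finset (V × V)} {p : V × V} (hp : p ∈ J)
    {c d x y x' y' : V} (hcd : (c = p.1 ∧ d = p.2) ∨ (c = p.2 ∧ d = p.1)) {N : Finset V}
    (hx : x ∈ N) (hy : y ∈ N) (hx' : x' ∈ N) (hy' : y' ∈ N) (hxy : x ≠ y)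
    (v : V) :
    usage (insert s(c, x) (insert s(d, y) (insert s(x', y') F))) (J.erase p) v ≤
      usage F J v + if v ∈ N then 2 else 0 := by
  have hins : ∀ (G : Finset (Sym2 V)) (e : Sym2 V), ((insert e G).filter fun e => v ∈ e).card ≤
      (G.filter fun e => v ∈ e).card + if v ∈ e then 1 else 0 := by
    intro G e
    rw [filter_insert]
    split_ifs with h
    · exact card_insert_le _ _
    · rfl
  have hE1 : ∀ f : V × V → V, ((J.erase p).filter fun p' => f p' = v).card +
      (if f p = v then 1 else 0) ≤ (J.filter fun p' => f p' = v).card := by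
    intro f
    rw [filter_erase]
    split_ifs with h
    · have : p ∈ J.filter fun p' => f p' = v := mem_filter.2 ⟨hp, h⟩
      rw [card_erase_add_one this]
    · exact card_le_card (erase_subset _ _)
  have h1 := hins (insert s(d, y) (insert s(x', y') F)) s(c, x)
  have h2 := hins (insert s(x', y') F) s(d, y)
  have h3 := hins F s(x', y')
  have h4 := hE1 Prod.fst
  have h5 := hE1 Prod.snd
  simp only [Sym2.mem_iff] at h1 h2 h3
  have key : (if v = c ∨ v = x then 1 else 0) + (if v = d ∨ v = y then 1 else 0) +
      (if v = x' ∨ v = y' then 1 else 0) ≤ (if p.1 = v then 1 else 0) +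
      (if p.2 = v then 1 else 0) + if v ∈ N then 2 else 0 := by
    have hcd' : (if v = c then 1 else 0) + (if v = d then 1 else 0) =
        (if p.1 = v then 1 else 0) + (if p.2 = v then 1 else 0) := by
      rcases hcd with ⟨rfl, rfl⟩ | ⟨rfl, rfl⟩
      · simp only [eq_comm]
      · rw [add_comm]
        simp only [eq_comm]
    have hor : ∀ (P R : Prop) [Decidable P] [Decidable R],
        (if P ∨ R then 1 else 0) ≤ (if P then 1 else 0) + if R then 1 else 0 := by
      intro P R _ _
      by_cases hP : P <;> by_cases hR : R <;> simp [hP, hR]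
    have g1 := hor (v = c) (v = x)
    have g2 := hor (v = d) (v = y)
    by_cases hv : v ∈ N
    · have g4 : (if v = x then 1 else 0) + (if v = y then 1 else 0) ≤ 1 := by
        by_cases h6 : v = x
        · have : v ≠ y := fun h => hxy (h6.symm.trans h)
          simp [h6, hxy]
        · simp only [h6, if_false]
          split_ifs <;> omega
      have g5 : (if v = x' ∨ v = y' then 1 else 0) ≤ 1 := by split_ifs <;> omega
      rw [if_pos hv]
      omega
    · have n1 : v ≠ x := fun h => hv (h ▸ hx)
      have n2 : v ≠ y := fun h => hv (h ▸ hy)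
      have n3 : v ≠ x' := fun h => hv (h ▸ hx')
      have n4 : v ≠ y' := fun h => hv (h ▸ hy')
      simp only [n1, n2, n3, n4, or_false, if_false] at *
      omega
  unfold usage
  omega

set_option maxHeartbeats 1000000 in
theorem exists_step {φ : Sym2 V → C} {Q : Finset C} {q τ Cl : ℝ} (hq : 0 < q) (hq1 : q ≤ 1)
    (hτ : 2048 * τ = q ^ 3) (hn : 3 ≤ Fintype.card V) (h4 : 4 ≤ τ * Fintype.card V)
    (hCl : 0 < Cl) (hClτ : Cl ≤ τ * Fintype.card V) (hdc : ∀ c v, (dc φ c v : ℝ) ≤ Cl)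
    (hsum : ∀ c, ∑ v, (dc φ c v : ℝ) ≤ Fintype.card V)
    (hdeg : ∀ u, (q - τ) * Fintype.card V ≤ (rdeg φ Q u univ : ℝ))
    (hqr : ∀ S : Finset V, ((univ.filter fun w =>
      (rdeg φ Q w S : ℝ) < q * S.card - τ * Fintype.card V).card : ℝ) ≤ τ * Fintype.card V)
    {D E F : Finset (Sym2 V)} {J : Finset (V × V)} {L : List V} {N : Finset V}
    (hL : L.Nodup) (hmem : ∀ x, x ∈ L)
    (hcyc : CycRel (fun x y => s(x, y) ∈ D ∪ F ∪ undirect J) L)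
    (hFQ : ∀ e ∈ F, φ e ∈ Q) (hFd : ∀ e ∈ F, ¬ e.IsDiag) (hFi : Set.InjOn φ F)
    (hE : ∀ x, ((E.filter fun e => x ∈ e).card : ℝ) ≤ τ * Fintype.card V)
    (hF : ∀ x, colourLoss φ F x ≤ τ * Fintype.card V)
    (hN : ((Nᶜ.card : ℕ) : ℝ) ≤ τ * Fintype.card V) {p : V × V} (hp : p ∈ J) :
    ∃ (L' : List V) (F' : Finset (Sym2 V)), L'.Nodup ∧ (∀ x, x ∈ L') ∧
      CycRel (fun x y => s(x, y) ∈ D ∪ F' ∪ undirect (J.erase p)) L' ∧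
      (∀ e ∈ F', e ∈ F ∨ e ∉ E) ∧ (∀ e ∈ F', φ e ∈ Q) ∧ (∀ e ∈ F', ¬ e.IsDiag) ∧
      Set.InjOn φ F' ∧ F'.card ≤ F.card + 3 ∧
      potential φ Cl (16 * τ) F' (J.erase p) ≤ potential φ Cl (16 * τ) F J ∧
      ∀ v, usage F' (J.erase p) v ≤ usage F J v + if v ∈ N then 2 else 0 := by
  have hn0 : 0 < Fintype.card V := by omega
  have hnR : (0 : ℝ) < Fintype.card V := by exact_mod_cast hn0
  have hτ0 : 0 < τ := by
    have : 0 < q ^ 3 := by positivity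
    linarith
  have hlen : L.length = Fintype.card V := by
    have : L.toFinset = univ := by
      ext x
      simp [hmem x]
    rw [← List.toFinset_card_of_nodup hL, this, card_univ]
  have hJW : ∀ v, junctionWeight φ Cl (16 * τ) J v = junctionWeight φ Cl (16 * τ) (J.erase p) v +
      2 * (1 / (3 * Cl)) * (sharedColours φ p.1 v + sharedColours φ p.2 v +
    Fintype.card V) / (16 * τ * Fintype.card V) := by
    intro v
    rw [junctionWeight, ← add_sum_erase _ _ hp, add_comm]
    rfl
  have hterm : ∀ v, 0 ≤ 2 * (1 / (3 * Cl)) * (sharedColours φ p.1 v + sharedColours φ p.2 v +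
    Fintype.card V) / (16 * τ * Fintype.card V) := by
    intro v
    have h1 := sharedColours_nonneg φ p.1 v
    have h2 := sharedColours_nonneg φ p.2 v
    positivity
  have hcyc' : CycRel (fun x y => s(x, y) ∈ ((D ∪ F ∪ undirect (J.erase p) : Finset (Sym2 V)) :
      Set (Sym2 V)) ∨ s(x, y) = s(p.1, p.2)) L := by
    refine hcyc.imp_of_mem fun x _ y _ h => ?_
    rcases mem_union.1 h with h | h
    · exact Or.inl (mem_union_left _ h)
    · exact (undirect_subset_insert J p h).imp (fun h => mem_union_right _ h) id
  rcases cycRel_or_exists_closed hL (by omega) hcyc' with hdone | ⟨L₁, hperm, hch, ha, hb⟩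
  · refine ⟨L, F, hL, hmem, hdone, fun e he => Or.inl he, hFQ, hFd, hFi, by omega, ?_, ?_⟩
    · refine sum_le_sum fun v _ => Real.exp_le_exp.2 ?_
      have := hJW v
      have := hterm v
      linarith
    · intro v
      have h1 : ((J.erase p).filter fun p => p.1 = v).card ≤ (J.filter fun p => p.1 = v).card :=
        card_le_card (filter_subset_filter _ (erase_subset _ _))
      have h2 : ((J.erase p).filter fun p => p.2 = v).card ≤ (J.filter fun p => p.2 = v).card :=
        card_le_card (filter_subset_filter _ (erase_subset _ _))
      unfold usage
      omega
  have hL₁ : L₁.Nodup := hperm.nodup_iff.2 hL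
  have hmem₁ : ∀ x, x ∈ L₁ := fun x => hperm.mem_iff.2 (hmem x)
  set Xa := available φ Q E F N p.2 with hXa
  set Xb := available φ Q E F N p.1 with hXb
  have hXcard : ∀ x, (q - τ) * Fintype.card V - (τ * Fintype.card V + (τ * Fintype.card V +
      τ * Fintype.card V)) ≤ ((available φ Q E F N x).card : ℝ) := by
    intro x
    have h1 := rdeg_le_card_available φ Q E F N x
    have h2 := hdeg x
    have h3 := hE x
    have h5 := hF x
    linarith
  obtain ⟨c, d, Xc, Xd, A, B, α, α', β, β', hcase, hA, hB, hα, hα', hβ, hβ', hAX, hBX, hne, hrot⟩ :=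
    exists_rotations hL₁ hmem₁ hch ha hb N Xa Xb (M := min Xa.card Xb.card) (min_le_left _ _)
      (min_le_right _ _)
  have hMX : ∃ x, min Xa.card Xb.card = (available φ Q E F N x).card := by
    rcases min_choice Xa.card Xb.card with h | h
    exacts [⟨_, h⟩, ⟨_, h⟩]
  obtain ⟨x₀, hx₀⟩ := hMX
  have hAc : q * Fintype.card V / 4 ≤ (A.card : ℝ) :=
    le_of_min_card hq hq1 hτ hnR (hXcard x₀) hx₀ hA hN h4
  have hBc : q * Fintype.card V / 4 ≤ (B.card : ℝ) :=
    le_of_min_card hq hq1 hτ hnR (hXcard x₀) hx₀ hB hN h4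
  have hXc : Xc = available φ Q E F N c := by
    rcases hcase with ⟨rfl, -, rfl, -⟩ | ⟨rfl, -, rfl, -⟩ <;> rfl
  have hXd : Xd = available φ Q E F N d := by
    rcases hcase with ⟨-, rfl, -, rfl⟩ | ⟨-, rfl, -, rfl⟩ <;> rfl
  have hcd : (c = p.1 ∧ d = p.2) ∨ (c = p.2 ∧ d = p.1) :=
    hcase.imp (fun h => ⟨h.1, h.2.1⟩) (fun h => ⟨h.1, h.2.1⟩)
  rw [hXc] at hAX
  rw [hXd] at hBX
  have hAX' : ∀ s ∈ A, (α s ≠ c ∧ φ s(c, α s) ∈ Q ∧ s(c, α s) ∉ E ∧ φ s(c, α s) ∉ F.image φ ∧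
      α s ∈ N) ∧ α' s ∈ N := fun s hs =>
    ⟨(mem_filter.1 (hAX s hs).1).2, (hAX s hs).2⟩
  have hBX' : ∀ s ∈ B, (β s ≠ d ∧ φ s(d, β s) ∈ Q ∧ s(d, β s) ∉ E ∧ φ s(d, β s) ∉ F.image φ ∧
      β s ∈ N) ∧ β' s ∈ N := fun s hs =>
    ⟨(mem_filter.1 (hBX s hs).1).2, (hBX s hs).2⟩
  have hO := le_card_options (φ := φ) (Q := Q) (E := E) (F := F) (α := α) (c := c) hα' hβ hβ'
    (fun u hu => (hBX' u hu).1.1) (fun s hs u hu => (hne s hs u hu).2) (q := q)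
    (g := τ * Fintype.card V) (U := τ * Fintype.card V) (Lm := τ * Fintype.card V) (Cl := Cl)
    (by positivity) (by positivity) hCl.le hqr hdc (fun s _ => hE _) (fun s _ => hF _) (by
      have e : q ^ 3 = q * q ^ 2 := by ring
      have h1 : q ^ 3 ≤ q ^ 2 := pow_le_pow_of_le_one hq.le hq1 (by norm_num)
      have h2 : τ ≤ q ^ 2 / 4 := by linarith [sq_nonneg q]
      have h3 := mul_le_mul_of_nonneg_right h2 hnR.le
      have h5 := mul_le_mul_of_nonneg_left hBc hq.le
      nlinarith)
  have hOc := options_numeric hq hq1 hτ hnR hAc hBc hClτ hO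
  obtain ⟨o, ho, hpot⟩ := exists_option_potential_le hα hα' hβ hβ' (fun s hs => (hAX' s hs).1.1)
    (fun u hu => (hBX' u hu).1.1) (fun s hs u hu => (hne s hs u hu).2) hsum hCl hdc
    (show 0 < 16 * τ by positivity) hn0 
    (O := options φ Q E F A B α α' β β' c d) (filter_subset _ _) hOc
    (fun v => junctionWeight φ Cl (16 * τ) (J.erase p) v + 1 / (3 * Cl) * colourLoss φ F v)
  obtain ⟨s, u⟩ := o
  simp only [options, mem_filter, mem_product] at ho
  obtain ⟨⟨hs, hu⟩, o1, o2, o3, o4, o5, o6⟩ := ho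
  obtain ⟨⟨a1, a2, a3, a4, a5⟩, a6⟩ := hAX' s hs
  obtain ⟨⟨b1, b2, b3, b4, b5⟩, b6⟩ := hBX' u hu
  obtain ⟨n1, n2⟩ := hne s hs u hu
  obtain ⟨L₂, hL₂, hcyc₂⟩ := hrot s hs u hu
  have hperm₂ := hL₂.trans hperm
  refine ⟨L₂, insert s(c, α s) (insert s(d, β u) (insert s(α' s, β' u) F)),
    hperm₂.nodup_iff.2 hL, fun x => hperm₂.mem_iff.2 (hmem x), ?_, ?_, ?_, ?_, ?_, ?_, ?_, ?_⟩
  · refine hcyc₂.imp_of_mem fun x _ y _ h => ?_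
    simp only [mem_coe, mem_union, mem_insert] at h ⊢
    rcases h with ((h | h) | h) | h | h | h
    exacts [Or.inl (Or.inl h), Or.inl (Or.inr (Or.inr (Or.inr (Or.inr h)))), Or.inr h,
      Or.inl (Or.inr (Or.inl h)), Or.inl (Or.inr (Or.inr (Or.inl h))),
      Or.inl (Or.inr (Or.inr (Or.inr (Or.inl h))))]
  · intro e he
    simp only [mem_insert] at he
    rcases he with rfl | rfl | rfl | he
    exacts [Or.inr a3, Or.inr b3, Or.inr o2, Or.inl he]
  · intro e he
    simp only [mem_insert] at he
    rcases he with rfl | rfl | rfl | he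
    exacts [a2, b2, o1, hFQ e he]
  · intro e he
    simp only [mem_insert] at he
    rcases he with rfl | rfl | rfl | he
    exacts [fun h => a1 h.symm, fun h => b1 h.symm, n2, hFd e he]
  · have hins : ∀ (G : Finset (Sym2 V)) (e : Sym2 V), Set.InjOn φ G → φ e ∉ G.image φ →
        Set.InjOn φ (insert e G : Finset (Sym2 V)) := by
      intro G e hG he
      have he' : e ∉ (G : Set (Sym2 V)) := fun h => he (mem_image_of_mem _ h)
      rw [coe_insert, Set.injOn_insert he']
      exact ⟨hG, by simpa using he⟩
    refine hins _ _ (hins _ _ (hins _ _ hFi o3) ?_) ?_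
    · simp only [image_insert, mem_insert, not_or]
      exact ⟨fun h => o5 h.symm, b4⟩
    · simp only [image_insert, mem_insert, not_or]
      exact ⟨fun h => o6 h.symm, fun h => o4 h.symm, a4⟩
  · have h1 := card_insert_le s(c, α s) (insert s(d, β u) (insert s(α' s, β' u) F))
    have h2 := card_insert_le s(d, β u) (insert s(α' s, β' u) F)
    have h3 := card_insert_le s(α' s, β' u) F
    omega
  · refine le_trans (sum_le_sum fun v _ => Real.exp_le_exp.2 ?_) (hpot.trans
      (sum_le_sum fun v _ => Real.exp_le_exp.2 ?_))
    · have h1 := colourLoss_insert_le φ (insert s(d, β u) (insert s(α' s, β' u) F)) s(c, α s) v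
      have h2 := colourLoss_insert_le φ (insert s(α' s, β' u) F) s(d, β u) v
      have h3 := colourLoss_insert_le φ F s(α' s, β' u) v
      have h5 : 0 ≤ 1 / (3 * Cl) := by positivity
      have h6 := mul_le_mul_of_nonneg_left (h1.trans (add_le_add le_rfl (h2.trans
        (add_le_add le_rfl h3)))) h5
      simp only at h6 ⊢
      linarith
    · rw [hJW v]
      have : sharedColours φ c v + sharedColours φ d v =
          sharedColours φ p.1 v + sharedColours φ p.2 v := by
        rcases hcd with ⟨rfl, rfl⟩ | ⟨rfl, rfl⟩
        · rfl
        · exact add_comm _ _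
      rw [this]
      linarith
  · exact usage_insert_le hp hcd a5 b5 a6 b6 n1

end Step

section Merge

variable {V C ι : Type} [Fintype V] [DecidableEq V] [DecidableEq C] [Fintype ι] [DecidableEq ι]

theorem sum_usage_le (F : Finset (Sym2 V)) (J : Finset (V × V)) :
    ∑ v, usage F J v ≤ 2 * F.card + 2 * J.card := by
  have h1 : ∑ v, (F.filter fun e => v ∈ e).card ≤ 2 * F.card := by
    simp only [card_filter]
    rw [sum_comm, mul_comm]
    refine sum_le_card_nsmul _ _ _ fun e _ => ?_
    rw [← card_filter]
    induction e using Sym2.ind with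
    | _ x y =>
      have : (univ.filter fun v => v ∈ s(x, y)) ⊆ {x, y} := by
        intro v hv
        simpa using hv
      exact (card_le_card this).trans card_le_two
  have h2 : ∀ f : V × V → V, ∑ v, (J.filter fun p => f p = v).card = J.card := fun f =>
    (card_eq_sum_card_fiberwise (f := f) (t := univ) (fun _ _ => by simp)).symm
  have h3 := h2 Prod.fst
  have h4 := h2 Prod.snd
  simp only [usage, sum_add_distrib]
  omega

theorem colourLoss_le_of_potential_le {φ : Sym2 V → C} {Cl μ b : ℝ} (hCl : 0 < Cl) (hμ : 0 < μ)
    {F : Finset (Sym2 V)} {J : Finset (V × V)} (hn : 0 < Fintype.card V)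
    (h : potential φ Cl μ F J ≤ Fintype.card V * Real.exp b) (v : V) :
    colourLoss φ F v ≤ 3 * Cl * Real.log (Fintype.card V) + 3 * Cl * b := by
  have hnR : (0 : ℝ) < Fintype.card V := by exact_mod_cast hn
  have hJ : 0 ≤ junctionWeight φ Cl μ J v := by
    refine sum_nonneg fun p _ => ?_
    have h1 := sharedColours_nonneg φ p.1 v
    have h2 := sharedColours_nonneg φ p.2 v
    positivity
  have h1 : Real.exp (junctionWeight φ Cl μ J v + 1 / (3 * Cl) * colourLoss φ F v) ≤
      Real.exp (Real.log (Fintype.card V) + b) := by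
    rw [Real.exp_add (Real.log _), Real.exp_log hnR]
    refine le_trans ?_ h
    exact single_le_sum (f := fun v => Real.exp (junctionWeight φ Cl μ J v +
      1 / (3 * Cl) * colourLoss φ F v)) (fun _ _ => (Real.exp_pos _).le) (mem_univ v)
  have h2 : 1 / (3 * Cl) * colourLoss φ F v ≤ Real.log (Fintype.card V) + b := by
    linarith [Real.exp_le_exp.1 h1]
  have h3 := mul_le_mul_of_nonneg_left h2 (show 0 ≤ 3 * Cl by positivity)
  have h4 : 3 * Cl * (1 / (3 * Cl) * colourLoss φ F v) = colourLoss φ F v := by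
    field_simp
  linarith

/-- Cyclic orderings `L i` of the vertices whose consecutive pairs are given edges of `D i`, new
edges of `F i`, or junctions of `J i` which are yet to be replaced. -/
structure MergeState (φ : Sym2 V → C) (Q : Finset C) (Cl τ m b : ℝ) (D : ι → Finset (Sym2 V))
    (L : ι → List V) (F : ι → Finset (Sym2 V)) (J : ι → Finset (V × V)) : Prop where
  nodup : ∀ i, (L i).Nodup
  mem : ∀ i x, x ∈ L i
  cyc : ∀ i, CycRel (fun x y => s(x, y) ∈ D i ∪ F i ∪ undirect (J i)) (L i)
  col : ∀ i, ∀ e ∈ F i, φ e ∈ Q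
  diag : ∀ i, ∀ e ∈ F i, ¬ e.IsDiag
  inj : ∀ i, Set.InjOn φ (F i)
  disj : ∀ i j e, e ∈ F i → e ∈ F j → i = j
  card : ∀ i, ((F i).card : ℝ) + 3 * (J i).card ≤ m
  pot : ∀ i, potential φ Cl (16 * τ) (F i) (J i) ≤ Fintype.card V * Real.exp b
  use : ∀ v, ((∑ i, usage (F i) (J i) v : ℕ) : ℝ) ≤ τ * Fintype.card V

theorem card_compl_lightly_used_le {τ m : ℝ} (hτ : 0 < τ) (hn : 0 < Fintype.card V)
    {F : ι → Finset (Sym2 V)} {J : ι → Finset (V × V)}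
    (hcard : ∀ i, ((F i).card : ℝ) + 3 * (J i).card ≤ m) (hm0 : 0 ≤ m)
    (hι : (Fintype.card ι : ℝ) ≤ Fintype.card V / 2) (hm : 2 * m ≤ τ ^ 2 * Fintype.card V) :
    (((univ.filter fun v => 2 * ((∑ i, usage (F i) (J i) v : ℕ) : ℝ) ≤
      τ * Fintype.card V)ᶜ.card : ℕ) : ℝ) ≤ τ * Fintype.card V := by
  set n : ℝ := (Fintype.card V : ℝ) with hnV
  have hnR : 0 < n := by rw [hnV]; exact_mod_cast hn
  set B := (univ.filter fun v => 2 * ((∑ i, usage (F i) (J i) v : ℕ) : ℝ) ≤ τ * n)ᶜ with hB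
  have h1 : (B.card : ℝ) * (τ * n / 2) ≤ ∑ v, ((∑ i, usage (F i) (J i) v : ℕ) : ℝ) := by
    rw [← nsmul_eq_mul]
    refine (card_nsmul_le_sum B (fun v => ((∑ i, usage (F i) (J i) v : ℕ) : ℝ)) _ ?_).trans
      (sum_le_univ_sum_of_nonneg fun _ => Nat.cast_nonneg _)
    intro v hv
    simp only [hB, mem_compl, mem_filter, mem_univ, true_and, not_le] at hv
    linarith
  have h2 : ∑ v, ((∑ i, usage (F i) (J i) v : ℕ) : ℝ) ≤ Fintype.card ι * (2 * m) := by
    push_cast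
    rw [sum_comm, ← nsmul_eq_mul, ← card_univ]
    refine sum_le_card_nsmul _ _ _ fun i _ => ?_
    have h3 : ((∑ v, usage (F i) (J i) v : ℕ) : ℝ) ≤ ((2 * (F i).card + 2 * (J i).card : ℕ) : ℝ) :=
      Nat.cast_le.2 (sum_usage_le _ _)
    push_cast at h3
    have h4 := hcard i
    have h5 : (0 : ℝ) ≤ (J i).card := Nat.cast_nonneg _
    linarith
  have h3 : (Fintype.card ι : ℝ) * (2 * m) ≤ n / 2 * (τ ^ 2 * n) :=
    mul_le_mul hι hm (by positivity) (by positivity)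
  have h4 : (B.card : ℝ) * (τ * n / 2) ≤ τ * n * (τ * n / 2) := by
    have : τ * n * (τ * n / 2) = n / 2 * (τ ^ 2 * n) := by ring
    linarith
  exact le_of_mul_le_mul_right h4 (by positivity)

theorem card_filter_biUnion_mem_le (F : ι → Finset (Sym2 V)) (J : ι → Finset (V × V)) (v : V) :
    ((univ.biUnion F).filter fun e => v ∈ e).card ≤ ∑ i, usage (F i) (J i) v := by
  rw [filter_biUnion]
  refine card_biUnion_le.trans (sum_le_sum fun i _ => ?_)
  exact Nat.le_add_right _ _

variable {φ : Sym2 V → C} {Q : Finset C} {q τ Cl m b : ℝ}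

theorem MergeState.exists_step (hq : 0 < q) (hq1 : q ≤ 1)
    (hτ : 2048 * τ = q ^ 3) (hn : 3 ≤ Fintype.card V) (h4 : 4 ≤ τ * Fintype.card V)
    (hCl : 0 < Cl) (hClτ : Cl ≤ τ * Fintype.card V) (hdc : ∀ c v, (dc φ c v : ℝ) ≤ Cl)
    (hsum : ∀ c, ∑ v, (dc φ c v : ℝ) ≤ Fintype.card V)
    (hdeg : ∀ u, (q - τ) * Fintype.card V ≤ (rdeg φ Q u univ : ℝ))
    (hqr : ∀ S : Finset V, ((univ.filter fun w =>
      (rdeg φ Q w S : ℝ) < q * S.card - τ * Fintype.card V).card : ℝ) ≤ τ * Fintype.card V)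
    (hm0 : 0 ≤ m) (hι : (Fintype.card ι : ℝ) ≤ Fintype.card V / 2)
    (hm : 2 * m ≤ τ ^ 2 * Fintype.card V)
    (hb : 3 * Cl * Real.log (Fintype.card V) + 3 * Cl * b ≤ τ * Fintype.card V)
    {D : ι → Finset (Sym2 V)} {L : ι → List V} {F : ι → Finset (Sym2 V)}
    {J : ι → Finset (V × V)} (h : MergeState φ Q Cl τ m b D L F J) {i₀ : ι} {p : V × V}
    (hp : p ∈ J i₀) :
    ∃ L' F', MergeState φ Q Cl τ m b D L' F' (Function.update J i₀ ((J i₀).erase p)) := by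
  have hn0 : 0 < Fintype.card V := by omega
  have hτ0 : 0 < τ := by
    have : 0 < q ^ 3 := by positivity
    linarith
  obtain ⟨L', F', g1, g2, g3, g4, g5, g6, g7, g8, g9, g10⟩ :=
    RainbowHam.exists_step hq hq1 hτ hn h4 hCl hClτ hdc hsum hdeg hqr (E := univ.biUnion F)
      (h.nodup i₀) (h.mem i₀) (h.cyc i₀) (h.col i₀) (h.diag i₀) (h.inj i₀)
      (fun x => (Nat.cast_le.2 (card_filter_biUnion_mem_le F J x)).trans (h.use x))
      (fun x => (colourLoss_le_of_potential_le hCl (by positivity) hn0 (h.pot i₀) x).trans hb)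
      (card_compl_lightly_used_le hτ0 hn0 h.card hm0 hι hm) hp
  have hall : ∀ (R : ι → List V → Finset (Sym2 V) → Finset (V × V) → Prop),
      R i₀ L' F' ((J i₀).erase p) → (∀ i, R i (L i) (F i) (J i)) →
      ∀ i, R i (Function.update L i₀ L' i) (Function.update F i₀ F' i)
        (Function.update J i₀ ((J i₀).erase p) i) := by
    intro R h1 h2 i
    by_cases hi : i = i₀
    · subst hi
      simpa using h1
    · simpa [hi] using h2 i
  have hdis : ∀ j e, e ∈ F' → e ∈ F j → i₀ = j := by
    intro j e he hj
    rcases g4 e he with h' | h'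
    · exact h.disj _ _ e h' hj
    · exact absurd (mem_biUnion.2 ⟨j, mem_univ j, hj⟩) h'
  refine ⟨Function.update L i₀ L', Function.update F i₀ F',
    hall (fun _ L _ _ => L.Nodup) g1 h.nodup,
    hall (fun _ L _ _ => ∀ x, x ∈ L) g2 h.mem,
    hall (fun i L F J => CycRel (fun x y => s(x, y) ∈ D i ∪ F ∪ undirect J) L) g3 h.cyc,
    hall (fun _ _ F _ => ∀ e ∈ F, φ e ∈ Q) g5 h.col,
    hall (fun _ _ F _ => ∀ e ∈ F, ¬ e.IsDiag) g6 h.diag,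
    hall (fun _ _ F _ => Set.InjOn φ F) g7 h.inj, ?_,
    hall (fun _ _ F J => (F.card : ℝ) + 3 * J.card ≤ m) ?_ h.card,
    hall (fun _ _ F J => potential φ Cl (16 * τ) F J ≤ Fintype.card V * Real.exp b)
      (g9.trans (h.pot i₀)) h.pot, ?_⟩
  · intro i j e hi hj
    by_cases hi0 : i = i₀ <;> by_cases hj0 : j = i₀
    · exact hi0.trans hj0.symm
    · rw [hi0, Function.update_self] at hi
      rw [Function.update_of_ne hj0] at hj
      exact hi0.trans (hdis j e hi hj)
    · rw [hj0, Function.update_self] at hj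
      rw [Function.update_of_ne hi0] at hi
      exact (hj0.trans (hdis i e hj hi)).symm
    · rw [Function.update_of_ne hi0] at hi
      rw [Function.update_of_ne hj0] at hj
      exact h.disj i j e hi hj
  · have h1 := h.card i₀
    have h2 : ((J i₀).erase p).card + 1 = (J i₀).card := card_erase_add_one hp
    have h3 : (((J i₀).erase p).card : ℝ) + 1 = (J i₀).card := by exact_mod_cast h2
    have h4 : (F'.card : ℝ) ≤ (F i₀).card + 3 := by exact_mod_cast g8
    linarith
  · intro v
    have hs : ∀ G : ι → ℕ, ∑ i, G i = G i₀ + ∑ i ∈ univ.erase i₀, G i := fun G =>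
      (add_sum_erase _ _ (mem_univ _)).symm
    have hrest : ∑ i ∈ univ.erase i₀, usage (Function.update F i₀ F' i)
        (Function.update J i₀ ((J i₀).erase p) i) v =
        ∑ i ∈ univ.erase i₀, usage (F i) (J i) v := by
      refine sum_congr rfl fun i hi => ?_
      have := ne_of_mem_erase hi
      simp [this]
    have hu := h.use v
    have hv := g10 v
    rw [hs] at hu ⊢
    rw [hrest]
    simp only [Function.update_self]
    split_ifs at hv with hN
    · rw [mem_filter, hs] at hN
      have hN := hN.2
      have : ((usage F' ((J i₀).erase p) v + ∑ i ∈ univ.erase i₀, usage (F i) (J i) v : ℕ) : ℝ) ≤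
          ((usage (F i₀) (J i₀) v + ∑ i ∈ univ.erase i₀, usage (F i) (J i) v : ℕ) : ℝ) + 2 := by
        have h5 : usage F' ((J i₀).erase p) v + ∑ i ∈ univ.erase i₀, usage (F i) (J i) v ≤
          (usage (F i₀) (J i₀) v + ∑ i ∈ univ.erase i₀, usage (F i) (J i) v) + 2 := by omega
        exact_mod_cast h5
      linarith
    · refine le_trans (Nat.cast_le.2 ?_) hu
      omega

theorem MergeState.exists_finished (hq : 0 < q) (hq1 : q ≤ 1)
    (hτ : 2048 * τ = q ^ 3) (hn : 3 ≤ Fintype.card V) (h4 : 4 ≤ τ * Fintype.card V)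
    (hCl : 0 < Cl) (hClτ : Cl ≤ τ * Fintype.card V) (hdc : ∀ c v, (dc φ c v : ℝ) ≤ Cl)
    (hsum : ∀ c, ∑ v, (dc φ c v : ℝ) ≤ Fintype.card V)
    (hdeg : ∀ u, (q - τ) * Fintype.card V ≤ (rdeg φ Q u univ : ℝ))
    (hqr : ∀ S : Finset V, ((univ.filter fun w =>
      (rdeg φ Q w S : ℝ) < q * S.card - τ * Fintype.card V).card : ℝ) ≤ τ * Fintype.card V)
    (hm0 : 0 ≤ m) (hι : (Fintype.card ι : ℝ) ≤ Fintype.card V / 2)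
    (hm : 2 * m ≤ τ ^ 2 * Fintype.card V)
    (hb : 3 * Cl * Real.log (Fintype.card V) + 3 * Cl * b ≤ τ * Fintype.card V)
    {D : ι → Finset (Sym2 V)} (k : ℕ) : ∀ {L : ι → List V} {F : ι → Finset (Sym2 V)}
    {J : ι → Finset (V × V)}, MergeState φ Q Cl τ m b D L F J → ∑ i, (J i).card = k →
    ∃ L' F', MergeState φ Q Cl τ m b D L' F' fun _ => ∅ := by
  induction k with
  | zero =>
    intro L F J h hJ
    have : J = fun _ => ∅ := by
      funext i
      exact card_eq_zero.1 (sum_eq_zero_iff.1 hJ i (mem_univ i))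
    exact ⟨L, F, this ▸ h⟩
  | succ k ih =>
    intro L F J h hJ
    have : ∃ i, (J i).Nonempty := by
      by_contra hc
      simp only [not_exists, not_nonempty_iff_eq_empty] at hc
      simp [hc] at hJ
    obtain ⟨i₀, p, hp⟩ := this
    obtain ⟨L', F', h'⟩ := h.exists_step hq hq1 hτ hn h4 hCl hClτ hdc hsum hdeg hqr hm0 hι hm hb hp
    refine ih h' ?_
    rw [← add_sum_erase _ _ (mem_univ i₀)] at hJ ⊢
    have hrest : ∑ i ∈ univ.erase i₀, (Function.update J i₀ ((J i₀).erase p) i).card =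
        ∑ i ∈ univ.erase i₀, (J i).card := by
      refine sum_congr rfl fun i hi => ?_
      have := ne_of_mem_erase hi
      simp [this]
    rw [hrest, Function.update_self]
    have h2 : ((J i₀).erase p).card + 1 = (J i₀).card := card_erase_add_one hp
    omega

end Merge

section Initial

variable {V C : Type} [Fintype V] [DecidableEq V] [DecidableEq C]

theorem junctionWeight_le {φ : Sym2 V → C} {Cl μ γ : ℝ} (hCl : 0 < Cl) (hμ : 0 < μ) (hγ : 0 ≤ γ)
    (hn : 0 < Fintype.card V) {J : Finset (V × V)} {S S' : Finset V}
    (hJ : ∀ p ∈ J, p.1 ∈ S ∧ p.2 ∈ S') (h1 : ∀ p ∈ J, ∀ p' ∈ J, p.1 = p'.1 → p = p')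
    (h2 : ∀ p ∈ J, ∀ p' ∈ J, p.2 = p'.2 → p = p')
    (hS : ∀ c, ∑ v ∈ S, (dc φ c v : ℝ) ≤ γ * Fintype.card V)
    (hS' : ∀ c, ∑ v ∈ S', (dc φ c v : ℝ) ≤ γ * Fintype.card V)
    (hcard : (S.card : ℝ) ≤ γ * Fintype.card V) (v : V) :
    junctionWeight φ Cl μ J v ≤ 2 * γ * Fintype.card V / (Cl * μ) := by
  set n : ℝ := (Fintype.card V : ℝ) with hnV
  have hnR : 0 < n := by rw [hnV]; exact_mod_cast hn
  have hf : ∀ (f : V × V → V) (T : Finset V), (∀ p ∈ J, f p ∈ T) →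
      (∀ p ∈ J, ∀ p' ∈ J, f p = f p' → p = p') → ∀ g : V → ℝ, (∀ x, 0 ≤ g x) →
      ∑ p ∈ J, g (f p) ≤ ∑ x ∈ T, g x := by
    intro f T hT hi g hg
    rw [← sum_image (f := g) (g := f) (fun p hp p' hp' h => hi p hp p' hp' h)]
    refine sum_le_sum_of_subset_of_nonneg ?_ fun x _ _ => hg x
    exact image_subset_iff.2 hT
  have a1 : ∑ p ∈ J, sharedColours φ p.1 v ≤ n * (γ * n) :=
    (hf Prod.fst S (fun p hp => (hJ p hp).1) h1 _ fun x => sharedColours_nonneg φ x v).trans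
      (sum_sharedColours_le φ S v (by positivity) hS)
  have a2 : ∑ p ∈ J, sharedColours φ p.2 v ≤ n * (γ * n) :=
    (hf Prod.snd S' (fun p hp => (hJ p hp).2) h2 _ fun x => sharedColours_nonneg φ x v).trans
      (sum_sharedColours_le φ S' v (by positivity) hS')
  have a3 : ∑ _p ∈ J, n ≤ n * (γ * n) := by
    have h3 := hf Prod.fst S (fun p hp => (hJ p hp).1) h1 (fun _ => n) fun _ => hnR.le
    simp only [sum_const, nsmul_eq_mul] at h3 ⊢
    refine h3.trans ?_
    rw [mul_comm]
    gcongr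
  rw [junctionWeight, ← sum_div, ← mul_sum, sum_add_distrib, sum_add_distrib,
    div_le_div_iff₀ (by positivity) (by positivity)]
  have h3 : 2 * (1 / (3 * Cl)) * (∑ p ∈ J, sharedColours φ p.1 v +
      ∑ p ∈ J, sharedColours φ p.2 v + ∑ _p ∈ J, n) ≤ 2 * (1 / (3 * Cl)) * (3 * (n * (γ * n))) := by
    gcongr
    linarith
  calc _ ≤ 2 * (1 / (3 * Cl)) * (3 * (n * (γ * n))) * (Cl * μ) := by gcongr
    _ = 2 * γ * n * (μ * n) := by field_simp

theorem PathSystem.exists_mergeState {φ : Sym2 V → C} {Q : Finset C} {t k : ℕ}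
    {l : Fin t → V → Fin k} {P : Fin t → Finset (V × V)} (h : PathSystem φ Q l P) {Cl τ γ : ℝ}
    (hCl : 0 < Cl) (hτ : 0 < τ) (hγ : 0 ≤ γ) (hn : 0 < Fintype.card V) (hγτ : 2 * γ ≤ τ)
    (hfree : ∀ b i, ((freeSet (P i) b).card : ℝ) ≤ γ * Fintype.card V)
    (hcol : ∀ b i c, ∑ v ∈ freeSet (P i) b, (dc φ c v : ℝ) ≤ γ * Fintype.card V)
    (hcount : ∀ b v, ((univ.filter fun i => v ∈ freeSet (P i) b).card : ℝ) ≤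
      γ * Fintype.card V) :
    ∃ L F J, MergeState φ Q Cl τ (3 * γ * Fintype.card V)
      (2 * γ * Fintype.card V / (Cl * (16 * τ))) (fun i => undirect (P i)) L F J := by
  have hnR : (0 : ℝ) < Fintype.card V := by exact_mod_cast hn
  choose L J hL hmem hJ h1 h2 hcyc using fun i =>
    exists_list_junctions (l := fun v => (l i v : ℕ)) (h.label i) (h.out i) (h.inn i)
  refine ⟨L, fun _ => ∅, J, hL, hmem, ?_, by simp, by simp, by simp, by simp, ?_, ?_, ?_⟩
  · intro i
    refine (hcyc i).imp_of_mem fun x _ y _ hxy => ?_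
    rcases hxy with hxy | hxy
    · exact mem_union_left _ (mem_union_left _ (mem_image_of_mem (fun p => s(p.1, p.2)) hxy))
    · exact mem_union_right _ (mem_image_of_mem (fun p => s(p.1, p.2)) hxy)
  · intro i
    have : (J i).card ≤ (freeSet (P i) true).card :=
      card_le_card_of_injOn Prod.fst (fun p hp => (hJ i p hp).1)
        fun p hp p' hp' => h1 i p hp p' hp'
    have h3 : ((J i).card : ℝ) ≤ (freeSet (P i) true).card := by exact_mod_cast this
    have h4 := hfree true i
    simp only [card_empty, Nat.cast_zero]
    linarith
  · intro i
    rw [potential, ← nsmul_eq_mul, ← card_univ]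
    refine sum_le_card_nsmul _ _ _ fun v _ => Real.exp_le_exp.2 ?_
    have := junctionWeight_le (φ := φ) hCl (show 0 < 16 * τ by positivity) hγ hn (hJ i) (h1 i)
      (h2 i) (hcol true i) (hcol false i) (hfree true i) v
    simpa [colourLoss] using this
  · intro v
    have key : ∀ i, usage ∅ (J i) v ≤ (if v ∈ freeSet (P i) true then 1 else 0) +
        if v ∈ freeSet (P i) false then 1 else 0 := by
      intro i
      have haux : ∀ (f : V × V → V) (T : Finset V), (∀ p ∈ J i, f p ∈ T) →
          (∀ p ∈ J i, ∀ p' ∈ J i, f p = f p' → p = p') →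
          ((J i).filter fun p => f p = v).card ≤ if v ∈ T then 1 else 0 := by
        intro f T hT hf
        split_ifs with hv
        · refine card_le_one.2 fun p hp p' hp' => ?_
          rw [mem_filter] at hp hp'
          exact hf p hp.1 p' hp'.1 (hp.2.trans hp'.2.symm)
        · rw [Nat.le_zero, card_eq_zero, filter_eq_empty_iff]
          intro p hp hpv
          exact hv (hpv ▸ hT p hp)
      have g1 := haux Prod.fst _ (fun p hp => (hJ i p hp).1) (h1 i)
      have g2 := haux Prod.snd _ (fun p hp => (hJ i p hp).2) (h2 i)
      simp only [usage, filter_empty, card_empty, zero_add]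
      exact add_le_add g1 g2
    have hs := sum_le_sum fun i (_ : i ∈ (univ : Finset (Fin t))) => key i
    rw [sum_add_distrib, ← card_filter, ← card_filter] at hs
    have hs' : ((∑ i, usage ∅ (J i) v : ℕ) : ℝ) ≤
      ((univ.filter fun i => v ∈ freeSet (P i) true).card : ℝ) +
        (univ.filter fun i => v ∈ freeSet (P i) false).card := by exact_mod_cast hs
    have g1 := hcount true v
    have g2 := hcount false v
    have g3 := mul_le_mul_of_nonneg_right hγτ hnR.le
    linarith

/-- A family of edge-disjoint rainbow Hamilton cycles, given as cyclic orderings `L i` of the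
vertices together with sets `H i` of edges containing the consecutive pairs. -/
structure RainbowCycles (φ : Sym2 V → C) {t : ℕ} (L : Fin t → List V)
    (H : Fin t → Finset (Sym2 V)) : Prop where
  nodup : ∀ i, (L i).Nodup
  mem : ∀ i x, x ∈ L i
  cyc : ∀ i, CycRel (fun x y => s(x, y) ∈ H i) (L i)
  diag : ∀ i, ∀ e ∈ H i, ¬ e.IsDiag
  inj : ∀ i, Set.InjOn φ (H i)
  disj : ∀ i j e, e ∈ H i → e ∈ H j → i = j

theorem PathSystem.rainbowCycles {φ : Sym2 V → C} {Q : Finset C} {t k : ℕ}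
    {l : Fin t → V → Fin k} {P : Fin t → Finset (V × V)} (h : PathSystem φ Q l P)
    {Cl τ m b : ℝ} {L : Fin t → List V} {F : Fin t → Finset (Sym2 V)}
    (hM : MergeState φ Q Cl τ m b (fun i => undirect (P i)) L F fun _ => ∅) :
    RainbowCycles φ L fun i => undirect (P i) ∪ F i := by
  have hcol : ∀ i, ∀ e ∈ undirect (P i), φ e ∉ Q := by
    intro i e he
    obtain ⟨p, hp, rfl⟩ := mem_image.1 he
    exact h.col i p hp
  refine ⟨hM.nodup, hM.mem, ?_, ?_, ?_, ?_⟩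
  · intro i
    refine (hM.cyc i).imp_of_mem fun x _ y _ hxy => ?_
    simpa [undirect] using hxy
  · intro i e he
    rcases mem_union.1 he with he | he
    · obtain ⟨p, hp, rfl⟩ := mem_image.1 he
      exact h.ne i p hp
    · exact hM.diag i e he
  · intro i e he e' he' hee
    rcases mem_union.1 he with he | he <;> rcases mem_union.1 he' with he' | he'
    · obtain ⟨p, hp, rfl⟩ := mem_image.1 he
      obtain ⟨p', hp', rfl⟩ := mem_image.1 he'
      rw [h.rainbow i p hp p' hp' hee]
    · exact absurd (hee ▸ hM.col i e' he') (hcol i e he)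
    · exact absurd (hee ▸ hM.col i e he) (hcol i e' he')
    · exact hM.inj i he he' hee
  · intro i j e hi hj
    rcases mem_union.1 hi with hi | hi <;> rcases mem_union.1 hj with hj | hj
    · obtain ⟨p, hp, rfl⟩ := mem_image.1 hi
      obtain ⟨p', hp', h'⟩ := mem_image.1 hj
      exact h.disj i j p hp p' hp' h'.symm
    · exact absurd (hM.col j e hj) (hcol i e hi)
    · exact absurd (hM.col i e hi) (hcol j e hj)
    · exact hM.disj i j e hi hj

end Initial

/-- Locally bounded colourings of complete graphs contain approximately as many edge-disjoint
rainbow Hamilton cycles as the size of the colour classes permits. -/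
theorem exists_rainbowCycles {q : ℝ} (hq : 0 < q) (hq1 : q ≤ 1 / 4) : ∃ κ : ℝ, 0 < κ ∧
    ∀ (V C : Type) [Fintype V] [DecidableEq V] [Fintype C] [DecidableEq C]
      (φ : Sym2 V → C) (t : ℕ) (Cl : ℝ), 3 ≤ Fintype.card V →
      4 ≤ κ * Fintype.card V → 2 ≤ Cl → Cl * Real.log (Fintype.card V) ≤ κ * Fintype.card V →
      Cl ≤ κ * Fintype.card V →
      (∀ c v, (dc φ c v : ℝ) ≤ Cl) →
      (∀ c, ∑ v, (dc φ c v : ℝ) ≤ (1 - q) * Fintype.card V) →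
      (t : ℝ) ≤ (1 - q) * Fintype.card V / 2 → Fintype.card C ≤ Fintype.card V ^ 2 →
      100 * (Fintype.card V : ℝ) ^ 4 * Real.exp (-(κ * Fintype.card V / Cl)) < 1 →
      ∃ (L : Fin t → List V) (H : Fin t → Finset (Sym2 V)), RainbowCycles φ L H := by
  obtain ⟨τ, hτ⟩ : ∃ τ : ℝ, 2048 * τ = q ^ 3 := ⟨q ^ 3 / 2048, by ring⟩
  have hq3 : 0 < q ^ 3 := by positivity
  have hq31 : q ^ 3 ≤ 1 := pow_le_one₀ hq.le (by linarith)
  have hτ0 : 0 < τ := by linarith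
  have hτ1 : τ ≤ 1 / 2048 := by linarith
  obtain ⟨γ, hγ⟩ : ∃ γ : ℝ, 6 * γ = τ ^ 2 := ⟨τ ^ 2 / 6, by ring⟩
  have hγ0 : 0 < γ := by
    have : 0 < τ ^ 2 := by positivity
    linarith
  have hγτ : 2 * γ ≤ τ := by nlinarith
  obtain ⟨κ, hκ, k, H⟩ := exists_reserved_pathSystem hq hq1 hγ0 (by linarith)
  refine ⟨min κ (τ / 6), by positivity, ?_⟩
  intro V C _ _ _ _ φ t Cl hn h4 hCl2 hlog hClκ hdc hsum ht hC hexp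
  have hnR : (0 : ℝ) < Fintype.card V := by
    have : 0 < Fintype.card V := by omega
    exact_mod_cast this
  set n : ℝ := (Fintype.card V : ℝ) with hnV
  have m1 : min κ (τ / 6) * n ≤ κ * n := by gcongr; exact min_le_left _ _
  have m2 : min κ (τ / 6) * n ≤ τ / 6 * n := by gcongr; exact min_le_right _ _
  have hτn : τ / 6 * n ≤ τ * n := by
    have : 0 < τ * n := by positivity
    linarith
  have hCl0 : 0 < Cl := by linarith
  obtain ⟨Q, l, P, hPS, hf1, hf2, hf3, hdeg, hqr⟩ := H V C φ t Cl (by linarith) hCl2 (by linarith)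
    hdc hsum ht hC (by
      refine lt_of_le_of_lt ?_ hexp
      gcongr)
  have hγn : γ * n ≤ τ * n := by
    have : γ ≤ τ := by linarith
    gcongr
  obtain ⟨L, F, J, hM⟩ := hPS.exists_mergeState hCl0 hτ0 hγ0.le (by omega) hγτ hf1 hf2 hf3
  obtain ⟨L', F', hM'⟩ := MergeState.exists_finished (q := q) hq (by linarith) hτ hn (by linarith)
    hCl0 (by linarith) hdc (fun c => (hsum c).trans (by
      have : 0 < q * n := by positivity
      linarith)) (fun u => by
      have := (abs_le.1 (hdeg u)).1
      linarith) (fun S => by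
      refine le_trans (Nat.cast_le.2 (card_le_card ?_)) ((hqr S).trans hγn)
      intro w hw
      simp only [mem_filter, mem_univ, true_and] at hw ⊢
      linarith) (by positivity) (by
      rw [Fintype.card_fin]
      have : 0 < q * n := by positivity
      linarith) (by
      rw [← hγ]
      linarith) (by
      have e : 3 * Cl * (2 * γ * n / (Cl * (16 * τ))) = τ * n / 16 := by
        have : γ = τ ^ 2 / 6 := by linarith
        rw [this]
        field_simp
        ring
      rw [e]
      linarith) _ hM rfl
  exact ⟨L', _, hPS.rainbowCycles hM'⟩

section Walks

open SimpleGraph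

theorem exists_isHamiltonianCycle {V : Type} [Fintype V] [DecidableEq V]
    (hn : 3 ≤ Fintype.card V) {L : List V} {H : Finset (Sym2 V)} (hL : L.Nodup)
    (hmem : ∀ x, x ∈ L) (hcyc : CycRel (fun x y => s(x, y) ∈ H) L) (hH : ∀ e ∈ H, ¬ e.IsDiag) :
    ∃ (v : V) (w : (⊤ : SimpleGraph V).Walk v v), w.IsHamiltonianCycle ∧ ∀ e ∈ w.edges, e ∈ H := by
  set G : SimpleGraph V := SimpleGraph.fromEdgeSet (H : Set (Sym2 V)) with hG
  have hlen : L.length = Fintype.card V := by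
    have : L.toFinset = univ := by
      ext x
      simp [hmem x]
    rw [← List.toFinset_card_of_nodup hL, this, card_univ]
  have hadj : ∀ x y, s(x, y) ∈ H → G.Adj x y := fun x y h =>
    (fromEdgeSet_adj _).2 ⟨h, fun hxy => hH _ h hxy⟩
  have hne : L ≠ [] := by
    rintro rfl
    simp at hlen
    omega
  have hch : L.IsChain G.Adj := hcyc.1.imp fun x y h => hadj x y h
  have hlast : G.Adj (L.getLast hne) (L.head hne) := by
    refine hadj _ _ (hcyc.2 _ ?_ _ ?_)
    · simp [List.getLast?_eq_getLast_of_ne_nil hne]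
    · simp [List.head?_eq_some_head hne]
  set w : G.Walk _ _ := Walk.cons hlast (Walk.ofSupport L hne hch) with hw
  have hwl : w.length = Fintype.card V := by
    rw [hw, Walk.length_cons, Walk.length_ofSupport]
    omega
  have hwc : w.IsCycle := by
    refine Walk.isCycle_iff_isPath_tail_and_le_length.2 ⟨?_, by omega⟩
    rw [hw, Walk.isPath_def, Walk.tail_cons]
    simpa using hL
  have hwH : w.IsHamiltonianCycle :=
    Walk.isHamiltonianCycle_iff_isCycle_and_length_eq.2 ⟨hwc, hwl⟩
  refine ⟨_, w.map (Hom.ofLE le_top), hwH.map Function.bijective_id, ?_⟩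
  intro e he
  rw [Walk.edges_map, List.mem_map] at he
  obtain ⟨e', he', rfl⟩ := he
  have := w.edges_subset_edgeSet he'
  rw [hG, edgeSet_fromEdgeSet] at this
  simpa using this.1

theorem ncard_uncovered {n t : ℕ} {v : Fin t → Fin n}
    (w : ∀ i : Fin t, (⊤ : SimpleGraph (Fin n)).Walk (v i) (v i))
    (hw : ∀ i, (w i).IsHamiltonianCycle)
    (hd : ∀ i j, i ≠ j → ∀ e ∈ (w i).edges, e ∉ (w j).edges) :
    (((⊤ : SimpleGraph (Fin n)).edgeSet \ ⋃ i, {e | e ∈ (w i).edges}).ncard : ℝ) =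
      n * (n - 1) / 2 - t * n ∧
    ((⊤ : SimpleGraph (Fin n)).edgeSet.ncard : ℝ) = n * (n - 1) / 2 := by
  set U : Finset (Sym2 (Fin n)) := univ.biUnion fun i => (w i).edges.toFinset with hU
  have hUset : (⋃ i, {e | e ∈ (w i).edges}) = (U : Set (Sym2 (Fin n))) := by
    ext e
    simp [hU]
  have hUcard : U.card = t * n := by
    rw [hU, card_biUnion]
    · have : ∀ i, ((w i).edges.toFinset).card = n := by
        intro i
        rw [List.toFinset_card_of_nodup (hw i).isCycle.edges_nodup, Walk.length_edges,
          (hw i).length_eq, Fintype.card_fin]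
      simp [this]
    · intro i _ j _ hij
      refine Finset.disjoint_left.2 ?_
      intro e he
      simpa using hd i j hij e (by simpa using he)
  have hUsub : (U : Set (Sym2 (Fin n))) ⊆ (⊤ : SimpleGraph (Fin n)).edgeSet := by
    rw [← hUset]
    exact Set.iUnion_subset fun i e he => (w i).edges_subset_edgeSet he
  have htop : ((⊤ : SimpleGraph (Fin n)).edgeSet.ncard : ℝ) = n * (n - 1) / 2 := by
    rw [← coe_edgeFinset, Set.ncard_coe_finset, card_edgeFinset_top_eq_card_choose_two,
      Fintype.card_fin, Nat.cast_choose_two]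
  refine ⟨?_, htop⟩
  have h1 := Set.ncard_sdiff_add_ncard_of_subset hUsub
  rw [hUset]
  rw [Set.ncard_coe_finset, hUcard] at h1
  have h2 : ((((⊤ : SimpleGraph (Fin n)).edgeSet \ (U : Set (Sym2 (Fin n)))).ncard : ℝ)) +
      t * n = n * (n - 1) / 2 := by
    rw [← htop]
    exact_mod_cast h1
  linarith

end Walks

section Colourings

variable {n : ℕ} {C : Type} [Fintype C] [DecidableEq C]

theorem dc_eq_ncard (φ : Sym2 (Fin n) → C) (c : C) (v : Fin n) :
    dc φ c v = ({u | (⊤ : SimpleGraph (Fin n)).Adj v u ∧ φ s(v, u) = c}).ncard := by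
  rw [dc, ← Set.ncard_coe_finset]
  congr 1
  ext u
  simp [ne_comm]

theorem sum_dc_le (φ : Sym2 (Fin n) → C) (c : C) :
    ∑ v, dc φ c v ≤ 2 * (Paper.colourCls (⊤ : SimpleGraph (Fin n)) φ c).ncard := by
  rw [← card_colPairs]
  refine (card_le_mul_card_image (f := fun p : Fin n × Fin n => s(p.1, p.2)) _ 2 ?_).trans ?_
  · intro e _
    induction e using Sym2.ind with
    | _ x y =>
      have : ((colPairs φ c).filter fun p => s(p.1, p.2) = s(x, y)) ⊆ {(x, y), (y, x)} := by
        rintro ⟨a, b⟩ hp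
        have := (mem_filter.1 hp).2
        simpa using this
      exact (card_le_card this).trans card_le_two
  · refine Nat.mul_le_mul_left _ ?_
    rw [← Set.ncard_coe_finset]
    refine Set.ncard_le_ncard ?_ (Set.toFinite _)
    intro e he
    obtain ⟨p, hp, rfl⟩ := mem_image.1 (mem_coe.1 he)
    have := (mem_filter.1 hp).2
    exact ⟨by simpa using this.1, this.2⟩

end Colourings

open Filter in
theorem eventually_large {κ ε : ℝ} (hκ : 0 < κ) (hε : 0 < ε) :
    ∃ n₀ : ℕ, ∀ n : ℕ, n₀ ≤ n → 101 ≤ n ∧ 1 ≤ Real.log n ∧ 10 * Real.log n ≤ κ * n ∧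
      4 ≤ κ * n ∧ 4 ≤ ε * n := by
  have hcast := tendsto_natCast_atTop_atTop (R := ℝ)
  have h1 : ∀ᶠ n : ℕ in atTop, 1 ≤ Real.log n :=
    (Real.tendsto_log_atTop.comp hcast).eventually_ge_atTop 1
  have h2 : ∀ᶠ n : ℕ in atTop, 10 * Real.log n ≤ κ * n := by
    have h := (Real.isLittleO_log_id_atTop.comp_tendsto hcast).bound (show 0 < κ / 10 by positivity)
    filter_upwards [h] with n hn
    have h3 := (le_abs_self _).trans hn
    simp only [Function.comp, id, Real.norm_natCast] at h3
    linarith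
  have h3 : ∀ {δ : ℝ}, 0 < δ → ∀ᶠ n : ℕ in atTop, 4 ≤ δ * n := fun hδ =>
    (hcast.const_mul_atTop hδ).eventually_ge_atTop 4
  obtain ⟨n₀, h⟩ := eventually_atTop.1
    ((eventually_ge_atTop 101).and (h1.and (h2.and ((h3 hκ).and (h3 hε)))))
  exact ⟨n₀, fun n hn => h n hn⟩

theorem exp_numeric {n κ Cl : ℝ} (hn : 101 ≤ n) (hCl : 0 < Cl)
    (h : 5 * (Cl * Real.log n) ≤ κ * n) :
    100 * n ^ 4 * Real.exp (-(κ * n / Cl)) < 1 := by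
  have hn0 : 0 < n := by linarith
  have h1 : 5 * Real.log n ≤ κ * n / Cl := by
    rw [le_div_iff₀ hCl]
    linarith
  have h2 : Real.exp (-(κ * n / Cl)) ≤ (n ^ 5)⁻¹ := by
    calc _ ≤ Real.exp (-(5 * Real.log n)) := Real.exp_le_exp.2 (by linarith)
      _ = (n ^ 5)⁻¹ := by
        rw [Real.exp_neg, show (5 : ℝ) * Real.log n = Real.log (n ^ 5) by
          rw [Real.log_pow]; norm_num, Real.exp_log (by positivity)]
  calc _ ≤ 100 * n ^ 4 * (n ^ 5)⁻¹ := by gcongr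
    _ = 100 / n := by field_simp
    _ < 1 := by
      rw [div_lt_one hn0]
      linarith

theorem exists_hamiltonianCycles_of_rainbowCycles {n t : ℕ} (hn : 3 ≤ n) {C : Type}
    {φ : Sym2 (Fin n) → C} {L : Fin t → List (Fin n)} {H : Fin t → Finset (Sym2 (Fin n))}
    (h : RainbowCycles φ L H) :
    ∃ (v : Fin t → Fin n) (w : ∀ i : Fin t, (⊤ : SimpleGraph (Fin n)).Walk (v i) (v i)),
      (∀ i, (w i).IsHamiltonianCycle) ∧ (∀ i, ((w i).edges.map φ).Nodup) ∧
      (∀ i j, i ≠ j → ∀ e ∈ (w i).edges, e ∉ (w j).edges) := by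
  choose v w hw hwH using fun i => exists_isHamiltonianCycle (by simpa using hn) (h.nodup i)
    (h.mem i) (h.cyc i) (h.diag i)
  refine ⟨v, w, hw, fun i => ?_, fun i j hij e hi hj => ?_⟩
  · exact List.Nodup.map_on (fun x hx y hy hxy => h.inj i (hwH i x hx) (hwH i y hy) hxy)
      (hw i).isCycle.edges_nodup
  · exact hij (h.disj i j e (hwH i e hi) (hwH j e hj))

end RainbowHam

open Paper

/-- Corollary 1.3: any `(1-ε)n/2`-bounded, locally `ηn/log⁴n`-bounded edge-colouring of
`K_n` has an `ε`-decomposition into rainbow Hamilton cycles. -/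
theorem stmt_2 :
    ∀ ε : ℝ, 0 < ε →
    ∃ η : ℝ, 0 < η ∧ ∃ n₀ : ℕ, ∀ n : ℕ, n₀ ≤ n →
    ∀ φ : Sym2 (Fin n) → ℕ,
      GBounded (⊤ : SimpleGraph (Fin n)) φ ((1 - ε) * n / 2) →
      LBounded (⊤ : SimpleGraph (Fin n)) φ (η * n / (Real.log n) ^ 4) →
      ∃ (t : ℕ) (v : Fin t → Fin n)
        (w : ∀ i : Fin t, (⊤ : SimpleGraph (Fin n)).Walk (v i) (v i)),
        (∀ i, (w i).IsHamiltonianCycle) ∧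
        (∀ i, ((w i).edges.map φ).Nodup) ∧
        (∀ i j, i ≠ j → ∀ e ∈ (w i).edges, e ∉ (w j).edges) ∧
        (((⊤ : SimpleGraph (Fin n)).edgeSet \ ⋃ i, {e | e ∈ (w i).edges}).ncard : ℝ)
          ≤ ε * ((⊤ : SimpleGraph (Fin n)).edgeSet.ncard : ℝ) := by
  intro ε hε
  by_cases hε1 : 1 ≤ ε
  · refine ⟨1, one_pos, 0, fun n _ φ _ _ => ⟨0, Fin.elim0, fun i => i.elim0, fun i => i.elim0,
      fun i => i.elim0, fun i => i.elim0, ?_⟩⟩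
    have h1 : (((⊤ : SimpleGraph (Fin n)).edgeSet \ ⋃ i : Fin 0,
        {e | e ∈ ((Fin.elim0 i : (⊤ : SimpleGraph (Fin n)).Walk (Fin.elim0 i)
          (Fin.elim0 i))).edges}).ncard : ℝ) ≤ (⊤ : SimpleGraph (Fin n)).edgeSet.ncard :=
      Nat.cast_le.2 (Set.ncard_le_ncard Set.sdiff_subset (Set.toFinite _))
    exact h1.trans (le_mul_of_one_le_left (Nat.cast_nonneg _) hε1)
  have hε1 : ε < 1 := not_le.1 hε1
  obtain ⟨κ, hκ, hmain⟩ := RainbowHam.exists_rainbowCycles (q := ε / 8) (by positivity)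
    (by linarith)
  obtain ⟨n₀, hn₀⟩ := RainbowHam.eventually_large hκ hε
  refine ⟨κ / 5, by positivity, n₀, fun n hn φ hG hL => ?_⟩
  obtain ⟨hn101, hlog1, hlogn, hκn, hεn⟩ := hn₀ n hn
  have hnR : (101 : ℝ) ≤ n := by exact_mod_cast hn101
  set Cl : ℝ := max 2 (κ / 5 * n / Real.log n ^ 4) with hCl
  have hCl2 : 2 ≤ Cl := le_max_left _ _
  have hClog : 5 * (Cl * Real.log n) ≤ κ * n := by
    rcases max_choice 2 (κ / 5 * n / Real.log n ^ 4) with h | h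
    · rw [hCl, h]
      linarith
    · rw [hCl, h]
      have h1 : κ / 5 * n / Real.log n ^ 4 * Real.log n = κ / 5 * n / Real.log n ^ 3 := by
        field_simp
      have h2 : κ / 5 * n / Real.log n ^ 3 ≤ κ / 5 * n :=
        div_le_self (by positivity) (one_le_pow₀ hlog1)
      rw [h1]
      linarith
  have hCllog0 : 0 ≤ Cl * Real.log n := by positivity
  have hClle : Cl ≤ Cl * Real.log n := le_mul_of_one_le_right (by linarith) hlog1
  let ψ : Sym2 (Fin n) → (Finset.univ.image φ : Finset ℕ) := fun e =>
    ⟨φ e, Finset.mem_image_of_mem _ (Finset.mem_univ e)⟩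
  have hψ : ∀ e c, ψ e = c ↔ φ e = c := fun e c => Subtype.ext_iff
  set t : ℕ := ⌊(1 - ε / 8) * n / 2⌋₊ with ht
  have ht0 : 0 ≤ (1 - ε / 8) * n / 2 := by
    have : 0 ≤ 1 - ε / 8 := by linarith
    positivity
  have ht1 : (t : ℝ) ≤ (1 - ε / 8) * n / 2 := Nat.floor_le ht0
  have ht2 : (1 - ε / 8) * n / 2 < t + 1 := Nat.lt_floor_add_one _
  obtain ⟨L, H, hLH⟩ := hmain (Fin n) (Finset.univ.image φ : Finset ℕ) ψ t Cl
    (by rw [Fintype.card_fin]; omega)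
    (by rw [Fintype.card_fin]; exact hκn)
    hCl2
    (by rw [Fintype.card_fin]; linarith)
    (by rw [Fintype.card_fin]; linarith)
    (fun c v => by
      rw [RainbowHam.dc_eq_ncard]
      simp only [hψ]
      exact (hL v c).trans (le_max_right _ _))
    (fun c => by
      have h1 := RainbowHam.sum_dc_le ψ c
      have h2 : ((∑ v, RainbowHam.dc ψ c v : ℕ) : ℝ) ≤
          ((2 * (colourCls (⊤ : SimpleGraph (Fin n)) ψ c).ncard : ℕ) : ℝ) := Nat.cast_le.2 h1
      have h3 := hG c
      have h4 : colourCls (⊤ : SimpleGraph (Fin n)) ψ c =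
          colourCls (⊤ : SimpleGraph (Fin n)) φ c := by
        simp only [colourCls, hψ]
      rw [h4] at h2
      push_cast at h2
      rw [Fintype.card_fin]
      have h5 : 0 ≤ ε * n := by positivity
      linarith)
    (by rw [Fintype.card_fin]; exact ht1)
    (by
      rw [Fintype.card_coe, Fintype.card_fin]
      refine Finset.card_image_le.trans ?_
      rw [Finset.card_univ, Sym2.card, Fintype.card_fin, Nat.choose_two_right]
      have : (n + 1) * (n + 1 - 1) ≤ 2 * n ^ 2 := by
        rw [Nat.add_sub_cancel]
        nlinarith
      omega)
    (by
      rw [Fintype.card_fin]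
      exact RainbowHam.exp_numeric hnR (by linarith) hClog)
  obtain ⟨v, w, h1, h2, h3⟩ :=
    RainbowHam.exists_hamiltonianCycles_of_rainbowCycles (by omega) hLH
  refine ⟨t, v, w, h1, fun i => ?_, h3, ?_⟩
  · refine List.Nodup.of_map (fun c => c) ?_
    have h4 : (w i).edges.map φ = ((w i).edges.map ψ).map Subtype.val := by
      rw [List.map_map]
      rfl
    rw [List.map_id', h4]
    exact (h2 i).map Subtype.val_injective
  · obtain ⟨h4, h5⟩ := RainbowHam.ncard_uncovered w h1 h3
    rw [h4, h5]
    have h6 : ((1 - ε / 8) * n / 2 - 1) * n ≤ t * n := by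
      have : (1 - ε / 8) * n / 2 - 1 ≤ (t : ℝ) := by linarith
      gcongr
    have h7 : 0 ≤ (n : ℝ) * (ε * n * (7 / 8) - 1 - ε) :=
      mul_nonneg (by linarith) (by linarith)
    nlinarith
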